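/- Let s ∈ (0,1) be irrational. For each of the four directions (1,0), (0,1), (1,1), (1,−1) (the directions of the 8th roots of unity), the orthogonal projection of the limit set Λ̂_s onto a line in that direction contains a nondegenerate line segment; consequently the Hausdorff dimension of Λ̂_s is at least 1. Moreover, Λ̂_s is not contained in any finite union of lines. -/

import Mathlib

noncomputable section

open Set Topology Filter

/-- The parallelogram `X_s = F₁(s)`, centered at the origin and spanned by the
vectors `(2,0)` and `(2s,2s)`. -/
def F1 (s : ℝ) : Set (ℝ × ℝ) :=
  {p | ∃ a b : ℝ, a ∈ Icc (-(1:ℝ)/2) (1/2) ∧ b ∈ Icc (-(1:ℝ)/2) (1/2) ∧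
    p = (2 * a + 2 * s * b, 2 * s * b)}

/-- Rotation by `π/2` about the origin. -/
def rotQ (p : ℝ × ℝ) : ℝ × ℝ := (-p.2, p.1)

/-- `F₂(s)`, the image of `F₁(s)` under rotation by `π/2` about the origin. -/
def F2 (s : ℝ) : Set (ℝ × ℝ) := rotQ '' F1 s

/-- The lattice `L₁` generated by `(0,2)` and `(2s,2s)`. -/
def L1 (s : ℝ) : Set (ℝ × ℝ) :=
  {v | ∃ m n : ℤ, v = (2 * s * n, 2 * m + 2 * s * n)}

/-- The lattice `L₂` generated by `(2,0)` and `(2s,−2s)`. -/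
def L2 (s : ℝ) : Set (ℝ × ℝ) :=
  {v | ∃ m n : ℤ, v = (2 * m + 2 * s * n, -(2 * s * n))}

/-- `F_j` indexed by `Fin 2` (index `0` is `F₁`, index `1` is `F₂`). -/
def FF (s : ℝ) : Fin 2 → Set (ℝ × ℝ) := fun j => if j = 0 then F1 s else F2 s

/-- `L_j` indexed by `Fin 2` (index `0` is `L₁`, index `1` is `L₂`). -/
def LL (s : ℝ) : Fin 2 → Set (ℝ × ℝ) := fun j => if j = 0 then L1 s else L2 s

/-- One application of the map `f′`, as a relation: `StepRel s p q` holds iff `p ∈ F_j`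
for some `j`, there is a unique `v ∈ L_{3−j}` with `p + v ∈ F_{3−j}`, and `q = p + v`
(i.e. `q − p ∈ L_{3−j}` and `q ∈ F_{3−j}`).  `f′` is undefined where the translation
is not unique. -/
def StepRel (s : ℝ) (p q : ℝ × ℝ) : Prop :=
  ∃ j : Fin 2, p ∈ FF s j ∧ (∃! v, v ∈ LL s (j + 1) ∧ p + v ∈ FF s (j + 1)) ∧
    q - p ∈ LL s (j + 1) ∧ q ∈ FF s (j + 1)

/-- The octagonal PET map `f_s = (f′)²`, as a relation. -/
def MapRel (s : ℝ) (p q : ℝ × ℝ) : Prop := ∃ r, StepRel s p r ∧ StepRel s r q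

/-- `n`-fold iteration of the (partially defined) map `f_s`, as a relation. -/
def IterRel (s : ℝ) : ℕ → ℝ × ℝ → ℝ × ℝ → Prop
  | 0, p, q => p = q
  | n + 1, p, q => ∃ r, IterRel s n p r ∧ MapRel s r q

/-- A convex polygon: the convex hull of a finite set of points, with nonempty interior. -/
def IsConvexPolygon (P : Set (ℝ × ℝ)) : Prop :=
  (∃ V : Finset (ℝ × ℝ), P = convexHull ℝ (V : Set (ℝ × ℝ))) ∧ (interior P).Nonempty

/-- A periodic tile of `(X_s, f_s)`: a maximal convex polygon in `X_s` on whose interior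
`f_s` and all its iterates are defined and periodic. -/
def IsPeriodicTile (s : ℝ) (P : Set (ℝ × ℝ)) : Prop :=
  IsConvexPolygon P ∧ P ⊆ F1 s ∧
    (∃ n, 0 < n ∧ ∀ p ∈ interior P, IterRel s n p p) ∧
    ∀ Q, IsConvexPolygon Q → Q ⊆ F1 s →
      (∃ n, 0 < n ∧ ∀ p ∈ interior Q, IterRel s n p p) → P ⊆ Q → P = Q

/-- The tiling `Δ_s`: the collection of all periodic tiles. -/
def tiles (s : ℝ) : Set (Set (ℝ × ℝ)) := {P | IsPeriodicTile s P}

/-- The limit set `Λ̂_s`: points of `X_s` every neighborhood of which meets infinitely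
many tiles of `Δ_s`. -/
def limitSet (s : ℝ) : Set (ℝ × ℝ) :=
  {p | p ∈ F1 s ∧ ∀ U ∈ 𝓝 p, {P ∈ tiles s | (U ∩ P).Nonempty}.Infinite}

/-- The renormalization map `R`. -/
def Rmap (x : ℝ) : ℝ :=
  if x < 1 / 2 then 1 / (2 * x) - (⌊1 / (2 * x)⌋ : ℤ) else 1 - x

/-- The central tiles of `Δ_s`: for `s > 1/2` the single octagon `F₁ ∩ F₂`; for
`s ≤ 1/2` the squares of the grid generated by the square `F₁ ∩ F₂` that lie in `X_s`. -/
def centralTiles (s : ℝ) : Set (Set (ℝ × ℝ)) :=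
  if 1 / 2 < s then {F1 s ∩ F2 s}
  else {T | (∃ m n : ℤ,
        T = (fun p : ℝ × ℝ => (p.1 + 2 * s * m, p.2 + 2 * s * n)) '' (F1 s ∩ F2 s)) ∧
      T ⊆ F1 s}

/-- The portion of a set `S ⊆ X_s` lying to the left of the central tiles of `Δ_s`
(the closure of the set of points of `S` lying strictly to the left of every point of
every central tile). -/
def leftPart (s : ℝ) (S : Set (ℝ × ℝ)) : Set (ℝ × ℝ) :=
  closure {p ∈ S | ∀ T ∈ centralTiles s, ∀ q ∈ T, p.1 < q.1}

/-- `X_s⁰`, the left half of `X_s`. -/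
def Xzero (s : ℝ) : Set (ℝ × ℝ) := leftPart s (F1 s)

/-- `S_s = Λ̂_s ∩ X_s⁰`, the left half of the limit set. -/
def leftLimitSet (s : ℝ) : Set (ℝ × ℝ) := limitSet s ∩ Xzero s

/-- Dot product in the plane. -/
def dot2 (v w : ℝ × ℝ) : ℝ := v.1 * w.1 + v.2 * w.2

/-- Cross product (signed area form) in the plane. -/
def cross2 (v w : ℝ × ℝ) : ℝ := v.1 * w.2 - v.2 * w.1

/-- The Euclidean distance on `ℝ × ℝ`. -/
def eudist (p q : ℝ × ℝ) : ℝ := Real.sqrt ((p.1 - q.1) ^ 2 + (p.2 - q.2) ^ 2)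

/-- A (solid) square in the plane. -/
def IsSquareSet (P : Set (ℝ × ℝ)) : Prop :=
  ∃ p v w : ℝ × ℝ, dot2 v w = 0 ∧ dot2 v v = dot2 w w ∧ v ≠ 0 ∧
    P = {q | ∃ a b : ℝ, a ∈ Icc (0:ℝ) 1 ∧ b ∈ Icc (0:ℝ) 1 ∧ q = p + a • v + b • w}

/-- Rotation by `π/4` about the origin. -/
def rot45 (v : ℝ × ℝ) : ℝ × ℝ :=
  ((v.1 - v.2) / Real.sqrt 2, (v.1 + v.2) / Real.sqrt 2)

/-- A (solid) semi-regular octagon: a convex octagon whose interior angles all equal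
`3π/4` (so consecutive edge directions differ by rotation by `π/4`) and whose side
lengths alternate between two values `a` and `b`. -/
def IsSemiregularOctagon (P : Set (ℝ × ℝ)) : Prop :=
  ∃ (p u : ℝ × ℝ) (a b : ℝ), dot2 u u = 1 ∧ 0 < a ∧ 0 < b ∧
    P = convexHull ℝ (Set.range fun k : Fin 8 =>
      p + ∑ i ∈ Finset.range k.1, (if Even i then a else b) • rot45^[i] u)

/-- A box: a square with sides parallel to the coordinate axes. -/
def IsBox (P : Set (ℝ × ℝ)) : Prop :=
  ∃ (p : ℝ × ℝ) (c : ℝ), 0 < c ∧ P = Icc p (p + (c, c))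

/-- A diamond: a square whose sides have slope `±1`. -/
def IsDiamond (P : Set (ℝ × ℝ)) : Prop :=
  ∃ (p : ℝ × ℝ) (c : ℝ), 0 < c ∧
    P = convexHull ℝ {p + (c, 0), p - (c, 0), p + (0, c), p - (0, c)}

/-- The horizontal fundamental line of symmetry `H : y = 0`. -/
def lineH : Set (ℝ × ℝ) := {p | p.2 = 0}

/-- The vertical fundamental line of symmetry `V : x = −1`. -/
def lineV : Set (ℝ × ℝ) := {p | p.1 = -1}

/-- The fundamental line of symmetry `D_s`, of slope `−1` through `(−s,−s)`. -/
def lineD (s : ℝ) : Set (ℝ × ℝ) := {p | p.1 + p.2 = -2 * s}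

/-- The fundamental line of symmetry `E_s`: for `s ≤ 1/2` the line of slope `−1`
through `(−3s,−3s)`, for `s > 1/2` the line of slope `1` through `(−s,−s)`. -/
def lineE (s : ℝ) : Set (ℝ × ℝ) :=
  if s ≤ 1 / 2 then {p | p.1 + p.2 = -6 * s} else {p | p.2 = p.1}

/-- A line in the plane. -/
def IsLine (L : Set (ℝ × ℝ)) : Prop :=
  ∃ p v : ℝ × ℝ, v ≠ 0 ∧ L = {q | ∃ t : ℝ, q = p + t • v}

namespace OctPET

/-- `Run R l x y`: the list of codes `l` leads from `x` to `y` through the coded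
transition relation `R`. -/
def Run {C P : Type*} (R : C → P → P → Prop) : List C → P → P → Prop
  | [], x, y => x = y
  | c :: l, x, y => ∃ m, R c x m ∧ Run R l m y

/-- The reversed transition relation. -/
def Rev {C P : Type*} (R : C → P → P → Prop) : C → P → P → Prop := fun c x y => R c y x

/-- The source determines the code and the target. -/
def Det {C P : Type*} (R : C → P → P → Prop) : Prop :=
  ∀ c c' z m m', R c z m → R c' z m' → c = c' ∧ m = m'

section Run

variable {C C' P P' : Type*} {R : C → P → P → Prop} {R' : C' → P' → P' → Prop}

theorem run_append {l₁ l₂ : List C} {z z' : P} :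
    Run R (l₁ ++ l₂) z z' ↔ ∃ m, Run R l₁ z m ∧ Run R l₂ m z' := by
  induction l₁ generalizing z with
  | nil => simp [Run]
  | cons c l ih =>
    simp only [List.cons_append, Run, ih]
    constructor
    · rintro ⟨m, h, m', h1, h2⟩; exact ⟨m', ⟨m, h, h1⟩, h2⟩
    · rintro ⟨m', ⟨m, h, h1⟩, h2⟩; exact ⟨m, h, m', h1, h2⟩

theorem run_singleton {c : C} {z z' : P} : Run R [c] z z' ↔ R c z z' := by
  simp [Run]

theorem run_rev {l : List C} {z z' : P} : Run (Rev R) l z z' ↔ Run R l.reverse z' z := by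
  induction l generalizing z with
  | nil => simp [Run, eq_comm]
  | cons c l ih =>
    rw [List.reverse_cons, run_append]
    simp only [Run, ih, Rev]
    constructor
    · rintro ⟨m, h, h1⟩; exact ⟨m, h1, _, h, rfl⟩
    · rintro ⟨m, h1, _, h, rfl⟩; exact ⟨m, h, h1⟩

theorem run_prefix (hD : Det R) {l l' : List C} {z m m' : P} (h : Run R l z m)
    (h' : Run R l' z m') (hl : l.length ≤ l'.length) : ∃ l₂, l' = l ++ l₂ ∧ Run R l₂ m m' := by
  induction l generalizing z l' with
  | nil => cases h; exact ⟨l', rfl, h'⟩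
  | cons c l ih =>
    cases l' with
    | nil => simp at hl
    | cons c' l' =>
      obtain ⟨k, hk, hr⟩ := h
      obtain ⟨k', hk', hr'⟩ := h'
      obtain ⟨rfl, rfl⟩ := hD _ _ _ _ _ hk hk'
      obtain ⟨l₂, rfl, h2⟩ := ih hr hr' (by simpa using hl)
      exact ⟨l₂, rfl, h2⟩

theorem run_suffix (hI : Det (Rev R)) {l l' : List C} {z z' m : P} (h : Run R l z m)
    (h' : Run R l' z' m) (hl : l.length ≤ l'.length) : ∃ l₁, l' = l₁ ++ l ∧ Run R l₁ z' z := by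
  have h1 : Run (Rev R) l.reverse m z := run_rev.2 (by simpa using h)
  have h2 : Run (Rev R) l'.reverse m z' := run_rev.2 (by simpa using h')
  obtain ⟨l₂, e, h3⟩ := run_prefix hI h1 h2 (by simpa using hl)
  refine ⟨l₂.reverse, ?_, run_rev.1 h3⟩
  have := congrArg List.reverse e
  simpa using this

theorem run_source_unique (hI : Det (Rev R)) {l : List C} {z z' m : P} (h : Run R l z m)
    (h' : Run R l z' m) : z = z' := by
  obtain ⟨l₂, e, h2⟩ := run_suffix hI h h' le_rfl
  obtain rfl : l₂ = [] := by simpa using e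
  exact h2.symm

theorem run_lift {ψ : P' → P} {L : C' → List C}
    (hL : ∀ c q q', R' c q q' → Run R (L c) (ψ q) (ψ q')) {l : List C'} {q q' : P'}
    (h : Run R' l q q') : Run R (l.flatMap L) (ψ q) (ψ q') := by
  induction l generalizing q with
  | nil => cases h; rfl
  | cons c l ih =>
    obtain ⟨m, h1, h2⟩ := h
    rw [List.flatMap_cons, run_append]
    exact ⟨_, hL _ _ _ h1, ih h2⟩

theorem odd_length_flatMap {L : C' → List C} (hL : ∀ c, Odd (L c).length) {l : List C'}
    (h : Odd l.length) : Odd (l.flatMap L).length := by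
  have key : ∀ l : List C', (Odd (l.flatMap L).length ↔ Odd l.length) := by
    intro l
    induction l with
    | nil => simp
    | cons c l ih =>
      rw [List.flatMap_cons, List.length_append, List.length_cons, Nat.odd_add, Nat.odd_add]
      have := hL c
      simp only [← Nat.not_odd_iff_even, ih, this, true_iff, odd_one]
      tauto
  exact (key l).2 h

/-- The `k`-fold repetition of a list. -/
def rep {C : Type*} (k : ℕ) (l : List C) : List C := (List.replicate k l).flatten

theorem rep_succ (k : ℕ) (l : List C) : rep (k + 1) l = l ++ rep k l := by
  simp [rep, List.replicate_succ]

theorem length_rep (k : ℕ) (l : List C) : (rep k l).length = k * l.length := by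
  simp [rep]

theorem run_rep {l : List C} {z : P} (h : Run R l z z) (k : ℕ) : Run R (rep k l) z z := by
  induction k with
  | zero => rfl
  | succ k ih => rw [rep_succ, run_append]; exact ⟨z, h, ih⟩

/-- A point with a closed orbit of odd length. -/
def Good (R : C → P → P → Prop) (p : P) : Prop := ∃ l, Odd l.length ∧ Run R l p p

/-- Two points which run periodically through the same nonempty list of codes. -/
def PairLoop (R : C → P → P → Prop) (z p : P) : Prop := ∃ l, l ≠ [] ∧ Run R l z z ∧ Run R l p p

/-- Two points which have the same next code. -/
def Agree (R : C → P → P → Prop) (z p : P) : Prop := ∃ c z' p', R c z z' ∧ R c p p'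

theorem good_rev {p : P} (h : Good R p) : Good (Rev R) p := by
  obtain ⟨l, h1, h2⟩ := h
  exact ⟨l.reverse, by simpa using h1, run_rev.2 (by simpa using h2)⟩

theorem pairLoop_rev {z p : P} (h : PairLoop R z p) : PairLoop (Rev R) z p := by
  obtain ⟨l, h0, h1, h2⟩ := h
  exact ⟨l.reverse, by simpa using h0, run_rev.2 (by simpa using h1),
    run_rev.2 (by simpa using h2)⟩

theorem agree_of_pairLoop {z p : P} (h : PairLoop R z p) : Agree R z p := by
  obtain ⟨l, h0, h1, h2⟩ := h
  cases l with
  | nil => exact absurd rfl h0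
  | cons c l =>
    obtain ⟨m, a, -⟩ := h1
    obtain ⟨m', b, -⟩ := h2
    exact ⟨c, m, m', a, b⟩

theorem agree_of_run {l : List C} (hl : l ≠ []) {z p z' p' : P} (h1 : Run R l z z')
    (h2 : Run R l p p') : Agree R z p := by
  cases l with
  | nil => exact absurd rfl hl
  | cons c l =>
    obtain ⟨m, a, -⟩ := h1
    obtain ⟨m', b, -⟩ := h2
    exact ⟨c, m, m', a, b⟩

theorem agree_rev_of_run {l : List C} (hl : l ≠ []) {z p z' p' : P} (h1 : Run R l z z')
    (h2 : Run R l p p') : Agree (Rev R) z' p' :=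
  agree_of_run (l := l.reverse) (by simpa using hl) (run_rev.2 (by simpa using h1))
    (run_rev.2 (by simpa using h2))

theorem good_of_run_good (hI : Det (Rev R)) {l : List C} {p q : P} (h : Run R l p q)
    (hq : Good R q) : Good R p := by
  obtain ⟨W, hW, hr⟩ := hq
  have h1 := run_rep hr (2 * l.length + 1)
  have hpos : 1 ≤ W.length := hW.pos
  obtain ⟨X, e, hX⟩ := run_suffix hI h h1 (by rw [length_rep]; nlinarith)
  refine ⟨l ++ X, ?_, run_append.2 ⟨q, h, hX⟩⟩
  have := congrArg List.length e
  rw [length_rep, List.length_append] at this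
  rw [List.length_append, add_comm, ← this]
  exact (odd_two_mul_add_one _).mul hW

theorem good_of_good_run (hD : Det R) {l : List C} {p q : P} (h : Run R l p q)
    (hq : Good R p) : Good R q :=
  good_rev (R := Rev R) (good_of_run_good (R := Rev R) hD (l := l.reverse)
    (run_rev.2 (by simpa using h)) (good_rev hq))

/-- A pair of periodic points can be pulled back along a run of the first point. -/
theorem pairLoop_pull (hI : Det (Rev R)) {l : List C} {z q q' : P} (h : Run R l z q)
    (hq : PairLoop R q q') : ∃ p, Run R l p q' ∧ PairLoop R z p := by
  obtain ⟨W, hW, hr, hr'⟩ := hq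
  have h1 := run_rep hr (l.length + 1)
  have h1' := run_rep hr' (l.length + 1)
  have hpos : 1 ≤ W.length := List.length_pos_iff.2 hW
  obtain ⟨X, e, hX⟩ := run_suffix hI h h1 (by rw [length_rep]; nlinarith)
  rw [e] at h1'
  obtain ⟨p, hp1, hp2⟩ := run_append.1 h1'
  refine ⟨p, hp2, l ++ X, ?_, run_append.2 ⟨_, h, hX⟩, run_append.2 ⟨_, hp2, hp1⟩⟩
  intro h0
  have := congrArg List.length e
  rw [length_rep] at this
  have h00 : X ++ l = [] := by
    rw [List.append_eq_nil_iff] at h0 ⊢; exact h0.symm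
  rw [h00] at this
  simp at this
  exact hW this

end Run

/-- The point `z` has the same next code as a point with a closed orbit of odd length
which is either on the same periodic itinerary or `ε`-close to `z`. -/
def Approx {C P : Type*} [Dist P] (R : C → P → P → Prop) (z : P) (ε : ℝ) : Prop :=
  ∃ p, Good R p ∧ Agree R z p ∧ (PairLoop R z p ∨ dist z p ≤ ε)

/-- Points with the same code stay at the same distance. -/
def Iso {C P : Type*} [Dist P] (R : C → P → P → Prop) : Prop :=
  ∀ c z z' p p', R c z z' → R c p p' → dist z' p' = dist z p

section Approx

variable {C C' P : Type*} {R : C → P → P → Prop} {R' : C' → P → P → Prop}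

theorem pairLoop_lift {ψ : P → P} {L : C' → List C} (hL : ∀ c, Odd (L c).length)
    (hψ : ∀ c q q', R' c q q' → Run R (L c) (ψ q) (ψ q')) {z p : P} (h : PairLoop R' z p) :
    PairLoop R (ψ z) (ψ p) := by
  obtain ⟨l, h0, h1, h2⟩ := h
  refine ⟨_, ?_, run_lift hψ h1, run_lift hψ h2⟩
  intro h3
  cases l with
  | nil => exact h0 rfl
  | cons c l =>
    rw [List.flatMap_cons, List.append_eq_nil_iff] at h3
    have := (hL c).pos
    rw [h3.1] at this
    simp at this

theorem good_lift {ψ : P → P} {L : C' → List C} (hL : ∀ c, Odd (L c).length)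
    (hψ : ∀ c q q', R' c q q' → Run R (L c) (ψ q) (ψ q')) {p : P} (h : Good R' p) :
    Good R (ψ p) := by
  obtain ⟨l, h0, h1⟩ := h
  exact ⟨_, odd_length_flatMap hL h0, run_lift hψ h1⟩

theorem exists_excursion (hI : Det (Rev R)) {ψ : P → P} {L : C' → List C}
    (hL : ∀ c, Odd (L c).length)
    (hψ : ∀ c q q', R' c q q' → Run R (L c) (ψ q) (ψ q')) {G : P → Prop}
    (hpred : ∀ q, G q → ∃ c q', G q' ∧ R' c q' q) :
    ∀ (n : ℕ) (l : List C) (z q' : P), l.length = n → G q' → Run R l z (ψ q') →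
      ∃ c q q' l₁ l₂, G q ∧ G q' ∧ R' c q q' ∧ L c = l₁ ++ l₂ ∧ l₁ ≠ [] ∧
        Run R l₁ (ψ q) z ∧ Run R l₂ z (ψ q') := by
  intro n
  induction n using Nat.strong_induction_on with
  | _ n ih =>
    intro l z q' hl hq' hrun
    obtain ⟨c, q, hq, hstep⟩ := hpred q' hq'
    have hr := hψ _ _ _ hstep
    rcases lt_or_ge l.length (L c).length with h | h
    · obtain ⟨l₁, e, h1⟩ := run_suffix hI hrun hr h.le
      refine ⟨c, q, q', l₁, l, hq, hq', hstep, e, ?_, h1, hrun⟩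
      rintro rfl
      rw [e] at h
      simp at h
    · obtain ⟨l₁, e, h1⟩ := run_suffix hI hr hrun h
      have := (hL c).pos
      refine ih l₁.length ?_ l₁ z q rfl hq h1
      rw [← hl, e, List.length_append]; omega

variable [Dist P]

theorem run_dist (hR : Iso R) {l : List C} {z z' p p' : P} (h : Run R l z z')
    (h' : Run R l p p') : dist z' p' = dist z p := by
  induction l generalizing z p with
  | nil => cases h; cases h'; rfl
  | cons c l ih =>
    obtain ⟨m, h1, h2⟩ := h
    obtain ⟨m', h1', h2'⟩ := h'
    rw [ih h2 h2', hR _ _ _ _ _ h1 h1']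

theorem approx_of_pairLoop {z p : P} (hg : Good R p) (h : PairLoop R z p) (ε : ℝ) :
    Approx R z ε :=
  ⟨p, hg, agree_of_pairLoop h, Or.inl h⟩

theorem approx_lift (hI : Det (Rev R)) (hI' : Det (Rev R')) (hiso : Iso R)
    {ψ : P → P} {L : C' → List C} (hL : ∀ c, Odd (L c).length)
    (hψ : ∀ c q q', R' c q q' → Run R (L c) (ψ q) (ψ q'))
    (hψd : ∀ q q', dist (ψ q) (ψ q') ≤ dist q q') {G : P → Prop}
    (hpred : ∀ q, G q → ∃ c q', G q' ∧ R' c q' q) {ε : ℝ}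
    (hG : ∀ q, G q → Approx R' q ε ∧ Approx (Rev R') q ε) {z q : P} {l : List C} (hq : G q)
    (hrun : Run R l z (ψ q)) : Approx R z ε ∧ Approx (Rev R) z ε := by
  obtain ⟨c, q, q', l₁, l₂, -, hq', hstep, e, hl₁, h1, h2⟩ :=
    exists_excursion hI hL hψ hpred _ l z q rfl hq hrun
  obtain ⟨p', hgood, ⟨c₀, q₀, p₀, hc₀, hp₀⟩, halt⟩ := (hG q' hq').2
  obtain ⟨rfl, rfl⟩ := hI' _ _ _ _ _ hstep hc₀
  have hr := hψ _ _ _ hp₀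
  rw [e] at hr
  obtain ⟨p, hp1, hp2⟩ := run_append.1 hr
  have hgp' : Good R (ψ p') := good_lift hL hψ (good_rev (R := Rev R') hgood)
  have hgp : Good R p := good_of_run_good hI hp2 hgp'
  have halt' : PairLoop R z p ∨ dist z p ≤ ε := by
    rcases halt with h | h
    · left
      have h3 := pairLoop_lift hL hψ (pairLoop_rev (R := Rev R') h)
      obtain ⟨p₁, h4, h5⟩ := pairLoop_pull hI h2 h3
      rwa [run_source_unique hI hp2 h4]
    · right
      rw [← run_dist hiso h2 hp2]
      exact (hψd _ _).trans h
  refine ⟨?_, p, good_rev hgp, agree_rev_of_run hl₁ h1 hp1, halt'.imp pairLoop_rev id⟩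
  by_cases hl₂ : l₂ = []
  · subst hl₂
    cases h2
    obtain ⟨p', hgood, ⟨c₀, q₀, p₀, hc₀, hp₀⟩, halt⟩ := (hG q' hq').1
    refine ⟨ψ p', good_lift hL hψ hgood, ?_, ?_⟩
    · refine agree_of_run (l := L c₀) ?_ (hψ _ _ _ hc₀) (hψ _ _ _ hp₀)
      intro h0
      have := (hL c₀).pos
      rw [h0] at this
      simp at this
    · exact halt.imp (pairLoop_lift hL hψ) ((hψd _ _).trans)
  · exact ⟨p, hgp, agree_of_run hl₂ h2 hp2, halt'⟩

end Approx

/-- The trapezoid (in the rotated coordinates `u = x + y`, `v = y - x`) carrying the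
renormalized system. -/
def InT (a w : ℝ) (z : ℝ × ℝ) : Prop :=
  0 < z.1 ∧ -2 * a < z.1 + z.2 ∧ z.1 + z.2 < 2 * a ∧ z.1 - z.2 < 2 * a + 2 * w

/-- The translation part of the code `c`. -/
def kap (a w : ℝ) (b : Bool) : ℝ := if b then 2 * w - 4 * a else 2 * w

/-- The quarter turn with the code `c`. -/
def act (a w : ℝ) (c : Bool × Bool) (z : ℝ × ℝ) : ℝ × ℝ :=
  if c.1 then (z.2 + kap a w c.2, -z.1) else (-z.2 - kap a w c.2, z.1)

/-- The coded transition relation of the renormalized system. -/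
def StepC (a w : ℝ) (c : Bool × Bool) (z z' : ℝ × ℝ) : Prop :=
  InT a w z ∧ InT a w z' ∧ z' = act a w c z

section Basic

variable {a w : ℝ}

theorem stepC_det : Det (StepC a w) := by
  rintro ⟨σ, b⟩ ⟨σ', b'⟩ ⟨u, v⟩ m m' ⟨h1, h2, rfl⟩ ⟨-, h3, rfl⟩
  simp only [InT, act, kap] at *
  cases σ <;> cases σ' <;> cases b <;> cases b' <;> simp at * <;> exfalso <;> linarith

theorem stepC_det_rev : Det (Rev (StepC a w)) := by
  rintro ⟨σ, b⟩ ⟨σ', b'⟩ z ⟨u, v⟩ ⟨u', v'⟩ ⟨h1, h2, rfl⟩ ⟨h3, -, h4⟩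
  simp only [InT, act, kap] at *
  cases σ <;> cases σ' <;> cases b <;> cases b' <;> simp at * <;>
    first
    | (exfalso; linarith)
    | (constructor <;> linarith)

theorem stepC_iso : Iso (StepC a w) := by
  rintro ⟨σ, b⟩ z z' p p' ⟨-, -, rfl⟩ ⟨-, -, rfl⟩
  cases σ <;> simp [act, Prod.dist_eq, max_comm, dist_neg_neg]

end Basic

/-- Points whose coordinates in the eight special directions avoid the module `Λ`. -/
def Gen (Λ : Submodule ℚ ℝ) (z : ℝ × ℝ) : Prop :=
  z.1 ∉ Λ ∧ z.2 ∉ Λ ∧ z.1 + z.2 ∉ Λ ∧ z.1 - z.2 ∉ Λ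

section Gen

variable {Λ : Submodule ℚ ℝ} {a w : ℝ}

theorem lin_mem (ha : a ∈ Λ) (hw : w ∈ Λ) (p q : ℚ) : (p : ℝ) * a + (q : ℝ) * w ∈ Λ := by
  have h1 := Λ.smul_mem p ha
  have h2 := Λ.smul_mem q hw
  rw [Rat.smul_def] at h1 h2
  exact Λ.add_mem h1 h2

theorem lin_notMem {x y : ℝ} (hx : x ∉ Λ) (k : ℚ) (hk : k ≠ 0) (h : y - (k : ℝ) * x ∈ Λ) :
    y ∉ Λ := by
  intro hy
  apply hx
  have h1 := Λ.smul_mem k⁻¹ (Λ.sub_mem hy h)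
  rw [Rat.smul_def] at h1
  have hk' : (k : ℝ) ≠ 0 := by exact_mod_cast hk
  have : ((k⁻¹ : ℚ) : ℝ) * (y - (y - k * x)) = x := by
    push_cast; field_simp; ring
  rwa [this] at h1

theorem lin_ne {x : ℝ} (ha : a ∈ Λ) (hw : w ∈ Λ) (hx : x ∉ Λ) (p q : ℚ) :
    x ≠ (p : ℝ) * a + (q : ℝ) * w := by
  rintro rfl
  exact hx (lin_mem ha hw p q)

theorem kap_mem (ha : a ∈ Λ) (hw : w ∈ Λ) (b : Bool) : kap a w b ∈ Λ := by
  cases b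
  · convert lin_mem ha hw 0 2 using 1; simp [kap]
  · convert lin_mem ha hw (-4) 2 using 1; simp [kap]; ring

theorem gen_act (ha : a ∈ Λ) (hw : w ∈ Λ) (c : Bool × Bool) {z : ℝ × ℝ} (h : Gen Λ z) :
    Gen Λ (act a w c z) := by
  obtain ⟨h1, h2, h3, h4⟩ := h
  obtain ⟨σ, b⟩ := c
  have hk := kap_mem ha hw b
  have hk' := Λ.neg_mem hk
  cases σ
  · refine ⟨lin_notMem h2 (-1) (by norm_num) ?_, lin_notMem h1 1 (by norm_num) ?_,
      lin_notMem h4 1 (by norm_num) ?_, lin_notMem h3 (-1) (by norm_num) ?_⟩ <;>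
    simp [act] <;> (try ring_nf) <;> simp [hk]
  · refine ⟨lin_notMem h2 1 (by norm_num) ?_, lin_notMem h1 (-1) (by norm_num) ?_,
      lin_notMem h4 (-1) (by norm_num) ?_, lin_notMem h3 1 (by norm_num) ?_⟩ <;>
    simp [act] <;> (try ring_nf) <;> simp [hk]

/-- Inverse of `act`. -/
def actInv (a w : ℝ) (c : Bool × Bool) (z : ℝ × ℝ) : ℝ × ℝ :=
  if c.1 then (-z.2, z.1 - kap a w c.2) else (z.2, -z.1 - kap a w c.2)

theorem act_actInv (c : Bool × Bool) (z : ℝ × ℝ) : act a w c (actInv a w c z) = z := by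
  obtain ⟨σ, b⟩ := c
  cases σ <;> simp [act, actInv]

theorem gen_actInv (ha : a ∈ Λ) (hw : w ∈ Λ) (c : Bool × Bool) {z : ℝ × ℝ} (h : Gen Λ z) :
    Gen Λ (actInv a w c z) := by
  obtain ⟨h1, h2, h3, h4⟩ := h
  obtain ⟨σ, b⟩ := c
  have hk := kap_mem ha hw b
  have hk' := Λ.neg_mem hk
  cases σ
  · refine ⟨lin_notMem h2 1 (by norm_num) ?_, lin_notMem h1 (-1) (by norm_num) ?_,
      lin_notMem h4 (-1) (by norm_num) ?_, lin_notMem h3 1 (by norm_num) ?_⟩ <;>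
    simp [actInv] <;> (try ring_nf) <;> simp [hk]
  · refine ⟨lin_notMem h2 (-1) (by norm_num) ?_, lin_notMem h1 1 (by norm_num) ?_,
      lin_notMem h4 1 (by norm_num) ?_, lin_notMem h3 (-1) (by norm_num) ?_⟩ <;>
    simp [actInv] <;> (try ring_nf) <;> simp [hk]

theorem exists_succ (hw0 : 0 < w) (hwa : w < 2 * a) (ha : a ∈ Λ) (hw : w ∈ Λ) {z : ℝ × ℝ}
    (hz : InT a w z) (hg : Gen Λ z) : ∃ c z', Gen Λ z' ∧ StepC a w c z z' := by
  suffices h : ∃ c, InT a w (act a w c z) by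
    obtain ⟨c, hc⟩ := h
    exact ⟨c, _, gen_act ha hw c hg, hz, hc, rfl⟩
  obtain ⟨u, v⟩ := z
  obtain ⟨h1, h2, h3, h4⟩ := hg
  obtain ⟨i1, i2, i3, i4⟩ := hz
  simp only [] at *
  have e1 := lin_ne ha hw h4 (-2) 2
  push_cast at e1
  rcases lt_or_gt_of_ne e1 with e1 | e1
  · have e2 := lin_ne ha hw h2 4 (-2)
    push_cast at e2
    rcases lt_or_gt_of_ne e2 with e2 | e2
    · refine ⟨(false, true), ?_⟩
      simp only [InT, act, kap]
      refine ⟨?_, ?_, ?_, ?_⟩ <;> simp <;> linarith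
    · refine ⟨(true, true), ?_⟩
      simp only [InT, act, kap]
      refine ⟨?_, ?_, ?_, ?_⟩ <;> simp <;> linarith
  · have e2 := lin_ne ha hw h2 0 (-2)
    push_cast at e2
    rcases lt_or_gt_of_ne e2 with e2 | e2
    · refine ⟨(false, false), ?_⟩
      simp only [InT, act, kap]
      refine ⟨?_, ?_, ?_, ?_⟩ <;> simp <;> linarith
    · refine ⟨(true, false), ?_⟩
      simp only [InT, act, kap]
      refine ⟨?_, ?_, ?_, ?_⟩ <;> simp <;> linarith

theorem exists_pred (hw0 : 0 < w) (hwa : w < 2 * a) (ha : a ∈ Λ) (hw : w ∈ Λ) {z : ℝ × ℝ}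
    (hz : InT a w z) (hg : Gen Λ z) : ∃ c z', Gen Λ z' ∧ StepC a w c z' z := by
  suffices h : ∃ c, InT a w (actInv a w c z) by
    obtain ⟨c, hc⟩ := h
    exact ⟨c, _, gen_actInv ha hw c hg, hc, hz, (act_actInv c z).symm⟩
  obtain ⟨u, v⟩ := z
  obtain ⟨h1, h2, h3, h4⟩ := hg
  obtain ⟨i1, i2, i3, i4⟩ := hz
  simp only [] at *
  have e1 := lin_ne ha hw h2 0 0
  push_cast at e1
  rcases lt_or_gt_of_ne e1 with e1 | e1
  · have e2 := lin_ne ha hw h4 (-2) 2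
    push_cast at e2
    rcases lt_or_gt_of_ne e2 with e2 | e2
    · refine ⟨(true, true), ?_⟩
      simp only [InT, actInv, kap]
      refine ⟨?_, ?_, ?_, ?_⟩ <;> simp <;> linarith
    · refine ⟨(true, false), ?_⟩
      simp only [InT, actInv, kap]
      refine ⟨?_, ?_, ?_, ?_⟩ <;> simp <;> linarith
  · have e2 := lin_ne ha hw h4 2 (-2)
    push_cast at e2
    rcases lt_or_gt_of_ne e2 with e2 | e2
    · refine ⟨(false, false), ?_⟩
      simp only [InT, actInv, kap]
      refine ⟨?_, ?_, ?_, ?_⟩ <;> simp <;> linarith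
    · refine ⟨(false, true), ?_⟩
      simp only [InT, actInv, kap]
      refine ⟨?_, ?_, ?_, ?_⟩ <;> simp <;> linarith

end Gen

theorem run_step {a w : ℝ} {c : Bool × Bool} {l : List (Bool × Bool)} {z z' : ℝ × ℝ}
    (h : InT a w z) (h' : InT a w (act a w c z)) (hr : Run (StepC a w) l (act a w c z) z') :
    Run (StepC a w) (c :: l) z z' := ⟨_, ⟨h, h', rfl⟩, hr⟩

theorem odd_length_ite_rep {C : Type*} (p : Prop) [Decidable p] (k : ℕ) (x y a b c d : C) :
    Odd ((rep k [x, y]).length + (if p then [a] else [b, c, d]).length) := by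
  rw [length_rep]
  split_ifs <;> simp [Nat.odd_add, parity_simps]

/-- The slide `[R₊, R₋]`. -/
theorem run_slide_right {a γ : ℝ} (hγ : 0 < γ) (k : ℕ) (u v : ℝ) (hu : 0 < u)
    (hv : 2 * (γ * k) < v) (huv : u + v < 2 * a) :
    Run (StepC a (2 * a - γ)) (rep k [(true, true), (false, true)]) (u, v)
      (u + 2 * (γ * k), v - 2 * (γ * k)) := by
  induction k generalizing u v with
  | zero => simp [rep, Run]
  | succ k ih =>
    rw [rep_succ]
    push_cast at *
    have hk : 0 ≤ γ * k := by positivity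
    have := ih (u + 2 * γ) (v - 2 * γ) (by linarith) (by linarith) (by linarith)
    refine run_step ?_ ?_ (run_step ?_ ?_ ?_)
    any_goals
      show InT _ _ _
      simp only [InT, act, kap]
      refine ⟨?_, ?_, ?_, ?_⟩ <;> (try simp) <;> linarith
    change Run _ (rep k _) _ _
    convert this using 1
    · simp only [act, kap]; ext <;> simp <;> ring
    · ext <;> simp <;> ring

/-- The slide `[Q₊, Q₋]`. -/
theorem run_slide_left {a γ : ℝ} (hγ : 0 < γ) (hγa : γ < a) (k : ℕ) (u v : ℝ)
    (hu : 2 * (γ * k) < u) (hv : -2 * γ < v) (hT : InT a γ (u, v)) :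
    Run (StepC a γ) (rep k [(true, false), (false, false)]) (u, v)
      (u - 2 * (γ * k), v + 2 * (γ * k)) := by
  induction k generalizing u v with
  | zero => simp [rep, Run]
  | succ k ih =>
    rw [rep_succ]
    push_cast at *
    have hk : 0 ≤ γ * k := by positivity
    obtain ⟨i1, i2, i3, i4⟩ := hT
    simp only at i1 i2 i3 i4
    have := ih (u - 2 * γ) (v + 2 * γ) (by linarith) (by linarith)
      (by refine ⟨?_, ?_, ?_, ?_⟩ <;> (try simp) <;> linarith)
    refine run_step ?_ ?_ (run_step ?_ ?_ ?_)
    any_goals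
      show InT _ _ _
      simp only [InT, act, kap]
      refine ⟨?_, ?_, ?_, ?_⟩ <;> (try simp) <;> linarith
    change Run _ (rep k _) _ _
    convert this using 1
    · simp only [act, kap]; ext <;> simp
    · ext <;> simp <;> ring

/-- The embedding of the renormalized system. -/
def psi (γ ω : ℝ) (n : ℕ) (q : ℝ × ℝ) : ℝ × ℝ :=
  (γ - (q.1 + q.2) / 2, 2 * (γ * n) + γ + ω - (q.1 - q.2) / 2)

/-- The list of codes over a code of the renormalized system for `w = 2 * a - γ`. -/
def liftBig (n : ℕ) (c : Bool × Bool) : List (Bool × Bool) :=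
  rep (n + if c.2 then 1 else 0) [(true, true), (false, true)] ++
    (if c.1 then [(false, true)] else [(true, false), (true, false), (false, false)])

/-- The list of codes over a code of the renormalized system for `w = γ`. -/
def liftSmall (n : ℕ) (c : Bool × Bool) : List (Bool × Bool) :=
  (if c.1 = false then [(false, true)] else [(true, false), (true, false), (false, false)]) ++
    rep (n + if c.2 then 1 else 0) [(true, false), (false, false)]

theorem odd_liftBig (n : ℕ) (c : Bool × Bool) : Odd (liftBig n c).length := by
  rw [liftBig, List.length_append]; exact odd_length_ite_rep _ _ _ _ _ _ _ _

theorem odd_liftSmall (n : ℕ) (c : Bool × Bool) : Odd (liftSmall n c).length := by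
  rw [liftSmall, List.length_append, add_comm]; exact odd_length_ite_rep _ _ _ _ _ _ _ _

section

variable {a γ ω : ℝ} {n : ℕ}

theorem psi_mem {w : ℝ} (hγ : 0 < γ) (hω : 0 < ω) (h2a : 2 * a = 2 * (γ * n) + 2 * γ + ω)
    (hw : γ ≤ w) {q : ℝ × ℝ} (hq : InT γ ω q) : InT a w (psi γ ω n q) := by
  obtain ⟨i1, i2, i3, i4⟩ := hq
  have hk : 0 ≤ γ * n := by positivity
  refine ⟨?_, ?_, ?_, ?_⟩ <;> simp only [psi] <;> linarith

theorem dist_psi (q q' : ℝ × ℝ) : dist (psi γ ω n q) (psi γ ω n q') ≤ dist q q' := by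
  have h1 := abs_le.1 ((Real.dist_eq _ _).symm.le.trans (le_max_left (dist q.1 q'.1) (dist q.2 q'.2)))
  have h2 := abs_le.1 ((Real.dist_eq _ _).symm.le.trans (le_max_right (dist q.1 q'.1) (dist q.2 q'.2)))
  rw [Prod.dist_eq, Prod.dist_eq]
  refine max_le ?_ ?_ <;> rw [Real.dist_eq, abs_le] <;> constructor <;> simp only [psi] <;> linarith

theorem run_liftBig (hγ : 0 < γ) (hω : 0 < ω) (hωγ : ω < 2 * γ)
    (h2a : 2 * a = 2 * (γ * n) + 2 * γ + ω) (c : Bool × Bool) (q q' : ℝ × ℝ)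
    (h : StepC γ ω c q q') :
    Run (StepC a (2 * a - γ)) (liftBig n c) (psi γ ω n q) (psi γ ω n q') := by
  obtain ⟨h1, h2, rfl⟩ := h
  have hk : 0 ≤ γ * n := by positivity
  have hm := psi_mem (a := a) (w := 2 * a - γ) hγ hω h2a (by linarith) h2
  obtain ⟨u, v⟩ := q
  obtain ⟨σ, b⟩ := c
  rw [liftBig, run_append]
  refine ⟨_, run_slide_right hγ _ _ _ ?_ ?_ ?_, ?_⟩
  · simp only [InT, psi] at *; linarith
  · simp only [InT, psi, act, kap] at *; cases b <;> cases σ <;> simp at * <;> linarith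
  · simp only [InT, psi, act, kap] at *; linarith
  · cases σ
    · refine run_step ?_ ?_ (run_step ?_ ?_ (run_step ?_ ?_ ?_))
      any_goals
        show InT _ _ _
        simp only [InT, act, kap, psi] at *
        cases b <;> simp at * <;> refine ⟨?_, ?_, ?_, ?_⟩ <;> linarith
      simp only [act, kap, psi, Run]
      cases b <;> ext <;> simp <;> linarith
    · refine run_step ?_ ?_ ?_
      any_goals
        show InT _ _ _
        simp only [InT, act, kap, psi] at *
        cases b <;> simp at * <;> refine ⟨?_, ?_, ?_, ?_⟩ <;> linarith
      simp only [act, kap, psi, Run]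
      cases b <;> ext <;> simp <;> linarith

theorem run_liftSmall (hγ : 0 < γ) (hω : 0 < ω) (hωγ : ω < 2 * γ)
    (h2a : 2 * a = 2 * (γ * n) + 2 * γ + ω) (c : Bool × Bool) (q q' : ℝ × ℝ)
    (h : Rev (StepC γ ω) c q q') :
    Run (StepC a γ) (liftSmall n c) (psi γ ω n q) (psi γ ω n q') := by
  obtain ⟨h2, h1, rfl⟩ := h
  have hk : 0 ≤ γ * n := by positivity
  obtain ⟨u, v⟩ := q'
  obtain ⟨σ, b⟩ := c
  rw [liftSmall, run_append]
  cases σ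
  · refine ⟨_, run_step ?_ ?_ rfl, ?_⟩
    any_goals
      show InT _ _ _
      simp only [InT, act, kap, psi] at *
      cases b <;> simp at * <;> refine ⟨?_, ?_, ?_, ?_⟩ <;> linarith
    convert run_slide_left (a := a) hγ (by linarith) _ _ _ ?_ ?_ ?_ using 1
    · simp only [act, kap, psi]
      cases b <;> ext <;> simp <;> linarith
    · simp only [InT, psi, act, kap] at *; cases b <;> simp at * <;> linarith
    · simp only [InT, psi, act, kap] at *; cases b <;> simp at * <;> linarith
    · simp only [InT, psi, act, kap] at *
      cases b <;> simp at * <;> refine ⟨?_, ?_, ?_, ?_⟩ <;> linarith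
  · refine ⟨_, run_step ?_ ?_ (run_step ?_ ?_ (run_step ?_ ?_ rfl)), ?_⟩
    any_goals
      show InT _ _ _
      simp only [InT, act, kap, psi] at *
      cases b <;> simp at * <;> refine ⟨?_, ?_, ?_, ?_⟩ <;> linarith
    convert run_slide_left (a := a) hγ (by linarith) _ _ _ ?_ ?_ ?_ using 1
    · simp only [act, kap, psi]
      cases b <;> ext <;> simp <;> linarith
    · simp only [InT, psi, act, kap] at *; cases b <;> simp at * <;> linarith
    · simp only [InT, psi, act, kap] at *; cases b <;> simp at * <;> linarith
    · simp only [InT, psi, act, kap] at *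
      cases b <;> simp at * <;> refine ⟨?_, ?_, ?_, ?_⟩ <;> linarith

end

/-- Around the fixed point of a quarter turn the points run in closed loops. -/
theorem good_pairLoop_of_quarter {C P : Type*} {R : C → P → P → Prop} {S : Set P} {ρ : P → P}
    {W : List C} (hW : Odd W.length) (hr : ∀ z ∈ S, Run R W z (ρ z)) (hS : ∀ z ∈ S, ρ z ∈ S)
    (h4 : ∀ z, ρ (ρ (ρ (ρ z))) = z) {c : P} (hc : c ∈ S) (hρ : ρ c = c) {z : P} (hz : z ∈ S) :
    ∃ p, Good R p ∧ PairLoop R z p := by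
  have key : ∀ z ∈ S, Run R (W ++ (W ++ (W ++ W))) z z := by
    intro z hz
    have h1 := hS _ hz
    have h2 := hS _ h1
    have h3 := hS _ h2
    refine run_append.2 ⟨_, hr _ hz, run_append.2 ⟨_, hr _ h1, run_append.2 ⟨_, hr _ h2, ?_⟩⟩⟩
    have := hr _ h3
    rwa [h4] at this
  refine ⟨c, ⟨W, hW, ?_⟩, _, ?_, key z hz, key c hc⟩
  · have := hr _ hc; rwa [hρ] at this
  · intro h
    have := hW.pos
    simp at h
    simp [h] at this

/-- The point is on a trivial periodic island, or runs into the renormalized system. -/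
def Reach (Λ : Submodule ℚ ℝ) (a w γ ω : ℝ) (n : ℕ) (z : ℝ × ℝ) : Prop :=
  (∃ p, Good (StepC a w) p ∧ PairLoop (StepC a w) z p) ∨
    ∃ l q, Run (StepC a w) l z (psi γ ω n q) ∧ InT γ ω q ∧ Gen Λ q

section

variable {Λ : Submodule ℚ ℝ} {a w γ ω : ℝ} {n : ℕ}

theorem reach_of_run {l : List (Bool × Bool)} {z y : ℝ × ℝ} (h : Run (StepC a w) l z y)
    (hy : Reach Λ a w γ ω n y) : Reach Λ a w γ ω n z := by
  rcases hy with ⟨p, h1, h2⟩ | ⟨l', q, h1, h2⟩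
  · obtain ⟨p', h3, h4⟩ := pairLoop_pull stepC_det_rev h h2
    exact Or.inl ⟨p', good_of_run_good stepC_det_rev h3 h1, h4⟩
  · exact Or.inr ⟨l ++ l', q, run_append.2 ⟨_, h, h1⟩, h2⟩

theorem reach_step (ha : a ∈ Λ) (hw : w ∈ Λ) (c : Bool × Bool) {z : ℝ × ℝ} (hg : Gen Λ z)
    (h : InT a w z) (h' : InT a w (act a w c z))
    (hr : Gen Λ (act a w c z) → Reach Λ a w γ ω n (act a w c z)) : Reach Λ a w γ ω n z :=
  reach_of_run (l := [c]) (run_step h h' rfl) (hr (gen_act ha hw c hg))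

theorem reach_psi (h2a : 2 * a = 2 * (γ * n) + 2 * γ + ω)
    (hγΛ : γ ∈ Λ) (ha : a ∈ Λ) {u v : ℝ} (hg : Gen Λ (u, v)) (hu : 0 < u) (hu' : u < 2 * γ)
    (hv : 2 * (γ * n) < v) (huv : u + v < 2 * a) : Reach Λ a w γ ω n (u, v) := by
  refine Or.inr ⟨[], (2 * a - u - v, 2 * γ - u - 2 * a + v), ?_, ?_, ?_⟩
  · simp only [Run, psi]
    ext <;> simp <;> linarith
  · refine ⟨?_, ?_, ?_, ?_⟩ <;> simp <;> linarith
  · obtain ⟨h1, h2, h3, h4⟩ := hg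
    refine ⟨lin_notMem h3 (-1) (by norm_num) ?_, lin_notMem h4 (-1) (by norm_num) ?_,
      lin_notMem h1 (-2) (by norm_num) ?_, lin_notMem h2 (-2) (by norm_num) ?_⟩
    · convert lin_mem ha hγΛ 2 0 using 1; simp; ring
    · convert lin_mem ha hγΛ (-2) 2 using 1; simp; ring
    · convert lin_mem ha hγΛ 0 2 using 1; simp; ring
    · convert lin_mem ha hγΛ 4 (-2) using 1; simp; ring

/-- The squares of the grid at the end of the trapezoid. -/
def gridSq (γ : ℝ) (j : ℕ) : Set (ℝ × ℝ) :=
  {z | 0 < z.1 ∧ z.1 < 2 * γ ∧ 2 * (γ * j) < z.2 ∧ z.2 < 2 * (γ * j) + 2 * γ}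

theorem reach_strip (hγ : 0 < γ) (h2a : 2 * a = 2 * (γ * n) + 2 * γ + ω)
    (hγΛ : γ ∈ Λ) (ha : a ∈ Λ)
    (hsq : ∀ j < n, ∀ z ∈ gridSq γ j, ∃ p, Good (StepC a w) p ∧ PairLoop (StepC a w) z p)
    {u v : ℝ} (hg : Gen Λ (u, v)) (hu : 0 < u) (hu' : u < 2 * γ)
    (hv : 0 < v) (huv : u + v < 2 * a) : Reach Λ a w γ ω n (u, v) := by
  have e := lin_ne ha hγΛ hg.2.1 0 (2 * n)
  push_cast at e
  rcases lt_or_gt_of_ne e with e | e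
  · obtain ⟨j, hj1, hj2⟩ : ∃ j : ℕ, 2 * (γ * j) < v ∧ v < 2 * (γ * j) + 2 * γ := by
      have h0 : 0 ≤ v / (2 * γ) := by positivity
      have h1 := Nat.floor_le h0
      have h2 := Nat.lt_floor_add_one (v / (2 * γ))
      rw [le_div_iff₀ (by positivity)] at h1
      rw [div_lt_iff₀ (by positivity)] at h2
      refine ⟨⌊v / (2 * γ)⌋₊, lt_of_le_of_ne (by linarith) ?_, by linarith⟩
      have := lin_ne ha hγΛ hg.2.1 0 (2 * (⌊v / (2 * γ)⌋₊ : ℕ))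
      push_cast at this
      intro h
      exact this (by linarith)
    have hjn : j < n := by
      by_contra h
      push Not at h
      have : (n : ℝ) ≤ j := by exact_mod_cast h
      nlinarith
    exact Or.inl (hsq j hjn _ ⟨hu, hu', hj1, hj2⟩)
  · exact reach_psi h2a hγΛ ha hg hu hu' (by linarith) huv

end

section Small

variable {Λ : Submodule ℚ ℝ} {a γ ω : ℝ} {n : ℕ}

theorem reach_small_strip (hγ : 0 < γ) (hω : 0 < ω) (h2a : 2 * a = 2 * (γ * n) + 2 * γ + ω)
    (hγΛ : γ ∈ Λ) (ha : a ∈ Λ) {u v : ℝ} (hg : Gen Λ (u, v)) (hu : 0 < u) (hu' : u < 2 * γ)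
    (hv : 0 < v) (huv : u + v < 2 * a) : Reach Λ a γ γ ω n (u, v) := by
  have hk : 0 ≤ γ * n := by positivity
  refine reach_strip hγ h2a hγΛ ha ?_ hg hu hu' hv huv
  intro j hj z hz
  have hj' : γ * j + γ ≤ γ * n := by
    have : (j : ℝ) + 1 ≤ n := by exact_mod_cast hj
    nlinarith
  have hj0 : 0 ≤ γ * j := by positivity
  refine good_pairLoop_of_quarter (S := gridSq γ j)
    (ρ := fun z => (z.2 - 2 * (γ * j), 2 * (γ * j) + 2 * γ - z.1))
    (W := [(true, false), (true, false), (false, false)] ++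
      rep j [(true, false), (false, false)]) ?_ ?_ ?_ ?_ (c := (γ, 2 * (γ * j) + γ)) ?_ ?_ hz
  · rw [List.length_append, length_rep]
    simp [Nat.odd_add, parity_simps]
    decide
  · rintro ⟨u, v⟩ ⟨h1, h2, h3, h4⟩
    simp only at h1 h2 h3 h4
    rw [run_append]
    refine ⟨_, run_step ?_ ?_ (run_step ?_ ?_ (run_step ?_ ?_ rfl)), ?_⟩
    any_goals
      show InT _ _ _
      simp only [InT, act, kap]
      refine ⟨?_, ?_, ?_, ?_⟩ <;> (try simp) <;> linarith
    convert run_slide_left (a := a) hγ (by linarith) j v (2 * γ - u) h3 (by linarith) ?_ using 1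
    · simp only [act, kap]
      ext <;> simp; ring
    · ext <;> simp; ring
    · simp only [InT]
      refine ⟨?_, ?_, ?_, ?_⟩ <;> (try simp) <;> linarith
  · rintro z ⟨h1, h2, h3, h4⟩
    refine ⟨?_, ?_, ?_, ?_⟩ <;> simp only [] <;> linarith
  · intro z; ext <;> simp only [] <;> ring
  · refine ⟨?_, ?_, ?_, ?_⟩ <;> simp only [] <;> linarith
  · ext <;> simp; ring

theorem reach_small_pos (hγ : 0 < γ) (hω : 0 < ω) (h2a : 2 * a = 2 * (γ * n) + 2 * γ + ω)
    (hγΛ : γ ∈ Λ) (ha : a ∈ Λ) (k : ℕ) {u v : ℝ} (hg : Gen Λ (u, v)) (hT : InT a γ (u, v))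
    (hv : 0 < v) (hk : u < 2 * γ * k) : Reach Λ a γ γ ω n (u, v) := by
  have hn : 0 ≤ γ * n := by positivity
  induction k generalizing u v with
  | zero => have := hT.1; simp at *; linarith
  | succ k ih =>
    push_cast at hk
    obtain ⟨i1, i2, i3, i4⟩ := id hT
    simp only at i1 i2 i3 i4
    have e := lin_ne ha hγΛ hg.1 0 2
    push_cast at e
    rcases lt_or_gt_of_ne e with e | e
    · exact reach_small_strip hγ hω h2a hγΛ ha hg i1 (by linarith) hv i3
    · refine reach_step ha hγΛ (true, false) hg hT ?_ fun hg1 =>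
        reach_step ha hγΛ (false, false) hg1 ?_ ?_ fun hg2 => ih hg2 ?_ ?_ ?_
      any_goals
        show InT _ _ _
        simp only [InT, act, kap]
        refine ⟨?_, ?_, ?_, ?_⟩ <;> (try simp) <;> linarith
      all_goals simp only [act, kap, Bool.false_eq_true, if_true, if_false]
      all_goals linarith

theorem reach_small (hγ : 0 < γ) (hω : 0 < ω) (h2a : 2 * a = 2 * (γ * n) + 2 * γ + ω)
    (hγΛ : γ ∈ Λ) (ha : a ∈ Λ) {z : ℝ × ℝ} (hg : Gen Λ z) (hT : InT a γ z) :
    Reach Λ a γ γ ω n z := by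
  have hn : 0 ≤ γ * n := by positivity
  have pos : ∀ {z : ℝ × ℝ}, Gen Λ z → InT a γ z → 0 < z.2 → Reach Λ a γ γ ω n z := by
    rintro ⟨u, v⟩ hg hT hv
    obtain ⟨k, hk⟩ := exists_nat_gt (u / (2 * γ))
    rw [div_lt_iff₀ (by positivity)] at hk
    exact reach_small_pos hγ hω h2a hγΛ ha k hg hT hv (by linarith)
  obtain ⟨u, v⟩ := z
  obtain ⟨i1, i2, i3, i4⟩ := id hT
  simp only at i1 i2 i3 i4
  have e1 := lin_ne ha hγΛ hg.2.1 0 0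
  have e2 := lin_ne ha hγΛ hg.2.1 0 (-2)
  have e3 := lin_ne ha hγΛ hg.1 0 2
  push_cast at e1 e2 e3
  rcases lt_or_gt_of_ne e1 with e1 | e1
  · rcases lt_or_gt_of_ne e2 with e2 | e2
    · refine reach_step ha hγΛ (false, false) hg hT ?_ fun hg1 => pos hg1 ?_ ?_
      any_goals
        show InT _ _ _
        simp only [InT, act, kap]
        refine ⟨?_, ?_, ?_, ?_⟩ <;> (try simp) <;> linarith
      simp [act, i1]
    · rcases lt_or_gt_of_ne e3 with e3 | e3
      · refine Or.inl (good_pairLoop_of_quarter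
          (S := {z | 0 < z.1 ∧ z.1 < 2 * γ ∧ -2 * γ < z.2 ∧ z.2 < 0})
          (ρ := act a γ (true, false)) (W := [(true, false)]) (by simp) ?_ ?_ ?_
          (c := (γ, -γ)) ?_ ?_ ⟨i1, by linarith, by simp; linarith, by simp; linarith⟩)
        · rintro ⟨u, v⟩ ⟨h1, h2, h3, h4⟩
          simp only at h1 h2 h3 h4
          refine run_step ?_ ?_ rfl
          any_goals
            show InT _ _ _
            simp only [InT, act, kap]
            refine ⟨?_, ?_, ?_, ?_⟩ <;> (try simp) <;> linarith
        · rintro ⟨u, v⟩ ⟨h1, h2, h3, h4⟩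
          simp only at h1 h2 h3 h4
          simp only [act, kap, mem_ofPred_eq]
          refine ⟨?_, ?_, ?_, ?_⟩ <;> (try simp) <;> linarith
        · intro z; simp only [act, kap]; ext <;> simp
        · refine ⟨?_, ?_, ?_, ?_⟩ <;> simp only [] <;> linarith
        · simp only [act, kap]; ext <;> simp; ring
      · refine reach_step ha hγΛ (true, false) hg hT ?_ fun hg1 =>
          reach_step ha hγΛ (false, false) hg1 ?_ ?_ fun hg2 => pos hg2 ?_ ?_
        any_goals
          show InT _ _ _
          simp only [InT, act, kap]
          refine ⟨?_, ?_, ?_, ?_⟩ <;> (try simp) <;> linarith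
        simp [act, kap]; linarith
  · exact pos hg hT (by simp; linarith)

end Small

section Big

variable {Λ : Submodule ℚ ℝ} {a γ ω : ℝ} {n : ℕ}

theorem reach_big_strip (hγ : 0 < γ) (hω : 0 < ω) (h2a : 2 * a = 2 * (γ * n) + 2 * γ + ω)
    (hγΛ : γ ∈ Λ) (ha : a ∈ Λ) {u v : ℝ} (hg : Gen Λ (u, v)) (hu : 0 < u) (hu' : u < 2 * γ)
    (hv : 0 < v) (huv : u + v < 2 * a) : Reach Λ a (2 * a - γ) γ ω n (u, v) := by
  have hk : 0 ≤ γ * n := by positivity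
  refine reach_strip hγ h2a hγΛ ha ?_ hg hu hu' hv huv
  intro j hj z hz
  have hj' : γ * j + γ ≤ γ * n := by
    have : (j : ℝ) + 1 ≤ n := by exact_mod_cast hj
    nlinarith
  have hj0 : 0 ≤ γ * j := by positivity
  refine good_pairLoop_of_quarter (S := gridSq γ j)
    (ρ := fun z => (2 * (γ * j) + 2 * γ - z.2, z.1 + 2 * (γ * j)))
    (W := rep j [(true, true), (false, true)] ++ [(false, true)])
    ?_ ?_ ?_ ?_ (c := (γ, 2 * (γ * j) + γ)) ?_ ?_ hz
  · rw [List.length_append, length_rep]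
    simp [parity_simps]
  · rintro ⟨u, v⟩ ⟨h1, h2, h3, h4⟩
    simp only at h1 h2 h3 h4
    rw [run_append]
    refine ⟨_, run_slide_right (a := a) hγ j u v h1 h3 (by linarith), ?_⟩
    refine run_step ?_ ?_ ?_
    any_goals
      show InT _ _ _
      simp only [InT, act, kap]
      refine ⟨?_, ?_, ?_, ?_⟩ <;> (try simp) <;> linarith
    simp only [Run, act, kap]
    ext <;> simp; ring
  · rintro z ⟨h1, h2, h3, h4⟩
    refine ⟨?_, ?_, ?_, ?_⟩ <;> simp only [] <;> linarith
  · intro z; ext <;> simp only [] <;> ring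
  · refine ⟨?_, ?_, ?_, ?_⟩ <;> simp only [] <;> linarith
  · ext <;> simp <;> ring

theorem reach_big_right (hγ : 0 < γ) (hω : 0 < ω) (h2a : 2 * a = 2 * (γ * n) + 2 * γ + ω)
    (hγΛ : γ ∈ Λ) (ha : a ∈ Λ) {u v : ℝ} (hg : Gen Λ (u, v)) (hT : InT a (2 * a - γ) (u, v))
    (huv : 2 * a - 2 * γ < u - v) : Reach Λ a (2 * a - γ) γ ω n (u, v) := by
  have hn : 0 ≤ γ * n := by positivity
  have hw : 2 * a - γ ∈ Λ := by
    convert lin_mem ha hγΛ 2 (-1) using 1; push_cast; ring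
  obtain ⟨i1, i2, i3, i4⟩ := id hT
  simp only at i1 i2 i3 i4
  have e1 := lin_ne ha hγΛ hg.2.1 0 0
  have e2 := lin_ne ha hγΛ hg.2.1 (-4) 2
  have e3 := lin_ne ha hγΛ hg.1 4 (-2)
  push_cast at e1 e2 e3
  rcases lt_or_gt_of_ne e1 with e1 | e1
  · rcases lt_or_gt_of_ne e2 with e2 | e2
    · refine reach_step ha hw (false, false) hg hT ?_ fun hg1 =>
        reach_big_strip hγ hω h2a hγΛ ha hg1 ?_ ?_ ?_ ?_
      any_goals
        show InT _ _ _
        simp only [InT, act, kap]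
        refine ⟨?_, ?_, ?_, ?_⟩ <;> (try simp) <;> linarith
      all_goals simp only [kap, Bool.false_eq_true, if_false]
      all_goals linarith
    · rcases lt_or_gt_of_ne e3 with e3 | e3
      · refine Or.inl (good_pairLoop_of_quarter
          (S := {z | 0 < z.1 ∧ z.1 < 4 * a - 2 * γ ∧ 2 * γ - 4 * a < z.2 ∧ z.2 < 0 ∧
            -2 * a < z.1 + z.2 ∧ z.1 + z.2 < 2 * a ∧ 2 * a - 2 * γ < z.1 - z.2 ∧
            z.1 - z.2 < 6 * a - 2 * γ})
          (ρ := act a (2 * a - γ) (true, false)) (W := [(true, false)]) (by simp) ?_ ?_ ?_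
          (c := (2 * a - γ, γ - 2 * a)) ?_ ?_
          (by refine ⟨?_, ?_, ?_, ?_, ?_, ?_, ?_, ?_⟩ <;> simp only [] <;> linarith))
        · rintro ⟨u, v⟩ ⟨h1, h2, h3, h4, h5, h6, h7, h8⟩
          simp only at h1 h2 h3 h4 h5 h6 h7 h8
          refine run_step ?_ ?_ rfl
          any_goals
            show InT _ _ _
            simp only [InT, act, kap]
            refine ⟨?_, ?_, ?_, ?_⟩ <;> (try simp) <;> linarith
        · rintro ⟨u, v⟩ ⟨h1, h2, h3, h4, h5, h6, h7, h8⟩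
          simp only at h1 h2 h3 h4 h5 h6 h7 h8
          simp only [act, kap, mem_ofPred_eq]
          refine ⟨?_, ?_, ?_, ?_, ?_, ?_, ?_, ?_⟩ <;> (try simp) <;> linarith
        · intro z; simp only [act, kap]; ext <;> simp
        · refine ⟨?_, ?_, ?_, ?_, ?_, ?_, ?_, ?_⟩ <;> simp only [] <;> linarith
        · simp only [act, kap]; ext <;> simp; ring
      · refine reach_step ha hw (true, false) hg hT ?_ fun hg1 =>
          reach_step ha hw (false, false) hg1 ?_ ?_ fun hg2 =>
          reach_big_strip hγ hω h2a hγΛ ha hg2 ?_ ?_ ?_ ?_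
        any_goals
          show InT _ _ _
          simp only [InT, act, kap]
          refine ⟨?_, ?_, ?_, ?_⟩ <;> (try simp) <;> linarith
        all_goals simp only [act, kap, Bool.false_eq_true, if_true, if_false]
        all_goals linarith
  · refine reach_step ha hw (true, false) hg hT ?_ fun hg1 =>
      reach_step ha hw (true, false) hg1 ?_ ?_ fun hg2 =>
      reach_step ha hw (false, false) hg2 ?_ ?_ fun hg3 =>
      reach_big_strip hγ hω h2a hγΛ ha hg3 ?_ ?_ ?_ ?_
    any_goals
      show InT _ _ _
      simp only [InT, act, kap]
      refine ⟨?_, ?_, ?_, ?_⟩ <;> (try simp) <;> linarith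
    all_goals simp only [act, kap, Bool.false_eq_true, if_true, if_false]
    all_goals linarith

theorem reach_big_pos (hγ : 0 < γ) (hω : 0 < ω) (h2a : 2 * a = 2 * (γ * n) + 2 * γ + ω)
    (hγΛ : γ ∈ Λ) (ha : a ∈ Λ) (k : ℕ) {u v : ℝ} (hg : Gen Λ (u, v))
    (hT : InT a (2 * a - γ) (u, v)) (hv : 0 < v) (hk : v < 2 * γ * k) :
    Reach Λ a (2 * a - γ) γ ω n (u, v) := by
  have hn : 0 ≤ γ * n := by positivity
  have hw : 2 * a - γ ∈ Λ := by
    convert lin_mem ha hγΛ 2 (-1) using 1; push_cast; ring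
  induction k generalizing u v with
  | zero => simp at hk; linarith
  | succ k ih =>
    push_cast at hk
    obtain ⟨i1, i2, i3, i4⟩ := id hT
    simp only at i1 i2 i3 i4
    have e1 := lin_ne ha hγΛ hg.1 0 2
    have e2 := lin_ne ha hγΛ hg.2.1 0 2
    have e3 := lin_ne ha hγΛ hg.2.2.2 2 (-2)
    push_cast at e1 e2 e3
    rcases lt_or_gt_of_ne e1 with e1 | e1
    · exact reach_big_strip hγ hω h2a hγΛ ha hg i1 (by linarith) hv i3
    rcases lt_or_gt_of_ne e3 with e3 | e3
    · rcases lt_or_gt_of_ne e2 with e2 | e2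
      · refine reach_step ha hw (false, true) hg hT ?_ fun hg1 =>
          reach_big_strip hγ hω h2a hγΛ ha hg1 ?_ ?_ ?_ ?_
        any_goals
          show InT _ _ _
          simp only [InT, act, kap]
          refine ⟨?_, ?_, ?_, ?_⟩ <;> (try simp) <;> linarith
        all_goals simp only [kap, if_true]
        all_goals linarith
      · refine reach_step ha hw (true, true) hg hT ?_ fun hg1 =>
          reach_step ha hw (false, true) hg1 ?_ ?_ fun hg2 => ih hg2 ?_ ?_ ?_
        any_goals
          show InT _ _ _
          simp only [InT, act, kap]
          refine ⟨?_, ?_, ?_, ?_⟩ <;> (try simp) <;> linarith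
        all_goals simp only [act, kap, if_true]
        all_goals linarith
    · exact reach_big_right hγ hω h2a hγΛ ha hg hT (by linarith)

theorem reach_big (hγ : 0 < γ) (hω : 0 < ω) (h2a : 2 * a = 2 * (γ * n) + 2 * γ + ω)
    (hγΛ : γ ∈ Λ) (ha : a ∈ Λ) {z : ℝ × ℝ} (hg : Gen Λ z) (hT : InT a (2 * a - γ) z) :
    Reach Λ a (2 * a - γ) γ ω n z := by
  have hn : 0 ≤ γ * n := by positivity
  have hw : 2 * a - γ ∈ Λ := by
    convert lin_mem ha hγΛ 2 (-1) using 1; push_cast; ring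
  have pos : ∀ {z : ℝ × ℝ}, Gen Λ z → InT a (2 * a - γ) z → 0 < z.2 →
      Reach Λ a (2 * a - γ) γ ω n z := by
    rintro ⟨u, v⟩ hg hT hv
    obtain ⟨k, hk⟩ := exists_nat_gt (v / (2 * γ))
    rw [div_lt_iff₀ (by positivity)] at hk
    exact reach_big_pos hγ hω h2a hγΛ ha k hg hT hv (by linarith)
  obtain ⟨u, v⟩ := z
  obtain ⟨i1, i2, i3, i4⟩ := id hT
  simp only at i1 i2 i3 i4
  have e1 := lin_ne ha hγΛ hg.2.1 0 0
  have e3 := lin_ne ha hγΛ hg.2.2.2 2 (-2)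
  push_cast at e1 e3
  rcases lt_or_gt_of_ne e1 with e1 | e1
  · rcases lt_or_gt_of_ne e3 with e3 | e3
    · refine reach_step ha hw (false, true) hg hT ?_ fun hg1 => pos hg1 ?_ ?_
      any_goals
        show InT _ _ _
        simp only [InT, act, kap]
        refine ⟨?_, ?_, ?_, ?_⟩ <;> (try simp) <;> linarith
      simp [act, i1]
    · exact reach_big_right hγ hω h2a hγΛ ha hg hT (by linarith)
  · exact pos hg hT (by simp; linarith)

end Big

/-- Rational independence of two numbers. -/
def Ind (a w : ℝ) : Prop := ∀ p q : ℚ, (p : ℝ) * a + (q : ℝ) * w = 0 → q = 0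

/-- The data of one renormalization step. -/
structure Lev (a γ ω : ℝ) (n : ℕ) : Prop where
  pos : 0 < γ
  lt : γ < a
  om_pos : 0 < ω
  om_lt : ω < 2 * γ
  eq : 2 * a = 2 * (γ * n) + 2 * γ + ω

theorem exists_lev {a γ : ℝ} (h0 : 0 < γ) (h1 : γ < a) (hi : Ind a γ) :
    ∃ ω n, Lev a γ ω n ∧ Ind γ ω := by
  have hf : 0 ≤ (2 * a - 2 * γ) / (2 * γ) := div_nonneg (by linarith) (by linarith)
  have h2 := Nat.floor_le hf
  have h3 := Nat.lt_floor_add_one ((2 * a - 2 * γ) / (2 * γ))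
  generalize ⌊(2 * a - 2 * γ) / (2 * γ)⌋₊ = n at h2 h3
  rw [le_div_iff₀ (by positivity)] at h2
  rw [div_lt_iff₀ (by positivity)] at h3
  have hne : (2 : ℝ) * a - 2 * γ - 2 * (γ * n) ≠ 0 := by
    intro h
    have := hi 2 (-2 - 2 * n) (by push_cast; linarith)
    have h' : (2 : ℚ) + 2 * n = 0 := by linarith
    have : (0 : ℚ) ≤ n := by positivity
    linarith
  refine ⟨2 * a - 2 * γ - 2 * (γ * n), n,
    ⟨h0, h1, lt_of_le_of_ne (by linarith) hne.symm, by linarith, by ring⟩, ?_⟩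
  intro p q h
  by_contra hq
  have hq' : (q : ℝ) ≠ 0 := by exact_mod_cast hq
  have h4 := hi (2 * q) (p - 2 * q - 2 * q * n) (by push_cast; linarith)
  have h5 : (p : ℝ) = 2 * q + 2 * q * n := by
    have : p = 2 * q + 2 * q * n := by linarith
    rw [this]; push_cast; ring
  rw [h5] at h
  have h6 : (q : ℝ) * (2 * a) = 0 := by linarith
  rcases mul_eq_zero.1 h6 with h6 | h6
  · exact hq' h6
  · linarith

theorem ind_ne {a w : ℝ} (h : Ind a w) : w ≠ a := by
  rintro rfl
  have := h 1 (-1) (by push_cast; ring)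
  norm_num at this

theorem ind_two_sub {a w : ℝ} (h : Ind a w) : Ind a (2 * a - w) := by
  intro p q hpq
  have := h (p + 2 * q) (-q) (by push_cast; linarith)
  linarith

/-- Some point with an odd closed orbit has the next code `c`. -/
def CodeGood (a w : ℝ) (c : Bool × Bool) : Prop :=
  ∃ p p', Good (StepC a w) p ∧ StepC a w c p p'

theorem exists_good_of_mem {a w : ℝ} {l : List (Bool × Bool)} {p p' : ℝ × ℝ}
    (hp : Good (StepC a w) p) (h : Run (StepC a w) l p p') {c : Bool × Bool} (hc : c ∈ l) :
    CodeGood a w c := by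
  obtain ⟨l₁, l₂, rfl⟩ := List.append_of_mem hc
  obtain ⟨m, h1, m', h2, -⟩ := run_append.1 h
  exact ⟨m, m', good_of_good_run stepC_det h1 hp, h2⟩

theorem codeGood_plus {a w : ℝ} (hw : 0 < w) (hwa : w < 2 * a) : CodeGood a w (true, false) := by
  have h1 : InT a w (w, -w) := by refine ⟨?_, ?_, ?_, ?_⟩ <;> (try simp) <;> linarith
  have h2 : StepC a w (true, false) (w, -w) (w, -w) :=
    ⟨h1, h1, by simp only [act, kap]; ext <;> simp; ring⟩
  exact ⟨_, _, ⟨[(true, false)], by simp, _, h2, rfl⟩, h2⟩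

theorem codeGood_minus {a w : ℝ} (hw : a < w) (hwa : w < 2 * a) :
    CodeGood a w (false, true) := by
  have h1 : InT a w (2 * a - w, 2 * a - w) := by
    refine ⟨?_, ?_, ?_, ?_⟩ <;> (try simp) <;> linarith
  have h2 : StepC a w (false, true) (2 * a - w, 2 * a - w) (2 * a - w, 2 * a - w) :=
    ⟨h1, h1, by simp only [act, kap]; ext <;> simp; ring⟩
  exact ⟨_, _, ⟨[(false, true)], by simp, _, h2, rfl⟩, h2⟩

section

variable {a γ ω : ℝ} {n : ℕ}

theorem codeGood_liftBig (h : Lev a γ ω n) {c d : Bool × Bool} (hc : CodeGood γ ω c)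
    (hd : d ∈ liftBig n c) : CodeGood a (2 * a - γ) d := by
  obtain ⟨p, p', h1, h2⟩ := hc
  have hr := run_liftBig h.pos h.om_pos h.om_lt h.eq
  exact exists_good_of_mem (good_lift (odd_liftBig n) hr h1) (hr _ _ _ h2) hd

theorem codeGood_liftSmall (h : Lev a γ ω n) {c d : Bool × Bool} (hc : CodeGood γ ω c)
    (hd : d ∈ liftSmall n c) : CodeGood a γ d := by
  obtain ⟨p, p', h1, h2⟩ := hc
  have hr := run_liftSmall h.pos h.om_pos h.om_lt h.eq
  exact exists_good_of_mem (good_lift (odd_liftSmall n) hr (good_rev (R := StepC γ ω)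
    (good_of_good_run (l := [c]) stepC_det (run_singleton.2 h2) h1))) (hr c p' p h2) hd

theorem codeGood_false_true {a w : ℝ} (hw : 0 < w) (hwa : w < 2 * a) (hi : Ind a w) :
    CodeGood a w (false, true) := by
  rcases lt_or_gt_of_ne (ind_ne hi) with h | h
  · obtain ⟨ω, n, hl, hi'⟩ := exists_lev hw h hi
    rcases lt_or_gt_of_ne (ind_ne hi') with h' | h'
    · obtain ⟨ω', n', hl', -⟩ := exists_lev hl.om_pos h' hi'
      have h1 := codeGood_liftSmall hl' (codeGood_plus hl'.om_pos hl'.om_lt)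
        (d := (false, false)) (by simp [liftSmall])
      exact codeGood_liftSmall hl h1 (by simp [liftSmall])
    · exact codeGood_liftSmall hl (codeGood_minus h' hl.om_lt) (by simp [liftSmall])
  · exact codeGood_minus h hwa

theorem codeGood_of_step {a w : ℝ} (hw : 0 < w) (hwa : w < 2 * a) (hi : Ind a w)
    {c : Bool × Bool} {z z' : ℝ × ℝ} (hz : StepC a w c z z') : CodeGood a w c := by
  rcases lt_or_gt_of_ne (ind_ne hi) with h | h
  · obtain ⟨ω, n, hl, hi'⟩ := exists_lev hw h hi
    have h1 := codeGood_false_true hl.om_pos hl.om_lt hi'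
    refine codeGood_liftSmall hl h1 ?_
    obtain ⟨i1, i2, rfl⟩ := hz
    rcases c with ⟨_ | _, _ | _⟩
    · simp [liftSmall, rep_succ]
    · simp [liftSmall, rep_succ]
    · simp [liftSmall, rep_succ]
    · exfalso
      simp only [InT, act, kap] at i1 i2
      simp at i1 i2
      linarith
  · obtain ⟨ω, n, hl, hi'⟩ := exists_lev (γ := 2 * a - w) (by linarith) (by linarith)
      (ind_two_sub hi)
    have h1 := codeGood_false_true hl.om_pos hl.om_lt hi'
    have h2 := codeGood_liftBig hl h1 (d := c) (by
      rcases c with ⟨_ | _, _ | _⟩ <;> simp [liftBig, rep_succ])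
    rwa [sub_sub_cancel] at h2

end

theorem dist_le_of_inT {a w : ℝ} (hw : 0 < w) (hwa : w < 2 * a) {z p : ℝ × ℝ}
    (hz : InT a w z) (hp : InT a w p) : dist z p ≤ 8 * a := by
  obtain ⟨h1, h2, h3, h4⟩ := hz
  obtain ⟨k1, k2, k3, k4⟩ := hp
  rw [Prod.dist_eq]
  refine max_le ?_ ?_ <;> rw [Real.dist_eq, abs_le] <;> constructor <;> linarith

/-- Every generic point is approximated in both time directions. -/
def AllApprox (Λ : Submodule ℚ ℝ) (a w ε : ℝ) : Prop :=
  ∀ z, InT a w z → Gen Λ z → Approx (StepC a w) z ε ∧ Approx (Rev (StepC a w)) z ε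

section

variable {Λ : Submodule ℚ ℝ} {a w ε : ℝ}

theorem allApprox_base (hw : 0 < w) (hwa : w < 2 * a) (hi : Ind a w) (haΛ : a ∈ Λ) (hwΛ : w ∈ Λ)
    (hε : 8 * a ≤ ε) : AllApprox Λ a w ε := by
  intro z hz hg
  constructor
  · obtain ⟨c, z', -, h⟩ := exists_succ hw hwa haΛ hwΛ hz hg
    obtain ⟨p, p', h1, h2⟩ := codeGood_of_step hw hwa hi h
    exact ⟨p, h1, ⟨c, z', p', h, h2⟩, Or.inr ((dist_le_of_inT hw hwa hz h2.1).trans hε)⟩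
  · obtain ⟨c, z', -, h⟩ := exists_pred hw hwa haΛ hwΛ hz hg
    obtain ⟨p, p', h1, h2⟩ := codeGood_of_step hw hwa hi h
    exact ⟨p', good_rev (good_of_good_run (l := [c]) stepC_det (run_singleton.2 h2) h1),
      ⟨c, z', p, h, h2⟩, Or.inr ((dist_le_of_inT hw hwa hz h2.2.1).trans hε)⟩

theorem approx_of_reach {γ ω : ℝ} {n : ℕ} (hl : Lev a γ ω n) (hw : w = γ ∨ w = 2 * a - γ)
    (hγΛ : γ ∈ Λ) (hωΛ : ω ∈ Λ) (h : AllApprox Λ γ ω ε) {z : ℝ × ℝ}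
    (hr : Reach Λ a w γ ω n z) : Approx (StepC a w) z ε ∧ Approx (Rev (StepC a w)) z ε := by
  rcases hr with ⟨p, h1, h2⟩ | ⟨l, q, h1, h2, h3⟩
  · exact ⟨approx_of_pairLoop h1 h2 _, approx_of_pairLoop (good_rev h1) (pairLoop_rev h2) _⟩
  · rcases hw with rfl | rfl
    · refine approx_lift (R' := Rev (StepC w ω)) stepC_det_rev stepC_det stepC_iso
        (odd_liftSmall n) (run_liftSmall hl.pos hl.om_pos hl.om_lt hl.eq) dist_psi
        (G := fun q => InT w ω q ∧ Gen Λ q) ?_ ?_ ⟨h2, h3⟩ h1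
      · rintro q ⟨i1, i2⟩
        obtain ⟨c, z', h4, h5⟩ := exists_succ hl.om_pos hl.om_lt hγΛ hωΛ i1 i2
        exact ⟨c, z', ⟨h5.2.1, h4⟩, h5⟩
      · rintro q ⟨i1, i2⟩
        exact (h q i1 i2).symm
    · refine approx_lift (R' := StepC γ ω) stepC_det_rev stepC_det_rev stepC_iso
        (odd_liftBig n) (run_liftBig hl.pos hl.om_pos hl.om_lt hl.eq) dist_psi
        (G := fun q => InT γ ω q ∧ Gen Λ q) ?_ ?_ ⟨h2, h3⟩ h1
      · rintro q ⟨i1, i2⟩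
        obtain ⟨c, z', h4, h5⟩ := exists_pred hl.om_pos hl.om_lt hγΛ hωΛ i1 i2
        exact ⟨c, z', ⟨h5.1, h4⟩, h5⟩
      · rintro q ⟨i1, i2⟩
        exact h q i1 i2

theorem om_mem {γ ω : ℝ} {n : ℕ} (hl : Lev a γ ω n) (haΛ : a ∈ Λ) (hγΛ : γ ∈ Λ) : ω ∈ Λ := by
  convert lin_mem haΛ hγΛ 2 (-2 - 2 * n) using 1
  have := hl.eq
  push_cast
  linarith

/-- The renormalization step at a parameter pair. -/
theorem exists_renorm (hw : 0 < w) (hwa : w < 2 * a) (hi : Ind a w) :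
    ∃ γ ω n, Lev a γ ω n ∧ Ind γ ω ∧ (w = γ ∨ w = 2 * a - γ) := by
  rcases lt_or_gt_of_ne (ind_ne hi) with h | h
  · obtain ⟨ω, n, h1, h2⟩ := exists_lev hw h hi
    exact ⟨w, ω, n, h1, h2, Or.inl rfl⟩
  · obtain ⟨ω, n, h1, h2⟩ := exists_lev (γ := 2 * a - w) (by linarith) (by linarith)
      (ind_two_sub hi)
    exact ⟨_, ω, n, h1, h2, Or.inr (by ring)⟩

theorem renorm_mem {γ : ℝ} (haΛ : a ∈ Λ) (hwΛ : w ∈ Λ) (h : w = γ ∨ w = 2 * a - γ) : γ ∈ Λ := by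
  rcases h with rfl | h
  · exact hwΛ
  · convert lin_mem haΛ hwΛ 2 (-1) using 1
    push_cast; linarith

theorem allApprox_step {γ ω : ℝ} {n : ℕ} (hl : Lev a γ ω n) (hw : w = γ ∨ w = 2 * a - γ)
    (haΛ : a ∈ Λ) (hwΛ : w ∈ Λ) (h : AllApprox Λ γ ω ε) : AllApprox Λ a w ε := by
  intro z hz hg
  have hγΛ := renorm_mem haΛ hwΛ hw
  refine approx_of_reach hl hw hγΛ (om_mem hl haΛ hγΛ) h ?_
  rcases hw with rfl | rfl
  · exact reach_small hl.pos hl.om_pos hl.eq hγΛ haΛ hg hz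
  · exact reach_big hl.pos hl.om_pos hl.eq hγΛ haΛ hg hz

theorem renorm_two_le {γ ω γ' ω' : ℝ} {n n' : ℕ} (hl : Lev a γ ω n) (hl' : Lev γ γ' ω' n')
    (h : ω = γ' ∨ ω = 2 * γ - γ') : γ' ≤ 3 / 4 * a := by
  have h1 := hl'.lt
  have h0 := hl.pos.trans hl.lt
  by_cases h2 : γ ≤ 3 / 4 * a
  · linarith
  · have h3 := hl.eq
    have : 0 ≤ γ * n := mul_nonneg hl.pos.le (by positivity)
    rcases h with h | h <;> linarith

theorem allApprox (hε : 0 < ε) (hw : 0 < w) (hwa : w < 2 * a) (hi : Ind a w) (haΛ : a ∈ Λ)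
    (hwΛ : w ∈ Λ) : AllApprox Λ a w ε := by
  obtain ⟨k, hk⟩ : ∃ k : ℕ, 8 * a ≤ ε * (4 / 3) ^ k := by
    obtain ⟨k, hk⟩ := pow_unbounded_of_one_lt (8 * a / ε) (show (1 : ℝ) < 4 / 3 by norm_num)
    rw [div_lt_iff₀ hε] at hk
    exact ⟨k, by linarith⟩
  induction k generalizing a w with
  | zero => exact allApprox_base hw hwa hi haΛ hwΛ (by simpa using hk)
  | succ k ih =>
    obtain ⟨γ, ω, n, h1, h2, h3⟩ := exists_renorm hw hwa hi
    have hγΛ := renorm_mem haΛ hwΛ h3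
    have hωΛ := om_mem h1 haΛ hγΛ
    obtain ⟨γ', ω', n', k1, k2, k3⟩ := exists_renorm h1.om_pos h1.om_lt h2
    have hγΛ' := renorm_mem hγΛ hωΛ k3
    have hωΛ' := om_mem k1 hγΛ hγΛ'
    refine allApprox_step h1 h3 haΛ hwΛ (allApprox_step k1 k3 hγΛ hωΛ
      (ih k1.om_pos k1.om_lt k2 hγΛ' hωΛ' ?_))
    have := renorm_two_le h1 k1 k3
    rw [pow_succ] at hk
    linarith

end

/-- The interior of `F₁`. -/
def HIn (s : ℝ) (z : ℝ × ℝ) : Prop :=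
  -s < z.2 ∧ z.2 < s ∧ -1 < z.1 - z.2 ∧ z.1 - z.2 < 1

/-- The closed parallelogram `F₁`. -/
def HCl (s : ℝ) (z : ℝ × ℝ) : Prop :=
  -s ≤ z.2 ∧ z.2 ≤ s ∧ -1 ≤ z.1 - z.2 ∧ z.1 - z.2 ≤ 1

/-- The clockwise quarter turn. -/
def turn (z : ℝ × ℝ) : ℝ × ℝ := (z.2, -z.1)

/-- The affine map with code `c`: a clockwise quarter turn after a translation. -/
def hact (s : ℝ) (c : ℤ × ℤ) (z : ℝ × ℝ) : ℝ × ℝ :=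
  (z.2 + 2 * s * c.2, -z.1 - 2 * c.1 + 2 * s * c.2)

/-- The coded transition relation of `f'` followed by a quarter turn. -/
def HStep (s : ℝ) (c : ℤ × ℤ) (z z' : ℝ × ℝ) : Prop := HIn s z ∧ HIn s z' ∧ z' = hact s c z

/-- Composition of the affine maps along a list of codes. -/
def hacts (s : ℝ) : List (ℤ × ℤ) → ℝ × ℝ → ℝ × ℝ
  | [], z => z
  | c :: l, z => hacts s l (hact s c z)

section

variable {s : ℝ}

theorem HIn.cl {z : ℝ × ℝ} (h : HIn s z) : HCl s z :=
  ⟨h.1.le, h.2.1.le, h.2.2.1.le, h.2.2.2.le⟩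

theorem HIn.neg {z : ℝ × ℝ} (h : HIn s z) : HIn s (-z) := by
  obtain ⟨h1, h2, h3, h4⟩ := h
  refine ⟨?_, ?_, ?_, ?_⟩ <;> simp <;> linarith

theorem int_eq_zero_of_abs_lt {c : ℝ} (hc : 0 < c) (n : ℤ) (h1 : -c < c * n) (h2 : c * n < c) :
    n = 0 := by
  have h3 : (n : ℝ) < 1 := by nlinarith
  have h4 : (-1 : ℝ) < n := by nlinarith
  have h5 : n < 1 := by exact_mod_cast h3
  have h6 : -1 < n := by exact_mod_cast h4
  omega

/-- Interior points and closed points do not differ by a nontrivial lattice vector. -/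
theorem lattice_unique (hs : 0 < s) {z z' : ℝ × ℝ} (m n : ℤ) (h : HIn s z) (h' : HCl s z')
    (h1 : z'.2 - z.2 = 2 * s * n) (h2 : (z'.1 - z'.2) - (z.1 - z.2) = 2 * m) :
    m = 0 ∧ n = 0 := by
  obtain ⟨a1, a2, a3, a4⟩ := h
  obtain ⟨b1, b2, b3, b4⟩ := h'
  exact ⟨int_eq_zero_of_abs_lt (c := 2) (by norm_num) m (by linarith) (by linarith),
    int_eq_zero_of_abs_lt (c := 2 * s) (by linarith) n (by linarith) (by linarith)⟩

theorem lattice_unique' (hs : 0 < s) {z z' : ℝ × ℝ} (m n : ℤ) (h : HIn s z) (h' : HCl s z')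
    (h1 : z'.2 - z.2 = 2 * s * n - 2 * m) (h2 : (z'.1 - z'.2) - (z.1 - z.2) = 2 * m) :
    m = 0 ∧ n = 0 := by
  have hm : m = 0 := by
    obtain ⟨a1, a2, a3, a4⟩ := h
    obtain ⟨b1, b2, b3, b4⟩ := h'
    exact int_eq_zero_of_abs_lt (c := 2) (by norm_num) m (by linarith) (by linarith)
  subst hm
  exact lattice_unique hs 0 n h h' (by simpa using h1) (by simpa using h2)

theorem hstep_det (hs : 0 < s) : Det (HStep s) := by
  rintro ⟨m, n⟩ ⟨m', n'⟩ z z1 z2 ⟨h1, h2, rfl⟩ ⟨-, h3, rfl⟩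
  obtain ⟨h4, h5⟩ := lattice_unique' hs (m' - m) (n' - n) h2 h3.cl
    (by simp only [hact]; push_cast; ring) (by simp only [hact]; push_cast; ring)
  obtain rfl : m' = m := by omega
  obtain rfl : n' = n := by omega
  exact ⟨rfl, rfl⟩

theorem HStep.neg {c : ℤ × ℤ} {z z' : ℝ × ℝ} (h : HStep s c z z') :
    HStep s (-c) (-z) (-z') := by
  obtain ⟨h1, h2, rfl⟩ := h
  refine ⟨h1.neg, h2.neg, ?_⟩
  simp only [hact]; ext <;> simp <;> ring

theorem run_neg {l : List (ℤ × ℤ)} {z z' : ℝ × ℝ} (h : Run (HStep s) l z z') :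
    Run (HStep s) (l.map Neg.neg) (-z) (-z') := by
  induction l generalizing z with
  | nil => cases h; rfl
  | cons c l ih =>
    obtain ⟨m, h1, h2⟩ := h
    exact ⟨_, h1.neg, ih h2⟩

theorem run_eq_hacts {l : List (ℤ × ℤ)} {z z' : ℝ × ℝ} (h : Run (HStep s) l z z') :
    z' = hacts s l z := by
  induction l generalizing z with
  | nil => cases h; rfl
  | cons c l ih =>
    obtain ⟨m, ⟨-, -, rfl⟩, h2⟩ := h
    exact ih h2

theorem hacts_append (l₁ l₂ : List (ℤ × ℤ)) (z : ℝ × ℝ) :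
    hacts s (l₁ ++ l₂) z = hacts s l₂ (hacts s l₁ z) := by
  induction l₁ generalizing z with
  | nil => rfl
  | cons c l ih => exact ih _

theorem hact_add (c : ℤ × ℤ) (z u : ℝ × ℝ) : hact s c (z + u) = hact s c z + turn u := by
  simp only [hact, turn]; ext <;> simp <;> ring

theorem hacts_add (l : List (ℤ × ℤ)) (z u : ℝ × ℝ) :
    hacts s l (z + u) = hacts s l z + turn^[l.length] u := by
  induction l generalizing z u with
  | nil => rfl
  | cons c l ih => simp only [hacts, hact_add, ih, List.length_cons, Function.iterate_succ_apply]

theorem turn_two (u : ℝ × ℝ) : turn^[2] u = -u := rfl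

theorem turn_iter_cases (k : ℕ) (u : ℝ × ℝ) :
    (Even k ∧ (turn^[k] u = u ∨ turn^[k] u = -u)) ∨
      (Odd k ∧ (turn^[k] u = turn u ∨ turn^[k] u = -turn u)) := by
  induction k with
  | zero => left; exact ⟨⟨0, rfl⟩, Or.inl rfl⟩
  | succ k ih =>
    rw [Function.iterate_succ_apply']
    rcases ih with ⟨h, h1 | h1⟩ | ⟨h, h1 | h1⟩ <;> rw [h1]
    · exact Or.inr ⟨h.add_one, Or.inl rfl⟩
    · exact Or.inr ⟨h.add_one, Or.inr (by simp [turn])⟩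
    · exact Or.inl ⟨h.add_one, Or.inr rfl⟩
    · exact Or.inl ⟨h.add_one, Or.inl (by simp [turn])⟩

theorem turn_iter_odd_double {k : ℕ} (hk : Odd k) (u : ℝ × ℝ) : turn^[k + k] u = -u := by
  obtain ⟨j, rfl⟩ := hk
  have : 2 * j + 1 + (2 * j + 1) = 2 * (2 * j + 1) := by ring
  rw [this, Function.iterate_mul]
  have h2 : (turn^[2]) = fun u => -u := funext turn_two
  rw [h2]
  have : (fun u : ℝ × ℝ => -u)^[2 * j + 1] u = -u := by
    rw [Function.iterate_succ_apply', Function.iterate_mul]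
    have : (fun u : ℝ × ℝ => -u)^[2] = id := by funext x; simp
    rw [this]; simp
  exact this

/-- A point which returns to itself or to its antipode after an odd number of steps. -/
def GoodH (s : ℝ) (p : ℝ × ℝ) : Prop :=
  ∃ l, Odd l.length ∧ (Run (HStep s) l p p ∨ Run (HStep s) l p (-p))

theorem GoodH.run_double {p : ℝ × ℝ} {l : List (ℤ × ℤ)}
    (h : Run (HStep s) l p p ∨ Run (HStep s) l p (-p)) :
    ∃ l', l'.length = l.length + l.length ∧ Run (HStep s) l' p p := by
  rcases h with h | h
  · exact ⟨l ++ l, by simp, run_append.2 ⟨_, h, h⟩⟩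
  · refine ⟨l ++ l.map Neg.neg, by simp, run_append.2 ⟨_, h, ?_⟩⟩
    have := run_neg h
    rwa [neg_neg] at this

theorem GoodH.exists_double {p : ℝ × ℝ} (h : GoodH s p) :
    ∃ l k, Odd k ∧ l.length = k + k ∧ Run (HStep s) l p p := by
  obtain ⟨l, h1, h2⟩ := h
  obtain ⟨l', h3, h4⟩ := GoodH.run_double h2
  exact ⟨l', _, h1, h3, h4⟩

end

/-- The points whose images along the code sequence of `p` stay in the interior. -/
def InCell (s : ℝ) (p z : ℝ × ℝ) : Prop :=
  ∀ l p', Run (HStep s) l p p' → HIn s (hacts s l z)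

/-- The points whose images along the code sequence of `p` stay in the closed domain. -/
def ClCell (s : ℝ) (p z : ℝ × ℝ) : Prop :=
  ∀ l p', Run (HStep s) l p p' → HCl s (hacts s l z)

section

variable {s : ℝ}

theorem reach_finite (hs : 0 < s) {p : ℝ × ℝ} {L : List (ℤ × ℤ)} (hL : L ≠ [])
    (h : Run (HStep s) L p p) : {p' | ∃ l, Run (HStep s) l p p'}.Finite := by
  refine ((Set.finite_Iic L.length).image fun i => hacts s (L.take i) p).subset ?_
  rintro p' ⟨l, hl⟩
  induction hn : l.length using Nat.strong_induction_on generalizing l with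
  | _ n ih =>
    subst hn
    rcases le_total l.length L.length with h1 | h1
    · obtain ⟨l₂, rfl, -⟩ := run_prefix (hstep_det hs) hl h h1
      exact ⟨l.length, by simp, by simp [run_eq_hacts hl]⟩
    · obtain ⟨l₂, rfl, h2⟩ := run_prefix (hstep_det hs) h hl h1
      refine ih l₂.length ?_ l₂ h2 rfl
      have := List.length_pos_iff.2 hL
      simp; omega

theorem GoodH.reach_hIn {p p' : ℝ × ℝ} (hs : 0 < s) (h : GoodH s p) {l : List (ℤ × ℤ)}
    (hl : Run (HStep s) l p p') : HIn s p' := by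
  obtain ⟨L, k, hk, hL, hr⟩ := h.exists_double
  have h1 := run_rep hr (l.length + 1)
  obtain ⟨l₂, h2, h3⟩ := run_prefix (hstep_det hs) hl h1 (by
    rw [length_rep, hL]; have := hk.pos; nlinarith)
  cases l₂ with
  | nil =>
    have := congrArg List.length h2
    rw [length_rep, hL] at this
    have := hk.pos
    simp at *; nlinarith
  | cons c l => obtain ⟨m, h4, -⟩ := h3; exact h4.1

/-- Every point in the orbit of a good point is reached, up to sign, with all four rotations of
a perturbation. -/
theorem GoodH.reach_rotated {p p' : ℝ × ℝ} (h : GoodH s p) {l : List (ℤ × ℤ)}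
    (hl : Run (HStep s) l p p') (u v : ℝ × ℝ)
    (hv : (v = u ∨ v = -u) ∨ (v = turn u ∨ v = -turn u)) :
    ∃ p'', (p'' = p' ∨ p'' = -p') ∧ ∀ w, (w = v ∨ w = -v) →
      ∃ l', Run (HStep s) l' p p'' ∧ hacts s l' (p + u) = p'' + w := by
  obtain ⟨L, hodd, hL⟩ := id h
  obtain ⟨M, k, hk, hM, hrM⟩ := h.exists_double
  -- the two lists with each parity
  have key : ∀ l'' p'', Run (HStep s) l'' p p'' →
      ∀ w, (w = turn^[l''.length] u ∨ w = -turn^[l''.length] u) →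
      ∃ l', Run (HStep s) l' p p'' ∧ hacts s l' (p + u) = p'' + w := by
    rintro l'' p'' h1 w (rfl | rfl)
    · exact ⟨l'', h1, by rw [hacts_add, run_eq_hacts h1]⟩
    · refine ⟨M ++ l'', run_append.2 ⟨_, hrM, h1⟩, ?_⟩
      rw [hacts_append, hacts_add, ← run_eq_hacts hrM, hM, turn_iter_odd_double hk, hacts_add,
        ← run_eq_hacts h1]
      congr 1
      have : ∀ (k : ℕ) (u : ℝ × ℝ), turn^[k] (-u) = -turn^[k] u := by
        intro k
        induction k with
        | zero => simp
        | succ k ih => intro u; simp only [Function.iterate_succ_apply]; rw [← ih]; rfl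
      exact this _ _
  have key2 : ∃ l'' p'', Run (HStep s) l'' p p'' ∧ (p'' = p' ∨ p'' = -p') ∧
      (l''.length = L.length + l.length) := by
    rcases hL with hL | hL
    · exact ⟨L ++ l, p', run_append.2 ⟨_, hL, hl⟩, Or.inl rfl, by simp⟩
    · exact ⟨L ++ l.map Neg.neg, -p', run_append.2 ⟨_, hL, run_neg hl⟩, Or.inr rfl, by simp⟩
  obtain ⟨l2, p2, h2, hp2, hlen⟩ := key2
  have hpar : (∃ l'' p'', Run (HStep s) l'' p p'' ∧ (p'' = p' ∨ p'' = -p') ∧ Even l''.length) ∧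
      (∃ l'' p'', Run (HStep s) l'' p p'' ∧ (p'' = p' ∨ p'' = -p') ∧ Odd l''.length) := by
    rcases Nat.even_or_odd l.length with he | ho
    · exact ⟨⟨l, p', hl, Or.inl rfl, he⟩, ⟨l2, p2, h2, hp2, hlen ▸ hodd.add_even he⟩⟩
    · exact ⟨⟨l2, p2, h2, hp2, hlen ▸ hodd.add_odd ho⟩, ⟨l, p', hl, Or.inl rfl, ho⟩⟩
  obtain ⟨⟨la, pa, ha, hpa, hae⟩, lb, pb, hb, hpb, hbo⟩ := hpar
  rcases hv with hv | hv
  · refine ⟨pa, hpa, fun w hw => key la pa ha w ?_⟩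
    have hw' : w = u ∨ w = -u := by rcases hv with rfl | rfl <;> simpa [or_comm] using hw
    rcases turn_iter_cases la.length u with ⟨-, h | h⟩ | ⟨h, -⟩
    · rw [h]; exact hw'
    · rw [h, neg_neg]; exact hw'.symm
    · exact absurd hae (Nat.not_even_iff_odd.2 h)
  · refine ⟨pb, hpb, fun w hw => key lb pb hb w ?_⟩
    have hw' : w = turn u ∨ w = -turn u := by
      rcases hv with rfl | rfl
      · exact hw
      · rw [neg_neg] at hw; exact hw.symm
    rcases turn_iter_cases lb.length u with ⟨h, -⟩ | ⟨-, h | h⟩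
    · exact absurd hbo (Nat.not_odd_iff_even.2 h)
    · rw [h]; exact hw'
    · rw [h, neg_neg]; exact hw'.symm

theorem abs_add_abs_le {a b c : ℝ} (h1 : |b + a| ≤ c) (h2 : |b + -a| ≤ c) : |a| + |b| ≤ c := by
  rw [abs_le] at h1 h2
  rcases abs_cases a with ⟨h, -⟩ | ⟨h, -⟩ <;> rcases abs_cases b with ⟨h', -⟩ | ⟨h', -⟩ <;>
    rw [h, h'] <;> linarith

theorem abs_add_abs_lt {a b c : ℝ} (h1 : |b + a| < c) (h2 : |b + -a| < c) : |a| + |b| < c := by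
  rw [abs_lt] at h1 h2
  rcases abs_cases a with ⟨h, -⟩ | ⟨h, -⟩ <;> rcases abs_cases b with ⟨h', -⟩ | ⟨h', -⟩ <;>
    rw [h, h'] <;> linarith

theorem hIn_iff {z : ℝ × ℝ} : HIn s z ↔ |z.2| < s ∧ |z.1 - z.2| < 1 := by
  simp only [HIn, abs_lt]; tauto

theorem hCl_iff {z : ℝ × ℝ} : HCl s z ↔ |z.2| ≤ s ∧ |z.1 - z.2| ≤ 1 := by
  simp only [HCl, abs_le]; tauto

/-- The cell of a good point is an octagon centered at that point. -/
theorem GoodH.cell_shape {p : ℝ × ℝ} (hs : 0 < s) (h : GoodH s p) :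
    ∃ r t : ℝ, 0 < r ∧ 0 < t ∧
      (∀ u : ℝ × ℝ, InCell s p (p + u) ↔ |u.1| < r ∧ |u.2| < r ∧ |u.1| + |u.2| < t) ∧
      (∀ u : ℝ × ℝ, ClCell s p (p + u) ↔ |u.1| ≤ r ∧ |u.2| ≤ r ∧ |u.1| + |u.2| ≤ t) := by
  have hfin : {p' | ∃ l, Run (HStep s) l p p'}.Finite := by
    obtain ⟨L, k, hk, hL, hr⟩ := h.exists_double
    refine reach_finite hs (L := L) ?_ hr
    rintro rfl
    have := hk.pos
    simp at hL; omega
  have hne : {p' | ∃ l, Run (HStep s) l p p'}.Nonempty := ⟨p, [], rfl⟩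
  obtain ⟨q, ⟨l1, hl1⟩, hq⟩ := Set.exists_min_image _ (fun p' => s - |p'.2|) hfin hne
  obtain ⟨q', ⟨l2, hl2⟩, hq'⟩ := Set.exists_min_image _ (fun p' => 1 - |p'.1 - p'.2|) hfin hne
  have hqI := hIn_iff.1 (h.reach_hIn hs hl1)
  have hqI' := hIn_iff.1 (h.reach_hIn hs hl2)
  have dir : ∀ (l : List (ℤ × ℤ)) (u : ℝ × ℝ), (|(turn^[l.length] u).2| = |u.1| ∨
      |(turn^[l.length] u).2| = |u.2|) ∧
      |(turn^[l.length] u).1 - (turn^[l.length] u).2| ≤ |u.1| + |u.2| := by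
    intro l u
    have e1 := abs_add_le u.1 u.2
    have e2 := abs_sub u.1 u.2
    have e3 : |-u.1 - u.2| = |u.1 + u.2| := by rw [← abs_neg]; ring_nf
    rcases turn_iter_cases l.length u with ⟨-, h | h⟩ | ⟨-, h | h⟩ <;> rw [h]
    · exact ⟨Or.inr rfl, e2⟩
    · refine ⟨Or.inr (by simp), ?_⟩
      have : (-u).1 - (-u).2 = -(u.1 - u.2) := by simp; ring
      rw [this, abs_neg]; exact e2
    · refine ⟨Or.inl (by simp [turn]), ?_⟩
      simp only [turn]; rwa [sub_neg_eq_add, add_comm]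
    · refine ⟨Or.inl (by simp [turn]), ?_⟩
      have : (-turn u).1 - (-turn u).2 = -(u.1 + u.2) := by simp [turn]; ring
      rw [this, abs_neg]; exact e1
  refine ⟨s - |q.2|, 1 - |q'.1 - q'.2|, by linarith, by linarith, fun u => ⟨fun hc => ?_, ?_⟩,
    fun u => ⟨fun hc => ?_, ?_⟩⟩
  · have key : ∀ {p' l}, Run (HStep s) l p p' → ∀ v, ((v = u ∨ v = -u) ∨ v = turn u ∨ v = -turn u) →
        |v.2| + |p'.2| < s ∧ |v.1 - v.2| + |p'.1 - p'.2| < 1 := by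
      intro p' l hl v hv
      obtain ⟨p'', hp'', hw⟩ := h.reach_rotated hl u v hv
      obtain ⟨la, ha, ea⟩ := hw v (Or.inl rfl)
      obtain ⟨lb, hb, eb⟩ := hw (-v) (Or.inr rfl)
      have ia := hIn_iff.1 (hc _ _ ha)
      have ib := hIn_iff.1 (hc _ _ hb)
      rw [ea] at ia
      rw [eb] at ib
      have j1 := abs_add_abs_lt ia.1 ib.1
      have j2 := abs_add_abs_lt (a := v.1 - v.2) (b := p''.1 - p''.2) (c := 1)
        (by convert ia.2 using 2; simp; ring) (by convert ib.2 using 2; simp; ring)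
      rcases hp'' with rfl | rfl
      · exact ⟨j1, j2⟩
      · rw [Prod.snd_neg, abs_neg] at j1
        rw [Prod.snd_neg, Prod.fst_neg, ← neg_sub', abs_neg] at j2
        exact ⟨j1, j2⟩
    have k1 := (key hl1 u (by simp)).1
    have k2 := (key hl1 (turn u) (by simp)).1
    have k3 := (key hl2 u (by simp)).2
    have k4 := (key hl2 (turn u) (by simp)).2
    simp only [turn, abs_neg, sub_neg_eq_add] at k2 k4
    refine ⟨by linarith, by linarith, ?_⟩
    rw [abs_sub_comm] at k3
    have := abs_add_abs_lt (a := u.1) (b := u.2) (c := 1 - |q'.1 - q'.2|) (by linarith)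
      (by rw [← sub_eq_add_neg]; linarith)
    exact this
  · rintro ⟨h1, h2, h3⟩ l p' hl
    have e1 := hq p' ⟨l, hl⟩
    have e2 := hq' p' ⟨l, hl⟩
    obtain ⟨d1, d2⟩ := dir l u
    rw [hacts_add, ← run_eq_hacts hl, hIn_iff]
    constructor
    · refine (abs_add_le _ _).trans_lt ?_
      rcases d1 with d1 | d1 <;> rw [d1] <;> linarith
    · have : (p' + turn^[l.length] u).1 - (p' + turn^[l.length] u).2 = (p'.1 - p'.2) +
        ((turn^[l.length] u).1 - (turn^[l.length] u).2) := by simp; ring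
      rw [this]
      refine (abs_add_le _ _).trans_lt ?_
      linarith
  · have key : ∀ {p' l}, Run (HStep s) l p p' → ∀ v, ((v = u ∨ v = -u) ∨ v = turn u ∨ v = -turn u) →
        |v.2| + |p'.2| ≤ s ∧ |v.1 - v.2| + |p'.1 - p'.2| ≤ 1 := by
      intro p' l hl v hv
      obtain ⟨p'', hp'', hw⟩ := h.reach_rotated hl u v hv
      obtain ⟨la, ha, ea⟩ := hw v (Or.inl rfl)
      obtain ⟨lb, hb, eb⟩ := hw (-v) (Or.inr rfl)
      have ia := hCl_iff.1 (hc _ _ ha)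
      have ib := hCl_iff.1 (hc _ _ hb)
      rw [ea] at ia
      rw [eb] at ib
      have j1 := abs_add_abs_le ia.1 ib.1
      have j2 := abs_add_abs_le (a := v.1 - v.2) (b := p''.1 - p''.2) (c := 1)
        (by convert ia.2 using 2; simp; ring) (by convert ib.2 using 2; simp; ring)
      rcases hp'' with rfl | rfl
      · exact ⟨j1, j2⟩
      · rw [Prod.snd_neg, abs_neg] at j1
        rw [Prod.snd_neg, Prod.fst_neg, ← neg_sub', abs_neg] at j2
        exact ⟨j1, j2⟩
    have k1 := (key hl1 u (by simp)).1
    have k2 := (key hl1 (turn u) (by simp)).1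
    have k3 := (key hl2 u (by simp)).2
    have k4 := (key hl2 (turn u) (by simp)).2
    simp only [turn, abs_neg, sub_neg_eq_add] at k2 k4
    refine ⟨by linarith, by linarith, ?_⟩
    rw [abs_sub_comm] at k3
    have := abs_add_abs_le (a := u.1) (b := u.2) (c := 1 - |q'.1 - q'.2|) (by linarith)
      (by rw [← sub_eq_add_neg]; linarith)
    exact this
  · rintro ⟨h1, h2, h3⟩ l p' hl
    have e1 := hq p' ⟨l, hl⟩
    have e2 := hq' p' ⟨l, hl⟩
    obtain ⟨d1, d2⟩ := dir l u
    rw [hacts_add, ← run_eq_hacts hl, hCl_iff]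
    constructor
    · refine (abs_add_le _ _).trans ?_
      rcases d1 with d1 | d1 <;> rw [d1] <;> linarith
    · have : (p' + turn^[l.length] u).1 - (p' + turn^[l.length] u).2 = (p'.1 - p'.2) +
        ((turn^[l.length] u).1 - (turn^[l.length] u).2) := by simp; ring
      rw [this]
      refine (abs_add_le _ _).trans ?_
      linarith

/-- Points of the open cell follow the codes of the center. -/
theorem run_of_inCell {p z : ℝ × ℝ} (h : InCell s p z) {l : List (ℤ × ℤ)} {p' : ℝ × ℝ}
    (hl : Run (HStep s) l p p') : Run (HStep s) l z (hacts s l z) := by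
  induction l generalizing p z with
  | nil => rfl
  | cons c l ih =>
    obtain ⟨m, h1, h2⟩ := hl
    have h3 : InCell s m (hact s c z) := fun l p' hr => h (c :: l) p' ⟨_, h1, hr⟩
    exact ⟨_, ⟨h [] p rfl, h [c] m (run_singleton.2 h1), rfl⟩, ih h3 h2⟩

/-- A list of twice an odd number of codes has at most one fixed point. -/
theorem fixed_unique {l : List (ℤ × ℤ)} {k : ℕ} (hk : Odd k) (hl : l.length = k + k)
    {p p' : ℝ × ℝ} (h : hacts s l p = p) (h' : hacts s l p' = p') : p = p' := by
  have h1 : hacts s l (p + (p' - p)) = hacts s l p + turn^[l.length] (p' - p) := hacts_add _ _ _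
  rw [hl, turn_iter_odd_double hk, h, add_sub_cancel, h'] at h1
  have e1 := congrArg Prod.fst h1
  have e2 := congrArg Prod.snd h1
  simp at e1 e2
  ext <;> linarith

/-- Open cells of distinct good points are disjoint. -/
theorem cell_disjoint (hs : 0 < s) {p p' z : ℝ × ℝ} (h : GoodH s p) (h' : GoodH s p')
    (hz : InCell s p z) (hz' : InCell s p' z) : p = p' := by
  obtain ⟨L, k, hk, hL, hr⟩ := h.exists_double
  obtain ⟨L', k', hk', hL', hr'⟩ := h'.exists_double
  have r1 := run_rep hr k'
  have r2 := run_rep hr' k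
  have len1 : (rep k' L).length = k' * k + k' * k := by rw [length_rep, hL]; ring
  have len2 : (rep k L').length = k' * k + k' * k := by rw [length_rep, hL']; ring
  obtain ⟨l₂, e, -⟩ := run_prefix (hstep_det hs) (run_of_inCell hz r1) (run_of_inCell hz' r2)
    (by rw [len1, len2])
  have : l₂ = [] := by
    have := congrArg List.length e
    rw [List.length_append, len1, len2] at this
    exact List.length_eq_zero_iff.1 (by omega)
  rw [this, List.append_nil] at e
  rw [e] at r2
  exact fixed_unique (hk'.mul hk) len1 (run_eq_hacts r1).symm (run_eq_hacts r2).symm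

theorem goodH_countable : {p | GoodH s p}.Countable := by
  have hc : ∀ p : {p | GoodH s p}, ∃ l k, Odd k ∧ l.length = k + k ∧ Run (HStep s) l p p :=
    fun p => p.2.exists_double
  choose L k hk hL hr using hc
  have : Function.Injective L := by
    intro p p' e
    have h2 := run_eq_hacts (hr p')
    rw [← e] at h2
    exact Subtype.ext (fixed_unique (hk p) (hL p) (run_eq_hacts (hr p)).symm h2.symm)
  exact Set.countable_coe_iff.1 this.countable

end

/-- The closed central tile `F₁ ∩ F₂`. -/
def Ctr (s : ℝ) (z : ℝ × ℝ) : Prop := HCl s z ∧ HCl s (turn z)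

/-- One application of `f'` on `F₁`, followed by a quarter turn. -/
def UStep (s : ℝ) (p q : ℝ × ℝ) : Prop :=
  HCl s p ∧ HCl s q ∧ (∃ c, q = hact s c p) ∧ ∀ c, HCl s (hact s c p) → hact s c p = q

/-- Equality up to powers of the quarter turn. -/
def Sim (w x : ℝ × ℝ) : Prop := (w = x ∨ w = -x) ∨ (w = turn x ∨ w = -turn x)

section

variable {s : ℝ}

theorem mem_F1_iff (hs : 0 < s) {z : ℝ × ℝ} : z ∈ F1 s ↔ HCl s z := by
  constructor
  · rintro ⟨a, b, ⟨ha, ha'⟩, ⟨hb, hb'⟩, rfl⟩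
    refine ⟨?_, ?_, ?_, ?_⟩ <;> simp <;> nlinarith
  · rintro ⟨h1, h2, h3, h4⟩
    refine ⟨(z.1 - z.2) / 2, z.2 / (2 * s), ⟨by linarith, by linarith⟩, ⟨?_, ?_⟩, ?_⟩
    · rw [le_div_iff₀ (by linarith)]; linarith
    · rw [div_le_iff₀ (by linarith)]; linarith
    · ext <;> simp <;> field_simp; ring

theorem HCl.neg {z : ℝ × ℝ} (h : HCl s z) : HCl s (-z) := by
  obtain ⟨h1, h2, h3, h4⟩ := h
  refine ⟨?_, ?_, ?_, ?_⟩ <;> simp <;> linarith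

theorem hCl_neg {z : ℝ × ℝ} : HCl s (-z) ↔ HCl s z :=
  ⟨fun h => by simpa using h.neg, HCl.neg⟩

theorem turn_neg (z : ℝ × ℝ) : turn (-z) = -turn z := rfl

theorem turn_turn (z : ℝ × ℝ) : turn (turn z) = -z := rfl

theorem rotQ_turn (z : ℝ × ℝ) : rotQ (turn z) = z := by ext <;> simp [rotQ, turn]

theorem turn_rotQ (z : ℝ × ℝ) : turn (rotQ z) = z := by ext <;> simp [rotQ, turn]

theorem turn_inj {z w : ℝ × ℝ} (h : turn z = turn w) : z = w := by
  rw [← rotQ_turn z, h, rotQ_turn]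

theorem mem_F2_iff (hs : 0 < s) {z : ℝ × ℝ} : z ∈ F2 s ↔ HCl s (turn z) := by
  rw [F2, ← mem_F1_iff hs]
  constructor
  · rintro ⟨w, hw, rfl⟩; rwa [turn_rotQ]
  · intro h; exact ⟨_, h, rotQ_turn z⟩

theorem mem_L2_iff {p q : ℝ × ℝ} : q - p ∈ L2 s ↔ ∃ c, turn q = hact s c p := by
  constructor
  · rintro ⟨m, n, h⟩
    refine ⟨(m, -n), ?_⟩
    have e1 := congrArg Prod.fst h
    have e2 := congrArg Prod.snd h
    simp at e1 e2
    ext <;> simp [turn, hact] <;> linarith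
  · rintro ⟨⟨m, n⟩, h⟩
    refine ⟨m, -n, ?_⟩
    have e1 := congrArg Prod.fst h
    have e2 := congrArg Prod.snd h
    simp [turn, hact] at e1 e2
    ext <;> simp <;> linarith

theorem mem_L1_iff {p q : ℝ × ℝ} : q - p ∈ L1 s ↔ ∃ c, turn (turn q) = hact s c (turn p) := by
  constructor
  · rintro ⟨m, n, h⟩
    refine ⟨(m, -n), ?_⟩
    have e1 := congrArg Prod.fst h
    have e2 := congrArg Prod.snd h
    simp at e1 e2
    ext <;> simp [turn, hact] <;> linarith
  · rintro ⟨⟨m, n⟩, h⟩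
    refine ⟨m, -n, ?_⟩
    have e1 := congrArg Prod.fst h
    have e2 := congrArg Prod.snd h
    simp [turn, hact] at e1 e2
    ext <;> simp <;> linarith

theorem unique_step_iff {F L : Set (ℝ × ℝ)} {τ : ℝ × ℝ → ℝ × ℝ} (hτ : Function.Bijective τ)
    {p p' : ℝ × ℝ} (hF : ∀ z, z ∈ F ↔ HCl s (τ z))
    (hL : ∀ q, q - p ∈ L ↔ ∃ c, τ q = hact s c p') (q : ℝ × ℝ) :
    ((∃! v, v ∈ L ∧ p + v ∈ F) ∧ q - p ∈ L ∧ q ∈ F) ↔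
      (HCl s (τ q) ∧ (∃ c, τ q = hact s c p') ∧ ∀ c, HCl s (hact s c p') → hact s c p' = τ q) := by
  constructor
  · rintro ⟨⟨v, -, hv⟩, h1, h2⟩
    refine ⟨(hF q).1 h2, (hL q).1 h1, fun c hc => ?_⟩
    obtain ⟨q', hq'⟩ := hτ.2 (hact s c p')
    have e1 := hv (q - p) ⟨h1, by simpa using h2⟩
    have e2 := hv (q' - p) ⟨(hL q').2 ⟨c, hq'⟩, by
      rw [add_sub_cancel, hF, hq']; exact hc⟩
    rw [← hq', sub_left_inj.1 (e2.trans e1.symm)]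
  · rintro ⟨h1, h2, h3⟩
    refine ⟨⟨q - p, ⟨(hL q).2 h2, by rw [add_sub_cancel, hF]; exact h1⟩, ?_⟩, (hL q).2 h2,
      (hF q).2 h1⟩
    rintro v ⟨hv1, hv2⟩
    have hv1' : (p + v) - p ∈ L := by rwa [add_sub_cancel_left]
    obtain ⟨c, hc⟩ := (hL _).1 hv1'
    have := h3 c (hc ▸ (hF _).1 hv2)
    rw [← hc] at this
    rw [← hτ.1 this, add_sub_cancel_left]

theorem turn_bijective : Function.Bijective turn :=
  ⟨fun _ _ => turn_inj, fun z => ⟨rotQ z, turn_rotQ z⟩⟩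

theorem stepRel_iff (hs : 0 < s) {p q : ℝ × ℝ} :
    StepRel s p q ↔ UStep s p (turn q) ∨ UStep s (turn p) (turn (turn q)) := by
  have k1 := unique_step_iff (s := s) (p := p) (p' := p) turn_bijective (fun z => mem_F2_iff hs)
    (fun q => mem_L2_iff) q
  have k2 := unique_step_iff (s := s) (F := F1 s) (p := p) (p' := turn p)
    (turn_bijective.comp turn_bijective)
    (fun z => by rw [mem_F1_iff hs, Function.comp_apply, turn_turn, hCl_neg])
    (fun q => mem_L1_iff) q
  constructor
  · rintro ⟨j, h1, h2⟩
    fin_cases j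
    · exact Or.inl ⟨(mem_F1_iff hs).1 h1, k1.1 h2⟩
    · exact Or.inr ⟨(mem_F2_iff hs).1 h1, k2.1 h2⟩
  · rintro (⟨h1, h2⟩ | ⟨h1, h2⟩)
    · exact ⟨0, (mem_F1_iff hs).2 h1, k1.2 h2⟩
    · exact ⟨1, (mem_F2_iff hs).2 h1, k2.2 h2⟩

theorem UStep.neg {p q : ℝ × ℝ} (h : UStep s p q) : UStep s (-p) (-q) := by
  have e : ∀ c z, hact s (-c) (-z) = -hact s c z := by
    intro c z; simp only [hact]; ext <;> simp <;> ring
  obtain ⟨h1, h2, ⟨c, rfl⟩, h3⟩ := h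
  refine ⟨h1.neg, h2.neg, ⟨-c, (e _ _).symm⟩, fun c' hc' => ?_⟩
  have := e (-c') p
  rw [neg_neg] at this
  rw [this] at hc' ⊢
  rw [h3 _ (hCl_neg.1 hc')]

theorem uStep_of_hStep (hs : 0 < s) {c : ℤ × ℤ} {z z' : ℝ × ℝ} (h : HStep s c z z') :
    UStep s z z' := by
  obtain ⟨h1, h2, rfl⟩ := h
  refine ⟨h1.cl, h2.cl, ⟨c, rfl⟩, fun c' hc' => ?_⟩
  obtain ⟨m, n⟩ := c
  obtain ⟨m', n'⟩ := c'
  obtain ⟨h4, h5⟩ := lattice_unique' hs (m' - m) (n' - n - 2 * 0) h2 hc'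
    (by simp only [hact]; push_cast; ring) (by simp only [hact]; push_cast; ring)
  obtain rfl : m' = m := by omega
  obtain rfl : n' = n := by omega
  rfl

theorem mapRel_of_hStep (hs : 0 < s) {c d : ℤ × ℤ} {z z' z'' : ℝ × ℝ} (h : HStep s c z z')
    (h' : HStep s d z' z'') : MapRel s z (-z'') := by
  refine ⟨rotQ z', (stepRel_iff hs).2 (Or.inl ?_), (stepRel_iff hs).2 (Or.inr ?_)⟩
  · rw [turn_rotQ]; exact uStep_of_hStep hs h
  · rw [turn_rotQ, turn_turn, neg_neg]; exact uStep_of_hStep hs h'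

theorem iterRel_succ {n : ℕ} {p q r : ℝ × ℝ} (h : MapRel s p r) (h' : IterRel s n r q) :
    IterRel s (n + 1) p q := by
  induction n generalizing q with
  | zero => cases h'; exact ⟨p, rfl, h⟩
  | succ n ih =>
    obtain ⟨t, h1, h2⟩ := h'
    exact ⟨t, ih h1, h2⟩

theorem iterRel_of_run (hs : 0 < s) (n : ℕ) {l : List (ℤ × ℤ)} {z z' : ℝ × ℝ}
    (h : Run (HStep s) l z z') (hl : l.length = n + n) :
    IterRel s n z (if Even n then z' else -z') := by
  induction n generalizing l z z' with
  | zero =>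
    obtain rfl : l = [] := List.length_eq_zero_iff.1 hl
    cases h; simp [IterRel]
  | succ n ih =>
    match l, hl, h with
    | [], hl, _ => simp at hl
    | [c], hl, _ => simp at hl; omega
    | c :: d :: l, hl, h =>
      obtain ⟨z1, h1, z2, h2, h3⟩ := h
      refine iterRel_succ (mapRel_of_hStep hs h1 h2) ?_
      have := ih (run_neg h3) (by simp at hl ⊢; omega)
      by_cases hn : Even n
      · simpa [Nat.even_add_one, hn] using this
      · simpa [Nat.even_add_one, hn] using this

/-- The open cell of a good point is uniformly periodic. -/
theorem GoodH.iterRel (hs : 0 < s) {p : ℝ × ℝ} (h : GoodH s p) :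
    ∃ n, 0 < n ∧ ∀ z, InCell s p z → IterRel s n z z := by
  obtain ⟨L, k, hk, hL, hr⟩ := h.exists_double
  refine ⟨k + k, by have := hk.pos; omega, fun z hz => ?_⟩
  have h1 := run_of_inCell hz (run_append.2 ⟨p, hr, hr⟩)
  have e : hacts s (L ++ L) z = z := by
    have e1 : ∀ u, hacts s L (p + u) = p - u := by
      intro u
      rw [hacts_add, ← run_eq_hacts hr, hL, turn_iter_odd_double hk, sub_eq_add_neg]
    have e2 : z = p + (z - p) := by abel
    rw [hacts_append, e2, e1, sub_eq_add_neg, e1, sub_neg_eq_add]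
  rw [e] at h1
  simpa using iterRel_of_run hs (k + k) h1 (by simp [hL])

theorem run_of_iterRel {n : ℕ} {z z' : ℝ × ℝ} (h : IterRel s n z z') :
    Run (fun _ : Unit => StepRel s) (List.replicate (n + n) ()) z z' := by
  induction n generalizing z' with
  | zero => exact h
  | succ n ih =>
    obtain ⟨r, h1, r', h2, h3⟩ := h
    have : n + 1 + (n + 1) = (n + n) + 2 := by ring
    rw [this, List.replicate_add, run_append]
    exact ⟨r, ih h1, r', h2, z', h3, rfl⟩

/-- The central tile is backward invariant. -/
theorem ctr_of_hStep (hs : 0 < s) {c : ℤ × ℤ} {z z' : ℝ × ℝ} (h : HStep s c z z')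
    (h' : Ctr s z') : Ctr s z := by
  obtain ⟨h1, h2, h3⟩ := h
  obtain ⟨m, n⟩ := c
  have h4 := h'.2
  obtain ⟨a1, a2, a3, a4⟩ := id h1
  obtain ⟨b1, b2, b3, b4⟩ := h4.neg
  have e1 : (-turn z').2 = z.2 + 2 * s * n := by rw [h3]; simp [turn, hact]
  have e2 : (-turn z').1 = z.1 + 2 * m - 2 * s * n := by rw [h3]; simp [turn, hact]; ring
  obtain rfl : n = 0 := int_eq_zero_of_abs_lt (c := 2 * s) (by linarith) n (by linarith)
    (by linarith)
  have e3 : 2 * s * ((0 : ℤ) : ℝ) = 0 := by simp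
  obtain rfl : m = 0 := int_eq_zero_of_abs_lt (c := 2) (by norm_num) m (by linarith) (by linarith)
  have : z' = turn z := by rw [h3]; ext <;> simp [hact, turn]
  exact ⟨h1.cl, this ▸ h2.cl⟩

theorem exists_int_shift (hs : 0 < s) (y : ℝ) : ∃ k : ℤ, |y + 2 * s * k| ≤ s := by
  refine ⟨-round (y / (2 * s)), ?_⟩
  have h := abs_sub_round (y / (2 * s))
  have e : y + 2 * s * ((-round (y / (2 * s)) : ℤ) : ℝ) =
      2 * s * (y / (2 * s) - round (y / (2 * s))) := by
    push_cast; field_simp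
    ring
  rw [e, abs_mul, abs_of_pos (by linarith : 0 < 2 * s)]
  nlinarith

/-- Landing on the boundary is never unique. -/
theorem not_unique_of_boundary (hs : 0 < s) {c : ℤ × ℤ} {z : ℝ × ℝ} (h : HCl s (hact s c z))
    (h' : ¬HIn s (hact s c z)) : ∃ d, HCl s (hact s d z) ∧ hact s d z ≠ hact s c z := by
  obtain ⟨m, n⟩ := c
  obtain ⟨h1, h2⟩ := hCl_iff.1 h
  rw [hIn_iff, not_and_or, not_lt, not_lt] at h'
  have shift : ∀ i j : ℤ, hact s (m + i, n + j) z =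
      hact s (m, n) z + (2 * s * j, -2 * i + 2 * s * j) := by
    intro i j; simp only [hact]; push_cast; ext <;> simp <;> ring
  rcases h' with h' | h'
  · obtain ⟨e, he, he'⟩ : ∃ e : ℤ, (e = 1 ∨ e = -1) ∧ |(hact s (m, n) z).2 + 2 * s * e| ≤ s := by
      rcases (le_abs'.1 h') with h3 | h3
      · refine ⟨1, Or.inl rfl, ?_⟩
        rw [abs_le] at h1 ⊢; push_cast; constructor <;> linarith
      · refine ⟨-1, Or.inr rfl, ?_⟩
        rw [abs_le] at h1 ⊢; push_cast; constructor <;> linarith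
    refine ⟨(m + 0, n + e), ?_, ?_⟩
    · rw [shift, hCl_iff]
      refine ⟨by simpa using he', ?_⟩
      convert h2 using 2; simp
    · rw [shift]
      intro h4
      have := congrArg Prod.fst h4
      simp at this
      rcases he with rfl | rfl <;> rcases this with h | h <;> simp_all
  · obtain ⟨e, he, he'⟩ : ∃ e : ℤ, (e = 1 ∨ e = -1) ∧
        |((hact s (m, n) z).1 - (hact s (m, n) z).2) + 2 * e| ≤ 1 := by
      rcases (le_abs'.1 h') with h3 | h3
      · refine ⟨1, Or.inl rfl, ?_⟩
        rw [abs_le] at h2 ⊢; push_cast; constructor <;> linarith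
      · refine ⟨-1, Or.inr rfl, ?_⟩
        rw [abs_le] at h2 ⊢; push_cast; constructor <;> linarith
    obtain ⟨k, hk⟩ := exists_int_shift hs ((hact s (m, n) z).2 - 2 * e)
    refine ⟨(m + e, n + k), ?_, ?_⟩
    · rw [shift, hCl_iff]
      refine ⟨?_, ?_⟩
      · convert hk using 2; simp; ring
      · convert he' using 2; simp; ring
    · rw [shift]
      intro h4
      have h5 := congrArg Prod.fst h4
      have h6 := congrArg Prod.snd h4
      simp only [Prod.fst_add, Prod.snd_add, add_eq_left] at h5 h6
      rw [h5] at h6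
      rcases he with rfl | rfl <;> simp at h6

theorem Sim.turn {w x : ℝ × ℝ} (h : Sim w x) : Sim (OctPET.turn w) x := by
  rcases h with (rfl | rfl) | (rfl | rfl)
  · exact Or.inr (Or.inl rfl)
  · exact Or.inr (Or.inr rfl)
  · exact Or.inl (Or.inr rfl)
  · exact Or.inl (Or.inl (by rw [turn_neg, turn_turn, neg_neg]))

theorem sim_of_turn {w x : ℝ × ℝ} (h : Sim (turn w) x) : Sim w x := by
  have := h.turn.turn.turn
  rwa [turn_turn, turn_turn, neg_neg] at this

/-- A step from a point similar to a point outside the central tile. -/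
theorem uStep_of_stepRel (hs : 0 < s) {w x q : ℝ × ℝ} (hw : Sim w x) (hx : HCl s x)
    (hc : ¬Ctr s x) (h : StepRel s w q) : ∃ q', UStep s x q' ∧ Sim q q' := by
  have key : ∀ w q, Sim w x → UStep s w q → ∃ q', UStep s x q' ∧ Sim q q' := by
    rintro w q ((rfl | rfl) | (rfl | rfl)) h
    · exact ⟨q, h, Or.inl (Or.inl rfl)⟩
    · exact ⟨-q, by simpa using h.neg, Or.inl (Or.inr (by simp))⟩
    · exact absurd ⟨hx, h.1⟩ hc
    · exact absurd ⟨hx, hCl_neg.1 h.1⟩ hc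
  rcases (stepRel_iff hs).1 h with h | h
  · obtain ⟨q', h1, h2⟩ := key _ _ hw h
    exact ⟨q', h1, sim_of_turn h2⟩
  · obtain ⟨q', h1, h2⟩ := key _ _ hw.turn h
    exact ⟨q', h1, sim_of_turn (sim_of_turn h2)⟩

/-- Orbits which hit the boundary are not defined forever. -/
theorem false_of_boundary (hs : 0 < s) {l : List (ℤ × ℤ)} {c : ℤ × ℤ} {x x' w q : ℝ × ℝ}
    {k : List Unit} (hl : Run (HStep s) l x x') (hx' : HIn s x') (hcl : HCl s (hact s c x'))
    (hin : ¬HIn s (hact s c x')) (hx : ¬Ctr s x) (hw : Sim w x) (hk : l.length < k.length)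
    (hrun : Run (fun _ : Unit => StepRel s) k w q) : False := by
  induction l generalizing x w k with
  | nil =>
    cases hl
    match k, hk, hrun with
    | d :: k, _, ⟨m, h1, _⟩ =>
      obtain ⟨q', ⟨-, -, -, h4⟩, -⟩ := uStep_of_stepRel hs hw hx'.cl hx h1
      obtain ⟨d, hd, hne⟩ := not_unique_of_boundary hs hcl hin
      exact hne ((h4 d hd).trans (h4 c hcl).symm)
  | cons d l ih =>
    obtain ⟨x1, h1, h2⟩ := hl
    match k, hk, hrun with
    | e :: k, hk, ⟨m, h3, h4⟩ =>
      obtain ⟨q', ⟨-, -, -, h5⟩, h6⟩ := uStep_of_stepRel hs hw h1.1.cl hx h3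
      have h7 : x1 = q' := by
        have := h5 d (h1.2.2 ▸ h1.2.1.cl)
        rw [← this]; exact h1.2.2
      exact ih h2 (fun h => hx (ctr_of_hStep hs h1 h)) (h7 ▸ h6) (by simpa using hk) h4

/-- Boundary points of a cell away from the central tile and the boundary of the domain are not
periodic. -/
theorem not_iterRel_of_boundary (hs : 0 < s) {p z : ℝ × ℝ} (hcl : ClCell s p z)
    (hin : ¬InCell s p z) (hz : HIn s z) (hc : ¬Ctr s z) {n : ℕ} (hn : 0 < n) :
    ¬IterRel s n z z := by
  intro hit
  have hex : ∃ l c p', Run (HStep s) (l ++ [c]) p p' ∧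
      Run (HStep s) l z (hacts s l z) ∧ HIn s (hacts s l z) ∧
        ¬HIn s (hact s c (hacts s l z)) := by
    by_contra hcon
    apply hin
    have : ∀ l p', Run (HStep s) l p p' → Run (HStep s) l z (hacts s l z) ∧
        HIn s (hacts s l z) := by
      intro l
      induction l using List.reverseRecOn with
      | nil => intro p' _; exact ⟨rfl, hz⟩
      | append_singleton l c ih =>
        intro p' hr
        obtain ⟨m, h1, h2⟩ := run_append.1 hr
        obtain ⟨h3, h4⟩ := ih m h1
        by_cases h5 : HIn s (hact s c (hacts s l z))
        · rw [hacts_append]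
          exact ⟨run_append.2 ⟨_, h3, run_singleton.2 ⟨h4, h5, rfl⟩⟩, h5⟩
        · exact absurd ⟨l, c, p', hr, h3, h4, h5⟩ hcon
    exact fun l p' hr => (this l p' hr).2
  obtain ⟨l, c, p', h1, h2, h3, h4⟩ := hex
  have h5 := hcl _ _ h1
  rw [hacts_append] at h5
  have h6 := run_rep (run_of_iterRel hit) (l.length + 1)
  exact false_of_boundary hs h2 h3 h5 h4 hc (Or.inl (Or.inl rfl))
    (by rw [length_rep, List.length_replicate]; nlinarith) h6

end

/-- The centrally symmetric octagon with axis-parallel radius `r` and diagonal radius `t`. -/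
def oct (p : ℝ × ℝ) (r t : ℝ) : Set (ℝ × ℝ) :=
  {z | |z.1 - p.1| ≤ r ∧ |z.2 - p.2| ≤ r ∧ |z.1 - p.1| + |z.2 - p.2| ≤ t}

/-- The interior of `oct p r t`. -/
def octInt (p : ℝ × ℝ) (r t : ℝ) : Set (ℝ × ℝ) :=
  {z | |z.1 - p.1| < r ∧ |z.2 - p.2| < r ∧ |z.1 - p.1| + |z.2 - p.2| < t}

theorem convex_oct (p : ℝ × ℝ) (r t : ℝ) : Convex ℝ (oct p r t) := by
  have h1 : ConvexOn ℝ univ fun z : ℝ × ℝ => |z.1 - p.1| := by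
    refine ⟨convex_univ, fun x _ y _ a b ha hb hab => ?_⟩
    have : (a • x + b • y).1 - p.1 = a * (x.1 - p.1) + b * (y.1 - p.1) := by
      simp; linear_combination p.1 * hab
    beta_reduce
    rw [this]
    refine (abs_add_le _ _).trans ?_
    simp [abs_mul, abs_of_nonneg, ha, hb]
  have h2 : ConvexOn ℝ univ fun z : ℝ × ℝ => |z.2 - p.2| := by
    refine ⟨convex_univ, fun x _ y _ a b ha hb hab => ?_⟩
    have : (a • x + b • y).2 - p.2 = a * (x.2 - p.2) + b * (y.2 - p.2) := by
      simp; linear_combination p.2 * hab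
    beta_reduce
    rw [this]
    refine (abs_add_le _ _).trans ?_
    simp [abs_mul, abs_of_nonneg, ha, hb]
  have e : oct p r t = {z ∈ univ | |z.1 - p.1| ≤ r} ∩ ({z ∈ univ | |z.2 - p.2| ≤ r} ∩
      {z ∈ univ | ((fun z : ℝ × ℝ => |z.1 - p.1|) + fun z : ℝ × ℝ => |z.2 - p.2|) z ≤ t}) := by
    ext z; simp [oct]
  rw [e]
  exact (h1.convex_le r).inter ((h2.convex_le r).inter ((h1.add h2).convex_le t))

theorem isOpen_octInt (p : ℝ × ℝ) (r t : ℝ) : IsOpen (octInt p r t) := by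
  have e : octInt p r t = {z | |z.1 - p.1| < r} ∩ ({z | |z.2 - p.2| < r} ∩
    {z | |z.1 - p.1| + |z.2 - p.2| < t}) := by ext; simp [octInt]
  rw [e]
  refine (isOpen_lt (by fun_prop) (by fun_prop)).inter
    ((isOpen_lt (by fun_prop) (by fun_prop)).inter (isOpen_lt (by fun_prop) (by fun_prop)))

theorem isClosed_oct (p : ℝ × ℝ) (r t : ℝ) : IsClosed (oct p r t) := by
  have e : oct p r t = {z | |z.1 - p.1| ≤ r} ∩ ({z | |z.2 - p.2| ≤ r} ∩
    {z | |z.1 - p.1| + |z.2 - p.2| ≤ t}) := by ext; simp [oct]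
  rw [e]
  refine (isClosed_le (by fun_prop) (by fun_prop)).inter
    ((isClosed_le (by fun_prop) (by fun_prop)).inter (isClosed_le (by fun_prop) (by fun_prop)))

theorem octInt_subset (p : ℝ × ℝ) (r t : ℝ) : octInt p r t ⊆ oct p r t :=
  fun _ h => ⟨h.1.le, h.2.1.le, h.2.2.le⟩

theorem interior_oct (p : ℝ × ℝ) (r t : ℝ) : interior (oct p r t) = octInt p r t := by
  refine Subset.antisymm (fun z hz => ?_)
    (interior_maximal (octInt_subset p r t) (isOpen_octInt p r t))
  obtain ⟨ε, hε, hb⟩ := Metric.isOpen_iff.1 isOpen_interior z hz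
  have key : ∀ a b : ℝ, |a| ≤ ε / 2 → |b| ≤ ε / 2 → z + (a, b) ∈ oct p r t := by
    intro a b ha hb'
    refine interior_subset (hb ?_)
    rw [Metric.mem_ball, dist_eq_norm, add_sub_cancel_left, Prod.norm_def]
    simp only [Real.norm_eq_abs]
    exact max_lt (by linarith) (by linarith)
  have k1 := key (ε / 2) 0 (by rw [abs_of_pos (half_pos hε)]) (by simp; linarith)
  have k2 := key (-(ε / 2)) 0 (by rw [abs_neg, abs_of_pos (half_pos hε)]) (by simp; linarith)
  have k3 := key 0 (ε / 2) (by simp; linarith) (by rw [abs_of_pos (half_pos hε)])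
  have k4 := key 0 (-(ε / 2)) (by simp; linarith) (by rw [abs_neg, abs_of_pos (half_pos hε)])
  simp only [oct, mem_ofPred_eq, Prod.fst_add, Prod.snd_add, add_zero] at k1 k2 k3 k4
  have f1 := abs_le.1 k1.1
  have f2 := abs_le.1 k2.1
  have f3 := abs_le.1 k3.2.1
  have f4 := abs_le.1 k4.2.1
  refine ⟨abs_lt.2 ⟨by linarith, by linarith⟩, abs_lt.2 ⟨by linarith, by linarith⟩, ?_⟩
  have g1 := le_abs_self (z.1 + ε / 2 - p.1)
  have g2 := neg_le_abs (z.1 + -(ε / 2) - p.1)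
  rcases abs_cases (z.1 - p.1) with ⟨h, -⟩ | ⟨h, -⟩ <;> rw [h] <;> linarith

theorem mem_of_hseg {H : Set (ℝ × ℝ)} (hH : Convex ℝ H) {a c x y : ℝ} (h1 : (a - c, y) ∈ H)
    (h2 : (a + c, y) ∈ H) (hx : |x| ≤ c) : (a + x, y) ∈ H := by
  rcases (abs_nonneg x |>.trans hx).eq_or_lt with h0 | h0
  · subst h0
    have : x = 0 := abs_nonpos_iff.1 hx
    subst this; exact h2
  rw [abs_le] at hx
  have := hH h1 h2 (a := (c - x) / (2 * c)) (b := (c + x) / (2 * c))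
    (div_nonneg (by linarith) (by linarith)) (div_nonneg (by linarith) (by linarith))
    (by field_simp; ring)
  convert this using 1
  ext <;> simp <;> field_simp <;> ring

theorem mem_of_vseg {H : Set (ℝ × ℝ)} (hH : Convex ℝ H) {a c x y : ℝ} (h1 : (y, a - c) ∈ H)
    (h2 : (y, a + c) ∈ H) (hx : |x| ≤ c) : (y, a + x) ∈ H := by
  rcases (abs_nonneg x |>.trans hx).eq_or_lt with h0 | h0
  · subst h0
    have : x = 0 := abs_nonpos_iff.1 hx
    subst this; exact h2
  rw [abs_le] at hx
  have := hH h1 h2 (a := (c - x) / (2 * c)) (b := (c + x) / (2 * c))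
    (div_nonneg (by linarith) (by linarith)) (div_nonneg (by linarith) (by linarith))
    (by field_simp; ring)
  convert this using 1
  ext <;> simp <;> field_simp <;> ring

/-- The vertices of `oct p r t`. -/
def octVerts (p : ℝ × ℝ) (r t : ℝ) : Finset (ℝ × ℝ) :=
  (({r, -r} : Finset ℝ) ×ˢ ({t - r, r - t} : Finset ℝ) ∪
    ({t - r, r - t} : Finset ℝ) ×ˢ ({r, -r} : Finset ℝ)).image fun v => p + v

theorem oct_eq_convexHull (p : ℝ × ℝ) {r t : ℝ} (h1 : r ≤ t) (h2 : t ≤ 2 * r) :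
    oct p r t = convexHull ℝ (octVerts p r t : Set (ℝ × ℝ)) := by
  have memV : ∀ v : ℝ × ℝ, v ∈ (octVerts p r t : Set (ℝ × ℝ)) ↔ ∃ a b : ℝ,
      (((a = r ∨ a = -r) ∧ (b = t - r ∨ b = r - t)) ∨
        ((a = t - r ∨ a = r - t) ∧ (b = r ∨ b = -r))) ∧ v = (p.1 + a, p.2 + b) := by
    intro v
    simp only [octVerts, Finset.coe_image, mem_image, Finset.mem_coe, Finset.mem_union,
      Finset.mem_product, Finset.mem_insert, Finset.mem_singleton]
    constructor
    · rintro ⟨⟨a, b⟩, h, rfl⟩; exact ⟨a, b, h, rfl⟩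
    · rintro ⟨a, b, h, rfl⟩; exact ⟨(a, b), h, rfl⟩
  apply Subset.antisymm
  · have hH := convex_convexHull ℝ (octVerts p r t : Set (ℝ × ℝ))
    have vert : ∀ a b : ℝ, (((a = r ∨ a = -r) ∧ (b = t - r ∨ b = r - t)) ∨
        ((a = t - r ∨ a = r - t) ∧ (b = r ∨ b = -r))) →
        (p.1 + a, p.2 + b) ∈ convexHull ℝ (octVerts p r t : Set (ℝ × ℝ)) :=
      fun a b h => subset_convexHull ℝ _ ((memV _).2 ⟨a, b, h, rfl⟩)
    generalize convexHull ℝ (octVerts p r t : Set (ℝ × ℝ)) = H at *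
    -- the two horizontal extreme points of a slice
    have ends : ∀ σ : ℝ, (σ = 1 ∨ σ = -1) → ∀ y, |y| ≤ r →
        (p.1 + σ * min r (t - |y|), p.2 + y) ∈ H := by
      intro σ hσ y hy
      rcases le_total r (t - |y|) with h | h
      · rw [min_eq_left h]
        refine mem_of_vseg hH (c := t - r) ?_ ?_ (by linarith)
        · rw [sub_eq_add_neg]; apply vert; left; rcases hσ with rfl | rfl <;> simp
        · apply vert; left; rcases hσ with rfl | rfl <;> simp
      · rw [min_eq_right h]
        obtain ⟨τ, hτ, hy'⟩ : ∃ τ : ℝ, (τ = 1 ∨ τ = -1) ∧ y = τ * |y| := by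
          rcases abs_cases y with ⟨h, -⟩ | ⟨h, -⟩
          · exact ⟨1, Or.inl rfl, by rw [h]; ring⟩
          · exact ⟨-1, Or.inr rfl, by rw [h]; ring⟩
        have A : (p.1 + σ * r, p.2 + τ * (t - r)) ∈ H := by
          apply vert; left; rcases hσ with rfl | rfl <;> rcases hτ with rfl | rfl <;> simp
        have B : (p.1 + σ * (t - r), p.2 + τ * r) ∈ H := by
          apply vert; right; rcases hσ with rfl | rfl <;> rcases hτ with rfl | rfl <;> simp
        rcases h2.eq_or_lt with h3 | h3
        · have : |y| = r := by linarith
          rw [this] at hy' ⊢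
          rw [hy']; exact B
        have hd : 0 < 2 * r - t := by linarith
        obtain ⟨e, he⟩ : ∃ e, (2 * r - t) * e = 1 := ⟨(2 * r - t)⁻¹, mul_inv_cancel₀ hd.ne'⟩
        have he0 : 0 ≤ e := by
          by_contra hcon
          nlinarith
        have := hH A B (a := (r - |y|) * e) (b := (|y| - (t - r)) * e)
          (mul_nonneg (by linarith) he0) (mul_nonneg (by linarith) he0)
          (by linear_combination he)
        convert this using 1
        generalize |y| = m at *
        subst hy'
        ext
        · simp
          linear_combination -(p.1 + σ * (t - m)) * he
        · simp
          linear_combination -(p.2 + τ * m) * he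
    rintro ⟨x, y⟩ ⟨hx, hy, hxy⟩
    simp only at hx hy hxy
    have e1 := ends 1 (Or.inl rfl) _ hy
    have e2 := ends (-1) (Or.inr rfl) _ hy
    rw [neg_one_mul, ← sub_eq_add_neg, add_sub_cancel] at e2
    rw [one_mul, add_sub_cancel] at e1
    have e3 := mem_of_hseg hH (x := x - p.1) e2 e1 (le_min hx (by linarith))
    simpa using e3
  · refine convexHull_min ?_ (convex_oct p r t)
    intro v hv
    obtain ⟨a, b, h, rfl⟩ := (memV v).1 hv
    have hr : 0 ≤ r := by linarith
    have ht : 0 ≤ t - r := by linarith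
    simp only [oct, mem_ofPred_eq, add_sub_cancel_left]
    have er : ∀ x, (x = r ∨ x = -r) → |x| = r := by
      rintro x (rfl | rfl) <;> simp [abs_of_nonneg hr]
    have et : ∀ x, (x = t - r ∨ x = r - t) → |x| = t - r := by
      rintro x (rfl | rfl)
      · exact abs_of_nonneg ht
      · rw [abs_sub_comm]; exact abs_of_nonneg ht
    rcases h with ⟨ha, hb⟩ | ⟨ha, hb⟩
    · rw [er a ha, et b hb]; refine ⟨?_, ?_, ?_⟩ <;> linarith
    · rw [et a ha, er b hb]; refine ⟨?_, ?_, ?_⟩ <;> linarith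

/-- A segment leaving an octagon crosses its boundary. -/
theorem exists_boundary_oct {p q : ℝ × ℝ} {r t : ℝ} (hr : 0 < r) (ht : 0 < t)
    (hq : q ∉ oct p r t) : ∃ z ∈ openSegment ℝ p q, z ∈ oct p r t ∧ z ∉ octInt p r t := by
  set N : ℝ := max (max (|q.1 - p.1| / r) (|q.2 - p.2| / r)) ((|q.1 - p.1| + |q.2 - p.2|) / t)
    with hN
  have hoct : ∀ c : ℝ, 0 ≤ c → (p + c • (q - p) ∈ oct p r t ↔ c * N ≤ 1) ∧
      (p + c • (q - p) ∈ octInt p r t ↔ c * N < 1) := by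
    intro c hc
    have e1 : (p + c • (q - p)).1 - p.1 = c * (q.1 - p.1) := by simp
    have e2 : (p + c • (q - p)).2 - p.2 = c * (q.2 - p.2) := by simp
    simp only [oct, octInt, mem_ofPred_eq, e1, e2, abs_mul, abs_of_nonneg hc]
    rw [hN, mul_max_of_nonneg _ _ hc, mul_max_of_nonneg _ _ hc, max_le_iff, max_le_iff, max_lt_iff,
      max_lt_iff, ← mul_add, ← mul_div_assoc, ← mul_div_assoc, ← mul_div_assoc, div_le_one hr,
      div_le_one hr, div_le_one ht, div_lt_one hr, div_lt_one hr, div_lt_one ht, and_assoc,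
      and_assoc]
    exact ⟨Iff.rfl, Iff.rfl⟩
  have hN1 : 1 < N := by
    by_contra hcon
    refine hq ?_
    have := (hoct 1 zero_le_one).1.2 (by linarith)
    simpa using this
  have hc : 0 < 1 / N := by positivity
  refine ⟨p + (1 / N) • (q - p), ?_, (hoct _ hc.le).1.2 ?_, fun h => ?_⟩
  · refine ⟨1 - 1 / N, 1 / N, ?_, hc, by ring, ?_⟩
    · rw [sub_pos, div_lt_one (by linarith)]; exact hN1
    · rw [smul_sub, sub_smul, one_smul]; abel
  · rw [one_div_mul_cancel (by linarith)]
  · have := (hoct _ hc.le).2.1 h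
    rw [one_div_mul_cancel (by linarith)] at this
    exact lt_irrefl _ this

section

variable {s : ℝ}

/-- The closed cell of a good point. -/
def cell (s : ℝ) (p : ℝ × ℝ) : Set (ℝ × ℝ) := {z | ClCell s p z}

theorem GoodH.cell_eq_oct {p : ℝ × ℝ} (hs : 0 < s) (h : GoodH s p) :
    ∃ r t : ℝ, 0 < r ∧ r ≤ t ∧ t ≤ 2 * r ∧ cell s p = oct p r t ∧
      ∀ z, InCell s p z ↔ z ∈ octInt p r t := by
  obtain ⟨r, t, hr, ht, h1, h2⟩ := h.cell_shape hs
  have e : ∀ z : ℝ × ℝ, p + (z - p) = z := fun z => by abel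
  have m1 := min_le_left r t
  have m2 := min_le_right r t
  have m3 := min_le_left t (2 * min r t)
  have m4 := min_le_right t (2 * min r t)
  have m5 : 0 < min r t := lt_min hr ht
  refine ⟨min r t, min t (2 * min r t), m5, le_min m2 (by linarith), m4, ?_, fun z => ?_⟩
  · ext z
    have := h2 (z - p)
    rw [e] at this
    rw [cell, mem_ofPred_eq, this]
    simp only [oct, mem_ofPred_eq, Prod.fst_sub, Prod.snd_sub, le_min_iff]
    have a1 := abs_nonneg (z.1 - p.1)
    have a2 := abs_nonneg (z.2 - p.2)
    constructor
    · rintro ⟨b1, b2, b3⟩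
      have c1 : |z.1 - p.1| ≤ min r t := le_min b1 (by linarith)
      have c2 : |z.2 - p.2| ≤ min r t := le_min b2 (by linarith)
      exact ⟨⟨b1, by linarith⟩, ⟨b2, by linarith⟩, b3, by linarith⟩
    · rintro ⟨b1, b2, b3, -⟩; exact ⟨b1.1, b2.1, b3⟩
  · have := h1 (z - p)
    rw [e] at this
    rw [this]
    simp only [octInt, mem_ofPred_eq, Prod.fst_sub, Prod.snd_sub, lt_min_iff]
    have a1 := abs_nonneg (z.1 - p.1)
    have a2 := abs_nonneg (z.2 - p.2)
    constructor
    · rintro ⟨b1, b2, b3⟩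
      have c1 : |z.1 - p.1| < min r t := lt_min b1 (by linarith)
      have c2 : |z.2 - p.2| < min r t := lt_min b2 (by linarith)
      exact ⟨⟨b1, by linarith⟩, ⟨b2, by linarith⟩, b3, by linarith⟩
    · rintro ⟨b1, b2, b3, -⟩; exact ⟨b1.1, b2.1, b3⟩

theorem GoodH.inCell_self {p : ℝ × ℝ} (hs : 0 < s) (h : GoodH s p) : InCell s p p :=
  fun _ _ hl => run_eq_hacts hl ▸ h.reach_hIn hs hl

theorem hIn_of_mem_interior {z : ℝ × ℝ} {Q : Set (ℝ × ℝ)} (hs : 0 < s) (hQ : Q ⊆ F1 s)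
    (hz : z ∈ interior Q) : HIn s z := by
  obtain ⟨ε, hε, hb⟩ := Metric.isOpen_iff.1 isOpen_interior z hz
  have key : ∀ a b : ℝ, |a| ≤ ε / 2 → |b| ≤ ε / 2 → HCl s (z + (a, b)) := by
    intro a b ha hb'
    refine (mem_F1_iff hs).1 (hQ (interior_subset (hb ?_)))
    rw [Metric.mem_ball, dist_eq_norm, add_sub_cancel_left, Prod.norm_def]
    simp only [Real.norm_eq_abs]
    exact max_lt (by linarith) (by linarith)
  have k1 := key (ε / 2) 0 (by rw [abs_of_pos (half_pos hε)]) (by simp; linarith)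
  have k2 := key (-(ε / 2)) 0 (by rw [abs_neg, abs_of_pos (half_pos hε)]) (by simp; linarith)
  have k3 := key 0 (ε / 2) (by simp; linarith) (by rw [abs_of_pos (half_pos hε)])
  have k4 := key 0 (-(ε / 2)) (by simp; linarith) (by rw [abs_neg, abs_of_pos (half_pos hε)])
  simp only [HCl, Prod.fst_add, Prod.snd_add, add_zero] at k1 k2 k3 k4
  refine ⟨?_, ?_, ?_, ?_⟩ <;> linarith

/-- The cells of good points away from the central tile are periodic tiles. -/
theorem GoodH.isPeriodicTile {p : ℝ × ℝ} (hs : 0 < s) (h : GoodH s p)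
    (hc : ∀ z ∈ cell s p, ¬Ctr s z) : IsPeriodicTile s (cell s p) := by
  obtain ⟨r, t, hr, hrt, htr, he, hi⟩ := h.cell_eq_oct hs
  have hinterior : interior (cell s p) = {z | InCell s p z} := by
    rw [he, interior_oct]; ext z; exact (hi z).symm
  have hp : p ∈ interior (cell s p) := by rw [hinterior]; exact h.inCell_self hs
  refine ⟨⟨⟨octVerts p r t, he ▸ oct_eq_convexHull p hrt htr⟩, p, hp⟩,
    fun z hz => (mem_F1_iff hs).2 (hz [] p rfl), ?_, ?_⟩
  · rw [hinterior]; exact h.iterRel hs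
  · rintro Q ⟨⟨V, hV⟩, -⟩ hQ ⟨n, hn, hper⟩ hPQ
    refine Subset.antisymm hPQ fun q hq => ?_
    by_contra hqP
    rw [he] at hqP
    obtain ⟨z, hz1, hz2, hz3⟩ := exists_boundary_oct hr (hr.trans_le hrt) hqP
    have hQc : Convex ℝ Q := hV ▸ convex_convexHull ℝ _
    have hzQ : z ∈ interior Q :=
      hQc.openSegment_interior_self_subset_interior (interior_mono hPQ hp) hq hz1
    rw [← he] at hz2
    exact not_iterRel_of_boundary hs hz2 (fun h => hz3 ((hi z).1 h))
      (hIn_of_mem_interior hs hQ hzQ) (hc z hz2) hn (hper z hzQ)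

end

section

variable {s : ℝ}

theorem GoodH.hIn {p : ℝ × ℝ} (hs : 0 < s) (h : GoodH s p) : HIn s p :=
  h.reach_hIn hs (l := []) rfl

theorem HCl.mem_closedBall {z : ℝ × ℝ} (hs : s < 1) (h : HCl s z) :
    z ∈ Metric.closedBall (0 : ℝ × ℝ) 2 := by
  obtain ⟨h1, h2⟩ := hCl_iff.1 h
  rw [abs_le] at h1 h2
  rw [mem_closedBall_zero_iff, Prod.norm_def, max_le_iff, Real.norm_eq_abs, Real.norm_eq_abs,
    abs_le, abs_le]
  refine ⟨⟨?_, ?_⟩, ?_, ?_⟩ <;> linarith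

theorem isClosed_hCl : IsClosed {z | HCl s z} := by
  have : {z : ℝ × ℝ | HCl s z} = {z | |z.2| ≤ s} ∩ {z | |z.1 - z.2| ≤ 1} := by
    ext z; exact hCl_iff
  rw [this]
  exact (isClosed_le (by fun_prop) (by fun_prop)).inter (isClosed_le (by fun_prop) (by fun_prop))

theorem isClosed_ctr : IsClosed {z | Ctr s z} := by
  have : Continuous turn := by unfold turn; fun_prop
  exact isClosed_hCl.inter (isClosed_hCl.preimage this)

theorem GoodH.large_or_small {p : ℝ × ℝ} (hs : 0 < s) (h : GoodH s p) (δ : ℝ) :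
    (∀ z, dist z p < δ → InCell s p z) ∨ ∀ z ∈ cell s p, dist z p ≤ 2 * δ := by
  obtain ⟨r, t, hr, hrt, -, hc, hi⟩ := h.cell_eq_oct hs
  rcases le_or_gt (2 * δ) r with hd | hd
  · left
    intro z hz
    rw [Prod.dist_eq, max_lt_iff, Real.dist_eq, Real.dist_eq] at hz
    rw [hi]
    have := abs_nonneg (z.1 - p.1)
    refine ⟨by linarith, by linarith, by linarith⟩
  · right
    intro z hz
    rw [hc] at hz
    rw [Prod.dist_eq, max_le_iff, Real.dist_eq, Real.dist_eq]
    exact ⟨hz.1.trans hd.le, hz.2.1.trans hd.le⟩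

theorem finite_large (hs : 0 < s) (hs1 : s < 1) {δ : ℝ} (hδ : 0 < δ) :
    {p | GoodH s p ∧ ∀ z, dist z p < δ → InCell s p z}.Finite := by
  by_contra hinf
  obtain ⟨x, -, hx⟩ := Set.Infinite.exists_accPt_of_subset_isCompact hinf
    (isCompact_closedBall (0 : ℝ × ℝ) 2) fun p hp => (hp.1.hIn hs).cl.mem_closedBall hs1
  obtain ⟨p, hp, q, hq, hpq⟩ :=
    (Set.Infinite.of_accPt (hx.nhds_inter (Metric.ball_mem_nhds x (half_pos hδ)))).nontrivial
  refine hpq (cell_disjoint hs hp.2.1 hq.2.1 (hp.2.2 q ?_) (hq.2.1.inCell_self hs))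
  have h1 := Metric.mem_ball.1 hp.1
  have h2 := Metric.mem_ball.1 hq.1
  have := dist_triangle_right q p x
  linarith

/-- The set of good points accumulates exactly where infinitely many cells come close. -/
theorem finite_cells_of_not_acc (hs : 0 < s) (hs1 : s < 1) {z : ℝ × ℝ}
    (hz : z ∉ derivedSet {p | GoodH s p}) :
    ∃ δ > 0, {p | GoodH s p ∧ (cell s p ∩ Metric.ball z δ).Nonempty}.Finite := by
  rw [mem_derivedSet, accPt_iff_nhds] at hz
  push Not at hz
  obtain ⟨U, hU, hz⟩ := hz
  obtain ⟨ε, hε, hU⟩ := Metric.mem_nhds_iff.1 hU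
  refine ⟨ε / 3, by positivity,
    ((finite_large hs hs1 (δ := ε / 3) (by positivity)).union (finite_singleton z)).subset ?_⟩
  rintro p ⟨hp, y, hy, hyz⟩
  rcases hp.large_or_small hs (ε / 3) with h | h
  · exact Or.inl ⟨hp, h⟩
  · refine Or.inr (hz p ⟨hU ?_, hp⟩)
    have h1 := h y hy
    have h2 := Metric.mem_ball.1 hyz
    have := dist_triangle_left p z y
    rw [Metric.mem_ball]
    linarith

theorem mem_limitSet_of_acc (hs : 0 < s) (hs1 : s < 1) {z : ℝ × ℝ}
    (hz : z ∈ derivedSet {p | GoodH s p}) (hc : ¬Ctr s z) : z ∈ limitSet s := by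
  have hcl : HCl s z := by
    have h := (mem_derivedSet.1 hz).clusterPt
    rw [← mem_closure_iff_clusterPt] at h
    exact closure_minimal (fun p hp => (GoodH.hIn hs hp).cl) isClosed_hCl h
  refine ⟨(mem_F1_iff hs).2 hcl, fun U hU => ?_⟩
  obtain ⟨ε, hε, hO⟩ := Metric.isOpen_iff.1 (isClosed_ctr (s := s)).isOpen_compl z hc
  have hN : U ∩ Metric.ball z (ε / 3) ∈ 𝓝 z :=
    inter_mem hU (Metric.ball_mem_nhds z (by positivity))
  have hinf := (Set.Infinite.of_accPt ((mem_derivedSet.1 hz).nhds_inter hN)).sdiff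
    (finite_large hs hs1 (δ := ε / 3) (by positivity))
  refine (hinf.image (f := cell s) ?_).mono ?_
  · rintro p ⟨⟨-, hp⟩, -⟩ q ⟨⟨-, hq⟩, -⟩ hpq
    obtain ⟨r, t, -, -, -, h1, h2⟩ := GoodH.cell_eq_oct hs hp
    obtain ⟨r', t', -, -, -, h1', h2'⟩ := GoodH.cell_eq_oct hs hq
    have e : octInt p r t = octInt q r' t' := by
      rw [← interior_oct, ← interior_oct, ← h1, ← h1', hpq]
    refine cell_disjoint hs hp hq (GoodH.inCell_self hs hp) ?_
    rw [h2', ← e, ← h2]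
    exact GoodH.inCell_self hs hp
  · rintro _ ⟨p, ⟨⟨⟨hpU, hpz⟩, hp⟩, hpl⟩, rfl⟩
    have hself : p ∈ cell s p := fun l p' h => (GoodH.inCell_self hs hp l p' h).cl
    refine ⟨GoodH.isPeriodicTile hs hp fun y hy => hO ?_, p, hpU, hself⟩
    rcases GoodH.large_or_small hs hp (ε / 3) with h | h
    · exact absurd ⟨hp, h⟩ hpl
    · have h1 := h y hy
      have h2 := Metric.mem_ball.1 hpz
      have := dist_triangle y p z
      rw [Metric.mem_ball]
      linarith

end

/-- `f'` followed by a quarter turn of either sign. -/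
def SStep (s : ℝ) (c : Bool × ℤ × ℤ) (z z' : ℝ × ℝ) : Prop :=
  HIn s z ∧ HIn s z' ∧ z' = if c.1 then hact s c.2 z else -hact s c.2 z

section

variable {s : ℝ}

/-- Signed runs are runs up to sign, and the code does not depend on the starting point. -/
theorem exists_run_of_signed (l : List (Bool × ℤ × ℤ)) : ∃ l' : List (ℤ × ℤ),
    l'.length = l.length ∧
      ((∀ z z', Run (SStep s) l z z' → Run (HStep s) l' z z') ∨
        ∀ z z', Run (SStep s) l z z' → Run (HStep s) l' z (-z')) := by
  induction l with
  | nil => exact ⟨[], rfl, Or.inl fun z z' h => h⟩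
  | cons c l ih =>
    obtain ⟨l', h1, h2⟩ := ih
    obtain ⟨σ, c⟩ := c
    cases σ
    · refine ⟨c :: l'.map Neg.neg, by simp [h1], ?_⟩
      rcases h2 with h2 | h2
      · right
        rintro z z' ⟨m, ⟨i1, i2, rfl⟩, hm⟩
        refine ⟨_, ⟨i1, ?_, rfl⟩, ?_⟩
        · simpa using i2.neg
        · simpa using run_neg (h2 _ _ hm)
      · left
        rintro z z' ⟨m, ⟨i1, i2, rfl⟩, hm⟩
        refine ⟨_, ⟨i1, ?_, rfl⟩, ?_⟩
        · simpa using i2.neg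
        · simpa using run_neg (h2 _ _ hm)
    · refine ⟨c :: l', by simp [h1], ?_⟩
      rcases h2 with h2 | h2
      · left
        rintro z z' ⟨m, ⟨i1, i2, rfl⟩, hm⟩
        exact ⟨_, ⟨i1, i2, rfl⟩, h2 _ _ hm⟩
      · right
        rintro z z' ⟨m, ⟨i1, i2, rfl⟩, hm⟩
        exact ⟨_, ⟨i1, i2, rfl⟩, h2 _ _ hm⟩

theorem goodH_of_signed {p : ℝ × ℝ} (h : Good (SStep s) p) : GoodH s p := by
  obtain ⟨l, hl, h⟩ := h
  obtain ⟨l', h1, h2⟩ := exists_run_of_signed (s := s) l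
  refine ⟨l', h1 ▸ hl, ?_⟩
  rcases h2 with h2 | h2
  · exact Or.inl (h2 _ _ h)
  · exact Or.inr (h2 _ _ h)

theorem hIn_of_run {l : List (ℤ × ℤ)} {z z' : ℝ × ℝ} (hz : HIn s z)
    (h : Run (HStep s) l z z') : HIn s z' := by
  induction l generalizing z with
  | nil => exact h ▸ hz
  | cons c l ih =>
    obtain ⟨m, hm, h⟩ := h
    exact ih hm.2.1 h

theorem inCell_of_signed (hs : 0 < s) {z p : ℝ × ℝ} (h : PairLoop (SStep s) z p) :
    InCell s p z := by
  obtain ⟨l, hl, hz, hp⟩ := h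
  obtain ⟨L, hL, hLz, hLp⟩ : ∃ L : List (ℤ × ℤ), L ≠ [] ∧ Run (HStep s) L z z ∧
      Run (HStep s) L p p := by
    obtain ⟨l', h1, h2⟩ := exists_run_of_signed (s := s) l
    have hl' : l' ≠ [] := by
      rw [← List.length_pos_iff_ne_nil] at hl ⊢
      omega
    rcases h2 with h2 | h2
    · exact ⟨l', hl', h2 _ _ hz, h2 _ _ hp⟩
    · refine ⟨l' ++ l'.map Neg.neg, by simp [hl'], ?_, ?_⟩
      · exact run_append.2 ⟨_, h2 _ _ hz, by simpa using run_neg (h2 _ _ hz)⟩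
      · exact run_append.2 ⟨_, h2 _ _ hp, by simpa using run_neg (h2 _ _ hp)⟩
  intro k p' hk
  have hlen : k.length ≤ (rep k.length L).length := by
    rw [length_rep]
    exact Nat.le_mul_of_pos_right _ (List.length_pos_iff_ne_nil.2 hL)
  obtain ⟨l₂, h2, -⟩ := run_prefix (hstep_det hs) hk (run_rep hLp k.length) hlen
  have hr := run_rep hLz k.length
  rw [h2, run_append] at hr
  obtain ⟨m, hm, -⟩ := hr
  rw [← run_eq_hacts hm]
  refine hIn_of_run ?_ hm
  cases L with
  | nil => exact absurd rfl hL
  | cons c L => obtain ⟨m, hm, -⟩ := hLz; exact hm.1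

end

/-- A weakly contracting injective affine map of the plane. -/
structure AffEmb (φ : ℝ × ℝ → ℝ × ℝ) : Prop where
  dist_le : ∀ q q', dist (φ q) (φ q') ≤ dist q q'
  aff : ∀ p q (t : ℝ), φ (p + t • (q - p)) = φ p + t • (φ q - φ p)
  inj : Function.Injective φ

theorem AffEmb.comp {φ χ : ℝ × ℝ → ℝ × ℝ} (h : AffEmb φ) (h' : AffEmb χ) :
    AffEmb (φ ∘ χ) where
  dist_le q q' := (h.dist_le _ _).trans (h'.dist_le _ _)
  aff p q t := by simp only [Function.comp_apply, h'.aff, h.aff]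
  inj := h.inj.comp h'.inj

theorem AffEmb.id : AffEmb id := ⟨fun _ _ => le_rfl, fun _ _ _ => rfl, fun _ _ h => h⟩

theorem affEmb_psi (γ ω : ℝ) (n : ℕ) : AffEmb (psi γ ω n) where
  dist_le := dist_psi
  aff p q t := by ext <;> simp [psi] <;> ring
  inj p q h := by
    have h1 := congrArg Prod.fst h
    have h2 := congrArg Prod.snd h
    simp only [psi] at h1 h2
    ext <;> linarith

/-- The module of special values. -/
def modL (s : ℝ) : Submodule ℚ ℝ := Submodule.span ℚ {1, s}

/-- The acute vertex of `F₁`. -/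
def apex (s : ℝ) : ℝ × ℝ := (-1 - s, -s)

/-- An embedding of a renormalized system into `F₁` at the acute vertex. -/
structure TopEmb (s a w : ℝ) (φ : ℝ × ℝ → ℝ × ℝ) : Prop where
  pos : 0 < w
  lt : w < 2 * a
  ind : Ind a w
  emb : AffEmb φ
  apex : φ (0, 2 * a) = apex s
  good : ∀ q, Good (StepC a w) q → GoodH s (φ q)
  cell : ∀ q p, PairLoop (StepC a w) q p → InCell s (φ p) (φ q)
  surj : ∃ η > 0, ∀ z, HIn s z → dist z (OctPET.apex s) < η → ∃ q, InT a w q ∧ φ q = z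
  a_mem : a ∈ modL s
  w_mem : w ∈ modL s
  gen : ∀ q, Gen (modL s) (φ q) → Gen (modL s) q

section

variable {s : ℝ}

theorem one_mem_modL : (1 : ℝ) ∈ modL s := Submodule.subset_span (by simp)

theorem self_mem_modL : s ∈ modL s := Submodule.subset_span (by simp)

theorem irr_ind (hirr : Irrational s) (p q : ℚ) (h : (p : ℝ) + q * s = 0) : q = 0 := by
  by_contra hq
  apply hirr.ne_rat (-p / q)
  have : (q : ℝ) ≠ 0 := by exact_mod_cast hq
  push_cast
  field_simp
  linarith

/-- The embedding for `s < 1/2`. -/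
def topSmall (q : ℝ × ℝ) : ℝ × ℝ := ((q.1 - q.2) / 2 - 1, -((q.1 + q.2) / 2))

/-- The embedding for `1/2 < s`. -/
def topBig (s : ℝ) (q : ℝ × ℝ) : ℝ × ℝ :=
  (-2 * s + (q.1 - q.2) / 4, 1 - 2 * s - (q.1 + q.2) / 4)

theorem sStep_topSmall {w : ℝ} {n : ℕ} (hl : Lev (1 / 2) s w n) (c : Bool × Bool) (q q' : ℝ × ℝ)
    (h : Rev (StepC s w) c q q') :
    Run (SStep s) [(c.1, if c.1 then 0 else 1,
      (if c.1 then (-1 : ℤ) else 1) * (n + 1 + if c.2 then 1 else 0))] (topSmall q)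
        (topSmall q') := by
  obtain ⟨h1, h2, rfl⟩ := h
  have h3 := hl.eq
  have h4 := hl.om_lt
  have h0 := hl.om_pos
  have hk : 0 ≤ s * n := mul_nonneg hl.pos.le (by positivity)
  obtain ⟨u, v⟩ := q'
  obtain ⟨σ, b⟩ := c
  rw [run_singleton]
  refine ⟨?_, ?_, ?_⟩
  · simp only [InT, act, kap, HIn, topSmall] at *
    cases b <;> cases σ <;> simp at * <;> refine ⟨?_, ?_, ?_, ?_⟩ <;> linarith
  · simp only [InT, act, kap, HIn, topSmall] at *
    cases b <;> cases σ <;> simp at * <;> refine ⟨?_, ?_, ?_, ?_⟩ <;> linarith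
  · simp only [act, kap, topSmall, hact]
    cases b <;> cases σ <;> ext <;> simp <;> linarith

theorem run_diag {γ : ℝ} (hγ : 0 < γ) (hγs : γ = 2 - 2 * s) (k : ℕ) (x y : ℝ)
    (h : HIn s (x, y))
    (h1 : x + γ * k < -s) (h2 : y + γ * k < s) (h3 : x + y + 2 * (γ * k) < -1 + 2 * γ) :
    Run (SStep s) (rep k [(true, 1, 0), (false, 1, 1)]) (x, y) (x + γ * k, y + γ * k) := by
  induction k generalizing x y with
  | zero => simp [rep, Run]
  | succ k ih =>
    rw [rep_succ]
    push_cast at *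
    have hk : 0 ≤ γ * k := by positivity
    obtain ⟨i1, i2, i3, i4⟩ := id h
    simp only at i1 i2 i3 i4
    have hm : HIn s (x + γ, y + γ) := by
      refine ⟨?_, ?_, ?_, ?_⟩ <;> simp <;> linarith
    have h' := ih (x + γ) (y + γ) hm (by linarith) (by linarith) (by linarith)
    have h2 : HIn s (y, -x - 2) := by
      refine ⟨?_, ?_, ?_, ?_⟩ <;> simp <;> linarith
    refine ⟨(y, -x - 2), ⟨h, h2, ?_⟩, (x + γ, y + γ), ⟨h2, hm, ?_⟩, ?_⟩
    · ext <;> simp [hact]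
    · ext <;> simp [hact] <;> linarith
    · change Run _ (rep k _) _ _
      convert h' using 1
      ext <;> simp <;> ring

theorem sStep_topBig {γ ω : ℝ} {n : ℕ} (hγs : γ = 2 - 2 * s) (hl : Lev 1 γ ω n)
    (c : Bool × Bool) (q q' : ℝ × ℝ) (h : StepC γ ω c q q') :
    Run (SStep s) (rep (n + if c.2 then 1 else 0) [(true, 1, 0), (false, 1, 1)] ++
      [if c.1 then (false, 1, 1) else (true, 0, -1)]) (topBig s q) (topBig s q') := by
  obtain ⟨h1, h2, rfl⟩ := h
  have h3 := hl.eq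
  have h4 := hl.om_lt
  have h0 := hl.om_pos
  have hγ := hl.pos
  have hγ1 := hl.lt
  have hk : 0 ≤ γ * n := mul_nonneg hl.pos.le (by positivity)
  obtain ⟨u, v⟩ := q
  obtain ⟨σ, b⟩ := c
  have j1 : HIn s (topBig s (u, v)) := by
    simp only [InT, act, kap, HIn, topBig] at *
    refine ⟨?_, ?_, ?_, ?_⟩ <;> linarith
  have j2 : HIn s (topBig s (act γ ω (σ, b) (u, v))) := by
    simp only [InT, act, kap, HIn, topBig] at *
    refine ⟨?_, ?_, ?_, ?_⟩ <;> linarith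
  rw [run_append]
  have := run_diag hγ hγs (n + if b then 1 else 0) (topBig s (u, v)).1
    (topBig s (u, v)).2 j1 ?_ ?_ ?_
  · refine ⟨_, this, ?_⟩
    rw [run_singleton]
    refine ⟨?_, j2, ?_⟩
    · simp only [InT, act, kap, HIn, topBig] at *
      cases b <;> cases σ <;> simp at * <;> refine ⟨?_, ?_, ?_, ?_⟩ <;> linarith
    · simp only [act, kap, topBig, hact]
      cases b <;> cases σ <;> ext <;> simp <;> linarith
  all_goals
    simp only [InT, act, kap, HIn, topBig] at *
    cases b <;> cases σ <;> simp at * <;> linarith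

end

section

variable {s : ℝ}

theorem modL_lin {x y : ℝ} (h : x ∈ modL s) (r p q : ℚ) (hy : y = r * x + p + q * s) :
    y ∈ modL s := by
  have h1 := (modL s).smul_mem r h
  have h2 := (modL s).smul_mem p one_mem_modL
  have h3 := (modL s).smul_mem q self_mem_modL
  rw [Rat.smul_def] at h1 h2 h3
  rw [hy]
  simpa using (modL s).add_mem ((modL s).add_mem h1 h2) h3

theorem exists_topEmb_small (h0 : 0 < s) (h1 : s < 1 / 2) (hirr : Irrational s) :
    ∃ a w φ, TopEmb s a w φ := by
  have hi : Ind (1 / 2) s := fun p q h => irr_ind hirr (p / 2) q (by push_cast; linarith)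
  obtain ⟨w, n, hl, hi'⟩ := exists_lev h0 h1 hi
  have hw := hl.om_pos
  have hrun := sStep_topSmall hl
  have hodd : ∀ c : Bool × Bool, Odd [((c.1, if c.1 then 0 else 1,
      (if c.1 then (-1 : ℤ) else 1) * (n + 1 + if c.2 then 1 else 0)) : Bool × ℤ × ℤ)].length :=
    fun c => by simp
  refine ⟨s, w, topSmall, hw, hl.om_lt, hi', ⟨fun p q => ?_, fun p q t => ?_, fun p q h => ?_⟩,
    ?_, fun q h => goodH_of_signed (good_lift hodd hrun (good_rev h)),
    fun q p h => inCell_of_signed h0 (pairLoop_lift hodd hrun (pairLoop_rev h)),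
    ⟨s, h0, fun z hz hd => ⟨(z.1 + 1 - z.2, -z.2 - z.1 - 1), ?_, ?_⟩⟩, self_mem_modL, ?_, ?_⟩
  · have h1 := abs_le.1 ((Real.dist_eq _ _).symm.le.trans
      (le_max_left (dist p.1 q.1) (dist p.2 q.2)))
    have h2 := abs_le.1 ((Real.dist_eq _ _).symm.le.trans
      (le_max_right (dist p.1 q.1) (dist p.2 q.2)))
    rw [Prod.dist_eq, Prod.dist_eq]
    refine max_le ?_ ?_ <;> rw [Real.dist_eq, abs_le] <;> constructor <;>
      simp only [topSmall] <;> linarith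
  · ext <;> simp [topSmall] <;> ring
  · have h1 := congrArg Prod.fst h
    have h2 := congrArg Prod.snd h
    simp only [topSmall] at h1 h2
    ext <;> linarith
  · ext <;> simp [topSmall, apex]; ring
  · rw [Prod.dist_eq, max_lt_iff, Real.dist_eq, Real.dist_eq, abs_lt, abs_lt] at hd
    obtain ⟨i1, i2, i3, i4⟩ := hz
    simp only [apex] at hd
    refine ⟨?_, ?_, ?_, ?_⟩ <;> simp only <;> linarith
  · ext <;> simp [topSmall] <;> ring
  · refine modL_lin (s := s) one_mem_modL 0 1 (-2 * (n + 1)) ?_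
    have := hl.eq
    push_cast
    linarith
  · rintro ⟨u, v⟩ ⟨g1, g2, g3, g4⟩
    simp only [topSmall] at g1 g2 g3 g4
    refine ⟨fun h => g4 (modL_lin h 1 (-1) 0 ?_), fun h => g3 (modL_lin h (-1) (-1) 0 ?_),
      fun h => g2 (modL_lin h (-1 / 2) 0 0 ?_), fun h => g1 (modL_lin h (1 / 2) (-1) 0 ?_)⟩ <;>
    push_cast <;> ring

theorem exists_topEmb_big (h0 : 1 / 2 < s) (h1 : s < 1) (hirr : Irrational s) :
    ∃ a w φ, TopEmb s a w φ := by
  have hi : Ind 1 (2 - 2 * s) := fun p q h => by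
    have := irr_ind hirr (p + 2 * q) (-2 * q) (by push_cast; linarith)
    linarith
  obtain ⟨γ, hγ⟩ : ∃ γ, γ = 2 - 2 * s := ⟨_, rfl⟩
  rw [← hγ] at hi
  obtain ⟨w, n, hl, hi'⟩ := exists_lev (show 0 < γ by linarith) (by linarith) hi
  have hw := hl.om_pos
  have hrun := sStep_topBig hγ hl
  have hodd : ∀ c : Bool × Bool, Odd (rep (n + if c.2 then 1 else 0) [((true, 1, 0) : Bool × ℤ × ℤ),
      (false, 1, 1)] ++ [if c.1 then (false, 1, 1) else (true, 0, -1)]).length := by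
    intro c
    rw [List.length_append, length_rep]
    simp [parity_simps]
  refine ⟨γ, w, topBig s, hw, hl.om_lt, hi', ⟨fun p q => ?_, fun p q t => ?_, fun p q h => ?_⟩,
    ?_, fun q h => goodH_of_signed (good_lift hodd hrun h),
    fun q p h => inCell_of_signed (by linarith) (pairLoop_lift hodd hrun h),
    ⟨γ, hl.pos, fun z hz hd => ⟨(2 * (z.1 + 1 - z.2), 2 * (1 - 4 * s - z.2 - z.1)), ?_, ?_⟩⟩,
    modL_lin one_mem_modL 0 2 (-2) (by push_cast; linarith), ?_, ?_⟩
  · have h1 := abs_le.1 ((Real.dist_eq _ _).symm.le.trans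
      (le_max_left (dist p.1 q.1) (dist p.2 q.2)))
    have h2 := abs_le.1 ((Real.dist_eq _ _).symm.le.trans
      (le_max_right (dist p.1 q.1) (dist p.2 q.2)))
    rw [Prod.dist_eq, Prod.dist_eq]
    refine max_le ?_ ?_ <;> rw [Real.dist_eq, abs_le] <;> constructor <;>
      simp only [topBig] <;> linarith
  · ext <;> simp [topBig] <;> ring
  · have h1 := congrArg Prod.fst h
    have h2 := congrArg Prod.snd h
    simp only [topBig] at h1 h2
    ext <;> linarith
  · ext <;> simp [topBig, apex] <;> linarith
  · rw [Prod.dist_eq, max_lt_iff, Real.dist_eq, Real.dist_eq, abs_lt, abs_lt] at hd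
    obtain ⟨i1, i2, i3, i4⟩ := hz
    simp only [apex] at hd
    refine ⟨?_, ?_, ?_, ?_⟩ <;> simp only <;> linarith
  · ext <;> simp [topBig] <;> ring
  · refine modL_lin (s := s) one_mem_modL 0 (2 - 4 * (n + 1)) (4 * (n + 1)) ?_
    have := hl.eq
    rw [hγ] at this
    push_cast
    linarith
  · rintro ⟨u, v⟩ ⟨g1, g2, g3, g4⟩
    simp only [topBig] at g1 g2 g3 g4
    refine ⟨fun h => g4 (modL_lin h (1 / 2) (-1) 0 ?_),
      fun h => g3 (modL_lin h (-1 / 2) 1 (-4) ?_),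
      fun h => g2 (modL_lin h (-1 / 4) 1 (-2) ?_),
      fun h => g1 (modL_lin h (1 / 4) 0 (-2) ?_)⟩ <;>
    push_cast <;> ring

theorem exists_topEmb (h0 : 0 < s) (h1 : s < 1) (hirr : Irrational s) :
    ∃ a w φ, TopEmb s a w φ := by
  rcases lt_trichotomy s (1 / 2) with h | h | h
  · exact exists_topEmb_small h0 h hirr
  · exact absurd (by rw [h]; push_cast; norm_num) (hirr.ne_rat (1 / 2))
  · exact exists_topEmb_big h h1 hirr

/-- Generic points near the apex lie in cells or are close to good points. -/
theorem exists_near_apex (h0 : 0 < s) (h1 : s < 1) (hirr : Irrational s) :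
    ∃ η > 0, ∀ z, HIn s z → dist z (apex s) < η → Gen (modL s) z → ∀ ε > 0,
      ∃ p, GoodH s p ∧ (InCell s p z ∨ dist z p ≤ ε) := by
  obtain ⟨a, w, φ, h⟩ := exists_topEmb h0 h1 hirr
  obtain ⟨η, hη, hs⟩ := h.surj
  refine ⟨η, hη, fun z hz hd hg ε hε => ?_⟩
  obtain ⟨q, hq, rfl⟩ := hs z hz hd
  obtain ⟨p, hp, -, hpq⟩ := (allApprox hε h.pos h.lt h.ind h.a_mem h.w_mem q hq (h.gen q hg)).1
  refine ⟨φ p, h.good p hp, hpq.imp (h.cell q p) fun hd => (h.emb.dist_le _ _).trans hd⟩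

end

theorem exists_sign_sub (x a : ℝ) : ∃ σ : ℝ, (σ = 1 ∨ σ = -1) ∧
    ∀ ε, |x + σ * ε - a| = |(|x - a| - ε)| := by
  rcases le_total x a with h | h
  · refine ⟨1, Or.inl rfl, fun ε => ?_⟩
    rw [abs_of_nonpos (sub_nonpos.2 h), ← abs_neg]
    congr 1
    ring
  · refine ⟨-1, Or.inr rfl, fun ε => ?_⟩
    rw [abs_of_nonneg (sub_nonneg.2 h)]
    congr 1
    ring

theorem exists_small (l : List ℝ) (h : ∀ x ∈ l, 0 < x) : ∃ ε > 0, ∀ x ∈ l, ε < x := by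
  induction l with
  | nil => exact ⟨1, one_pos, by simp⟩
  | cons x l ih =>
    obtain ⟨ε, h0, h1⟩ := ih fun y hy => h y (List.mem_cons_of_mem _ hy)
    have hx := h x List.mem_cons_self
    refine ⟨min ε (x / 2), lt_min h0 (half_pos hx), ?_⟩
    intro y hy
    rcases List.mem_cons.1 hy with rfl | hy
    · exact (min_le_right _ _).trans_lt (half_lt_self hx)
    · exact (min_le_left _ _).trans_lt (h1 y hy)

/-- A flat and a slanted octagon meeting over a generic abscissa overlap. -/
theorem flat_slanted_overlap {p q : ℝ × ℝ} {r t r' t' x y : ℝ}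
    (hp : (x, y) ∈ oct p r t) (hq : (x, y) ∈ oct q r' t') (hr : 0 < r) (h1 : |x - p.1| ≠ r)
    (hflat : r + |x - p.1| < t) (hx : x ≠ q.1) (hsl : t' < r' + |x - q.1|) :
    ∃ z, z ∈ octInt p r t ∧ z ∈ octInt q r' t' := by
  obtain ⟨p1, p2, p3⟩ := hp
  obtain ⟨q1, q2, q3⟩ := hq
  simp only at p1 p2 p3 q1 q2 q3
  have hx' : 0 < |x - q.1| := abs_pos.2 (sub_ne_zero.2 hx)
  obtain ⟨σ, hσ, hσ'⟩ := exists_sign_sub x q.1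
  obtain ⟨τ, hτ, hτ'⟩ := exists_sign_sub y p.2
  obtain ⟨ε, hε, hε'⟩ := exists_small
    [r, r - |x - p.1|, t - r - |x - p.1|, |x - q.1|, r' + |x - q.1| - t'] (by
      intro e he
      simp only [List.mem_cons, List.not_mem_nil, or_false] at he
      rcases he with rfl | rfl | rfl | rfl | rfl
      · exact hr
      · exact sub_pos.2 (lt_of_le_of_ne p1 h1)
      · linarith
      · exact hx'
      · linarith)
  simp only [List.mem_cons, List.not_mem_nil, or_false, forall_eq_or_imp, forall_eq] at hε'
  obtain ⟨e1, e2, e3, e4, e5⟩ := hε'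
  have k1 : |x + σ * ε - p.1| ≤ |x - p.1| + ε := by
    have : x + σ * ε - p.1 = (x - p.1) + σ * ε := by ring
    rw [this]
    refine (abs_add_le _ _).trans ?_
    rcases hσ with rfl | rfl <;> simp [abs_of_pos hε]
  have k2 : |x + σ * ε - q.1| = |x - q.1| - ε := by
    rw [hσ', abs_of_pos (by linarith)]
  have k3 : |y + τ * (ε / 2) - p.2| < r := by
    rw [hτ', abs_lt]
    constructor <;> linarith [abs_nonneg (y - p.2)]
  have k4 : |y + τ * (ε / 2) - q.2| ≤ |y - q.2| + ε / 2 := by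
    have : y + τ * (ε / 2) - q.2 = (y - q.2) + τ * (ε / 2) := by ring
    rw [this]
    refine (abs_add_le _ _).trans ?_
    rcases hτ with rfl | rfl <;> simp [abs_of_pos (half_pos hε)]
  refine ⟨(x + σ * ε, y + τ * (ε / 2)), ⟨?_, ?_, ?_⟩, ?_, ?_, ?_⟩ <;> simp only <;> linarith

theorem not_slanted_of_top {p : ℝ × ℝ} {r t x c : ℝ} (h : (x, c) ∈ oct p r t) (hr : 0 < r)
    (hsub : ∀ z ∈ oct p r t, z.2 ≤ c) (hx : x ≠ p.1) : ¬t < r + |x - p.1| := by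
  intro hlt
  obtain ⟨p1, p2, p3⟩ := h
  simp only at p1 p2 p3
  have hx' : 0 < |x - p.1| := abs_pos.2 (sub_ne_zero.2 hx)
  have hpc : p.2 ≤ c := by
    refine hsub p ⟨?_, ?_, ?_⟩ <;> simp only [sub_self, abs_zero] <;>
      linarith [abs_nonneg (c - p.2)]
  rw [abs_of_nonneg (sub_nonneg.2 hpc)] at p2 p3
  obtain ⟨σ, hσ, hσ'⟩ := exists_sign_sub x p.1
  obtain ⟨ε, hε, hε'⟩ := exists_small [|x - p.1|, r + |x - p.1| - t] (by
    intro e he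
    simp only [List.mem_cons, List.not_mem_nil, or_false] at he
    rcases he with rfl | rfl
    · exact hx'
    · linarith)
  simp only [List.mem_cons, List.not_mem_nil, or_false, forall_eq_or_imp, forall_eq] at hε'
  obtain ⟨e1, e2⟩ := hε'
  have k : |x + σ * ε - p.1| = |x - p.1| - ε := by
    rw [hσ', abs_of_pos (by linarith)]
  have k' : |c + ε - p.2| = c + ε - p.2 := abs_of_nonneg (by linarith)
  have := hsub (x + σ * ε, c + ε) (by
    refine ⟨?_, ?_, ?_⟩ <;> simp only [k, k'] <;> linarith)
  simp only at this
  linarith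

theorem not_flat_of_bottom {p : ℝ × ℝ} {r t x c : ℝ} (h : (x, c - x) ∈ oct p r t)
    (hsub : ∀ z ∈ oct p r t, c ≤ z.1 + z.2) (hx : |x - p.1| ≠ r) : ¬r + |x - p.1| < t := by
  intro hlt
  obtain ⟨p1, p2, p3⟩ := h
  simp only at p1 p2 p3
  obtain ⟨ε, hε, hε'⟩ := exists_small [r - |x - p.1|, t - r - |x - p.1|] (by
    intro e he
    simp only [List.mem_cons, List.not_mem_nil, or_false] at he
    rcases he with rfl | rfl
    · exact sub_pos.2 (lt_of_le_of_ne p1 hx)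
    · linarith)
  simp only [List.mem_cons, List.not_mem_nil, or_false, forall_eq_or_imp, forall_eq] at hε'
  obtain ⟨e1, e2⟩ := hε'
  have k : |x - ε - p.1| ≤ |x - p.1| + ε := by
    have : x - ε - p.1 = (x - p.1) + -ε := by ring
    rw [this]
    refine (abs_add_le _ _).trans ?_
    rw [abs_neg, abs_of_pos hε]
  have := hsub (x - ε, c - x) (by
    refine ⟨?_, ?_, ?_⟩ <;> simp only <;> linarith)
  simp only at this
  linarith

/-- Finitely many octagons with disjoint interiors, confined to a wedge with one horizontal and
one diagonal side, cannot cover a generic vertical segment spanning the wedge: the one at the top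
crosses the segment between horizontal sides, the one at the bottom between diagonal sides, and
these two kinds never meet. -/
theorem not_cover_wedge {ι : Type*} {S : Set ι} (hS : S.Finite) (p : ι → ℝ × ℝ) (r t : ι → ℝ)
    {x c d : ℝ} (hr : ∀ i ∈ S, 0 < r i)
    (hsub : ∀ i ∈ S, ∀ z ∈ oct (p i) (r i) (t i), z.2 ≤ c ∧ d ≤ z.1 + z.2)
    (hdisj : ∀ i ∈ S, ∀ j ∈ S, ∀ z, z ∈ octInt (p i) (r i) (t i) →
      z ∈ octInt (p j) (r j) (t j) → i = j)
    (hcd : d - x < c) (h1 : ∀ i ∈ S, x ≠ (p i).1) (h2 : ∀ i ∈ S, |x - (p i).1| ≠ r i)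
    (h3 : ∀ i ∈ S, r i + |x - (p i).1| ≠ t i) :
    ¬∀ y ∈ Icc (d - x) c, ∃ i ∈ S, (x, y) ∈ oct (p i) (r i) (t i) := by
  intro hcov
  have hclosed : ∀ S' ⊆ S, IsClosed (⋃ i ∈ S', {y | (x, y) ∈ oct (p i) (r i) (t i)}) :=
    fun S' hS' => (hS.subset hS').isClosed_biUnion fun i _ =>
      (isClosed_oct _ _ _).preimage (by fun_prop)
  have hp := isPreconnected_closed_iff.1 (isPreconnected_Icc (a := d - x) (b := c)) _ _
    (hclosed {i ∈ S | r i + |x - (p i).1| < t i} (sep_subset _ _))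
    (hclosed {i ∈ S | t i < r i + |x - (p i).1|} (sep_subset _ _))
    (by
      intro y hy
      obtain ⟨i, hi, hiy⟩ := hcov y hy
      rcases lt_or_gt_of_ne (h3 i hi) with h | h
      · exact Or.inl (mem_biUnion (show i ∈ {i ∈ S | _} from ⟨hi, h⟩) hiy)
      · exact Or.inr (mem_biUnion (show i ∈ {i ∈ S | _} from ⟨hi, h⟩) hiy))
    (by
      obtain ⟨i, hi, hiy⟩ := hcov c (right_mem_Icc.2 hcd.le)
      refine ⟨c, right_mem_Icc.2 hcd.le, mem_biUnion (show i ∈ {i ∈ S | _} from ⟨hi, ?_⟩) hiy⟩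
      exact lt_of_le_of_ne (not_lt.1 (not_slanted_of_top hiy (hr i hi)
        (fun z hz => (hsub i hi z hz).1) (h1 i hi))) (h3 i hi))
    (by
      obtain ⟨i, hi, hiy⟩ := hcov (d - x) (left_mem_Icc.2 hcd.le)
      refine ⟨d - x, left_mem_Icc.2 hcd.le,
        mem_biUnion (show i ∈ {i ∈ S | _} from ⟨hi, ?_⟩) hiy⟩
      exact lt_of_le_of_ne (not_lt.1 (not_flat_of_bottom hiy
        (fun z hz => (hsub i hi z hz).2) (h2 i hi))) (h3 i hi).symm)
  obtain ⟨y, -, hy1, hy2⟩ := hp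
  obtain ⟨i, ⟨hi, hi'⟩, hiy⟩ := mem_iUnion₂.1 hy1
  obtain ⟨j, ⟨hj, hj'⟩, hjy⟩ := mem_iUnion₂.1 hy2
  obtain ⟨z, hz1, hz2⟩ := flat_slanted_overlap hiy hjy (hr i hi) (h2 i hi) hi' (h1 j hj) hj'
  obtain rfl := hdisj i hi j hj z hz1 hz2
  exact lt_asymm hi' hj'

section

variable {s : ℝ}

/-- The accumulation points of the set of good points. -/
def acc (s : ℝ) : Set (ℝ × ℝ) := derivedSet {p | GoodH s p}

theorem isClosed_acc : IsClosed (acc s) := isClosed_derivedSet _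

theorem finite_cells_of_isCompact (hs : 0 < s) (hs1 : s < 1) {K : Set (ℝ × ℝ)} (hK : IsCompact K)
    (hd : Disjoint K (acc s)) : {p | GoodH s p ∧ (cell s p ∩ K).Nonempty}.Finite := by
  choose! δ hδ hf using fun z (hz : z ∈ K) =>
    finite_cells_of_not_acc hs hs1 (disjoint_left.1 hd hz)
  obtain ⟨t, ht, hc⟩ := hK.elim_nhds_subcover (fun z => Metric.ball z (δ z))
    fun z hz => Metric.ball_mem_nhds z (hδ z hz)
  refine (t.finite_toSet.biUnion fun z hz => hf z (ht z hz)).subset ?_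
  rintro p ⟨hp, y, hy, hyK⟩
  obtain ⟨z, hz, hyz⟩ := mem_iUnion₂.1 (hc hyK)
  exact mem_biUnion (Finset.mem_coe.2 hz) ⟨hp, y, hy, hyz⟩

theorem InCell.mem_cell {p z : ℝ × ℝ} (h : InCell s p z) : z ∈ cell s p :=
  fun l p' hl => (h l p' hl).cl

/-- If a wedge at the apex is cut by generic parallel segments, they all meet `acc s`. -/
theorem exists_acc_of_wedge (hs : 0 < s) (hs1 : s < 1) {η : ℝ}
    (hη : ∀ z, HIn s z → dist z (apex s) < η → Gen (modL s) z → ∀ ε > 0,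
      ∃ p, GoodH s p ∧ (InCell s p z ∨ dist z p ≤ ε))
    {g P : ℝ × ℝ → ℝ × ℝ} {R T : ℝ × ℝ → ℝ} (hg : Continuous g)
    (hR : ∀ p, GoodH s p → 0 < R p)
    (hcell : ∀ p, GoodH s p → ∀ z, g z ∈ cell s p ↔ z ∈ oct (P p) (R p) (T p))
    (hinterior : ∀ p, GoodH s p → ∀ z, InCell s p (g z) ↔ z ∈ octInt (P p) (R p) (T p))
    {c d x₁ : ℝ} (hsub : ∀ z, HCl s (g z) → z.2 ≤ c ∧ d ≤ z.1 + z.2)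
    {B : Set ℝ} (hB : B.Countable)
    (hgen : ∀ x ∈ Ioo (d - c) x₁, x ∉ B → ∃ C : Set ℝ, C.Countable ∧ ∀ y ∈ Ioo (d - x) c, y ∉ C →
      HIn s (g (x, y)) ∧ dist (g (x, y)) (apex s) < η ∧ Gen (modL s) (g (x, y)))
    {x : ℝ} (hx : x ∈ Ioo (d - c) x₁) : ∃ y ∈ Icc (d - x) c, g (x, y) ∈ acc s := by
  have hBad : (⋃ p ∈ {p | GoodH s p}, ({(P p).1, (P p).1 + R p, (P p).1 - R p,
      (P p).1 + (T p - R p), (P p).1 - (T p - R p)} : Set ℝ)).Countable :=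
    goodH_countable.biUnion fun p _ => (Set.toFinite _).countable
  have key : ∀ x ∈ Ioo (d - c) x₁, x ∉ B →
      x ∉ (⋃ p ∈ {p | GoodH s p}, ({(P p).1, (P p).1 + R p, (P p).1 - R p,
        (P p).1 + (T p - R p), (P p).1 - (T p - R p)} : Set ℝ)) →
      ∃ y ∈ Icc (d - x) c, g (x, y) ∈ acc s := by
    intro x hx hxB hxg
    by_contra hno
    push Not at hno
    have hxg' : ∀ p, GoodH s p → x ∉ ({(P p).1, (P p).1 + R p, (P p).1 - R p,
        (P p).1 + (T p - R p), (P p).1 - (T p - R p)} : Set ℝ) :=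
      fun p hp hxp => hxg (mem_biUnion (show p ∈ {p | GoodH s p} from hp) hxp)
    simp only [mem_insert_iff, mem_singleton_iff, not_or] at hxg'
    have hgx : Continuous fun y => g (x, y) := by fun_prop
    have hfin := finite_cells_of_isCompact hs hs1
      ((isCompact_Icc (a := d - x) (b := c)).image hgx) (by
        rw [Set.disjoint_left]
        rintro _ ⟨y, hy, rfl⟩
        exact hno y hy)
    refine not_cover_wedge hfin P R T (x := x) (c := c) (d := d) (fun p hp => hR p hp.1)
      (fun p hp z hz => hsub z ?_) (fun p hp q hq z hz hz' => ?_) (by linarith [hx.1])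
      (fun p hp => (hxg' p hp.1).1) (fun p hp h => ?_) (fun p hp h => ?_) ?_
    · exact ((hcell p hp.1 z).2 hz) [] p rfl
    · exact cell_disjoint hs hp.1 hq.1 ((hinterior p hp.1 z).2 hz) ((hinterior q hq.1 z).2 hz')
    · obtain ⟨-, h1, h2, -, -⟩ := hxg' p hp.1
      rcases abs_choice (x - (P p).1) with e | e <;> rw [e] at h
      · exact h1 (by linarith)
      · exact h2 (by linarith)
    · obtain ⟨-, -, -, h1, h2⟩ := hxg' p hp.1
      rcases abs_choice (x - (P p).1) with e | e <;> rw [e] at h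
      · exact h1 (by linarith)
      · exact h2 (by linarith)
    · obtain ⟨C, hC, hgC⟩ := hgen x hx hxB
      have hcl : IsClosed (⋃ p ∈ {p | GoodH s p ∧
          (cell s p ∩ (fun y => g (x, y)) '' Icc (d - x) c).Nonempty},
          {y | (x, y) ∈ oct (P p) (R p) (T p)}) :=
        hfin.isClosed_biUnion fun i _ => (isClosed_oct _ _ _).preimage (by fun_prop)
      have hsubset : Icc (d - x) c ⊆ (⋃ p ∈ {p | GoodH s p ∧
          (cell s p ∩ (fun y => g (x, y)) '' Icc (d - x) c).Nonempty},
          {y | (x, y) ∈ oct (P p) (R p) (T p)}) := by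
        refine (closure_Ioo (by linarith [hx.1] : d - x < c).ne).symm.subset.trans (closure_minimal (((hC.dense_compl ℝ).open_subset_closure_inter isOpen_Ioo).trans
          (closure_minimal ?_ hcl)) hcl)
        rintro y ⟨hy, hyC⟩
        obtain ⟨k1, k2, k3⟩ := hgC y hy hyC
        have hy' := Ioo_subset_Icc_self hy
        have : ∃ p, GoodH s p ∧ g (x, y) ∈ cell s p := by
          by_contra hcon
          push Not at hcon
          have hclos : g (x, y) ∈ closure {p | GoodH s p} := by
            rw [Metric.mem_closure_iff]
            intro ε hε
            obtain ⟨p, hp, hc | hd⟩ := hη _ k1 k2 k3 (ε / 2) (half_pos hε)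
            · exact absurd hc.mem_cell (hcon p hp)
            · exact ⟨p, hp, by linarith⟩
          rw [closure_eq_self_union_derivedSet] at hclos
          rcases hclos with h | h
          · exact hcon _ h (GoodH.inCell_self hs h).mem_cell
          · exact hno y hy' h
        obtain ⟨p, hp, hpc⟩ := this
        exact mem_biUnion (show p ∈ {p | _} from ⟨hp, _, hpc, y, hy', rfl⟩)
          ((hcell p hp _).1 hpc)
      intro y hy
      obtain ⟨p, hp, hpy⟩ := mem_iUnion₂.1 (hsubset hy)
      exact ⟨p, hp, hpy⟩
  obtain ⟨x₂, hx2, hx2'⟩ := exists_between hx.2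
  obtain ⟨x₃, hx3, hx3'⟩ := exists_between hx.1
  have hK : IsClosed (Prod.fst '' ({z : ℝ × ℝ | z.1 ∈ Icc x₃ x₂ ∧ z.2 ∈ Icc (d - x₂) c} ∩
      ({z | d - z.1 ≤ z.2} ∩ g ⁻¹' acc s))) := by
    refine (IsCompact.image ?_ continuous_fst).isClosed
    exact (isCompact_Icc.prod isCompact_Icc).inter_right
      ((isClosed_le (by fun_prop) (by fun_prop)).inter (isClosed_acc.preimage hg))
  have hD := ((hB.union hBad).dense_compl ℝ).open_subset_closure_inter
    (isOpen_Ioo (a := x₃) (b := x₂)) ⟨hx3', hx2⟩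
  obtain ⟨⟨x', y⟩, ⟨-, h1⟩, rfl⟩ := closure_minimal (by
    rintro x' ⟨hx', hxc⟩
    rw [mem_compl_iff, mem_union, not_or] at hxc
    obtain ⟨y, hy, hya⟩ := key x' ⟨hx3.trans hx'.1, hx'.2.trans hx2'⟩ hxc.1 hxc.2
    exact ⟨(x', y), ⟨⟨Ioo_subset_Icc_self hx', by linarith [hy.1, hx'.2], hy.2⟩, hy.1, hya⟩, rfl⟩)
    hK hD
  refine ⟨y, ⟨h1.1, ?_⟩, h1.2⟩
  have : g (x', y) ∈ {z | HCl s z} := by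
    have h := (mem_derivedSet.1 h1.2).clusterPt
    rw [← mem_closure_iff_clusterPt] at h
    exact closure_minimal (fun p hp => (GoodH.hIn hs hp).cl) isClosed_hCl h
  exact (hsub _ this).1

end

section

variable {s : ℝ}

theorem countable_modL : (modL s : Set ℝ).Countable := by
  refine (countable_range fun p : ℚ × ℚ => p.1 • (1 : ℝ) + p.2 • s).mono fun x hx => ?_
  obtain ⟨p, q, h⟩ := Submodule.mem_span_pair.1 hx
  exact ⟨(p, q), h⟩

theorem hCl_of_acc (hs : 0 < s) {z : ℝ × ℝ} (hz : z ∈ acc s) : HCl s z := by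
  have h := (mem_derivedSet.1 hz).clusterPt
  rw [← mem_closure_iff_clusterPt] at h
  exact closure_minimal (fun p hp => (GoodH.hIn hs hp).cl) isClosed_hCl h

theorem countable_not_gen (x : ℝ) :
    {y | y ∈ modL s ∨ x + y ∈ modL s ∨ x - y ∈ modL s}.Countable :=
  countable_modL.union <|
    (countable_modL.preimage (add_right_injective x)).union
      (countable_modL.preimage sub_right_injective)

theorem half_mem_modL {x : ℝ} (h : x / 2 ∈ modL s) : x ∈ modL s := by
  have := (modL s).add_mem h h
  rwa [add_halves] at this

theorem exists_acc_vertical (h0 : 0 < s) (h1 : s < 1) (hirr : Irrational s) :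
    ∃ δ > 0, ∀ t ∈ Ioo 0 δ, ∃ z ∈ acc s, z.1 = -1 - s + t := by
  obtain ⟨η, hη, hnear⟩ := exists_near_apex h0 h1 hirr
  have hδ : 0 < min η (min s 1) := lt_min hη (lt_min h0 one_pos)
  refine ⟨min η (min s 1), hδ, fun t ht => ?_⟩
  have b1 : min η (min s 1) ≤ η := min_le_left _ _
  have b2 : min η (min s 1) ≤ s := (min_le_right _ _).trans (min_le_left _ _)
  have b3 : min η (min s 1) ≤ 1 := (min_le_right _ _).trans (min_le_right _ _)
  choose! r τ hr hrτ hτ hc hi using fun p (hp : GoodH s p) => hp.cell_eq_oct h0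
  have hgen : ∀ x ∈ Ioo (-1 - s) (-1 - s + min η (min s 1)), x ∉ (modL s : Set ℝ) →
      ∃ C : Set ℝ, C.Countable ∧ ∀ y ∈ Ioo (-1 - x) s, y ∉ C → HIn s (x, -y) ∧
        dist (x, -y) (apex s) < η ∧ Gen (modL s) (x, -y) := by
    intro x hx hxL
    refine ⟨_, countable_not_gen (s := s) x, fun y hy hyL => ?_⟩
    simp only [mem_ofPred_eq, not_or] at hyL
    obtain ⟨x1, x2⟩ := hx
    obtain ⟨y1, y2⟩ := hy
    refine ⟨⟨?_, ?_, ?_, ?_⟩, ?_, hxL, ?_, ?_, ?_⟩ <;> (try simp only)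
    any_goals linarith
    · rw [Prod.dist_eq, max_lt_iff, Real.dist_eq, Real.dist_eq, abs_lt, abs_lt]
      simp only [apex]
      refine ⟨⟨?_, ?_⟩, ?_, ?_⟩ <;> linarith
    · rw [neg_mem_iff]; exact hyL.1
    · rw [← sub_eq_add_neg]; exact hyL.2.2
    · rw [sub_neg_eq_add]; exact hyL.2.1
  obtain ⟨y, -, hy⟩ := exists_acc_of_wedge h0 h1 hnear (g := fun z => (z.1, -z.2))
    (P := fun p => (p.1, -p.2)) (R := r) (T := τ) (c := s) (d := -1)
    (x₁ := -1 - s + min η (min s 1)) (x := -1 - s + t) (by fun_prop) hr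
    (fun p hp z => by
      have e : -z.2 - p.2 = -(z.2 - -p.2) := by ring
      simp only [hc p hp, oct, mem_ofPred_eq, e, abs_neg])
    (fun p hp z => by
      have e : -z.2 - p.2 = -(z.2 - -p.2) := by ring
      simp only [hi p hp, octInt, mem_ofPred_eq, e, abs_neg])
    (fun z hz => ⟨by linarith [hz.1], by linarith [hz.2.2.1]⟩)
    countable_modL hgen
    ⟨by linarith [ht.1], by linarith [ht.2]⟩
  exact ⟨_, hy, rfl⟩

theorem abs_le_and_abs_le_iff {a b c : ℝ} :
    |a| ≤ c ∧ |b| ≤ c ↔ |a + b| + |b - a| ≤ 2 * c := by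
  constructor
  · rintro ⟨h1, h2⟩
    rw [abs_le] at h1 h2
    rcases abs_choice (a + b) with e | e <;> rcases abs_choice (b - a) with e' | e' <;>
      rw [e, e'] <;> linarith
  · intro h
    constructor <;> rw [abs_le] <;>
      constructor <;> linarith [le_abs_self (a + b), neg_le_abs (a + b), le_abs_self (b - a),
        neg_le_abs (b - a)]

theorem abs_lt_and_abs_lt_iff {a b c : ℝ} :
    |a| < c ∧ |b| < c ↔ |a + b| + |b - a| < 2 * c := by
  constructor
  · rintro ⟨h1, h2⟩
    rw [abs_lt] at h1 h2
    rcases abs_choice (a + b) with e | e <;> rcases abs_choice (b - a) with e' | e' <;>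
      rw [e, e'] <;> linarith
  · intro h
    constructor <;> rw [abs_lt] <;>
      constructor <;> linarith [le_abs_self (a + b), neg_le_abs (a + b), le_abs_self (b - a),
        neg_le_abs (b - a)]

theorem abs_add_abs_le_iff {a b c : ℝ} : |a| + |b| ≤ c ↔ |a + b| ≤ c ∧ |b - a| ≤ c := by
  have h := (abs_le_and_abs_le_iff (a := a + b) (b := b - a) (c := c)).symm
  rw [show a + b + (b - a) = 2 * b by ring, show b - a - (a + b) = -(2 * a) by ring, abs_neg,
    abs_mul, abs_mul, abs_two] at h
  rw [← h]
  constructor <;> intro h <;> linarith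

theorem abs_add_abs_lt_iff {a b c : ℝ} : |a| + |b| < c ↔ |a + b| < c ∧ |b - a| < c := by
  have h := (abs_lt_and_abs_lt_iff (a := a + b) (b := b - a) (c := c)).symm
  rw [show a + b + (b - a) = 2 * b by ring, show b - a - (a + b) = -(2 * a) by ring, abs_neg,
    abs_mul, abs_mul, abs_two] at h
  rw [← h]
  constructor <;> intro h <;> linarith

theorem mem_oct_diag (z p : ℝ × ℝ) (r t : ℝ) :
    ((z.1 - z.2) / 2, (z.1 + z.2) / 2) ∈ oct p r t ↔
      z ∈ oct (p.1 + p.2, p.2 - p.1) t (2 * r) := by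
  simp only [oct, mem_ofPred_eq]
  rw [← and_assoc, abs_le_and_abs_le_iff, abs_add_abs_le_iff (c := t), and_comm, and_assoc,
    show (z.1 - z.2) / 2 - p.1 + ((z.1 + z.2) / 2 - p.2) = z.1 - (p.1 + p.2) by ring,
    show (z.1 + z.2) / 2 - p.2 - ((z.1 - z.2) / 2 - p.1) = z.2 - (p.2 - p.1) by ring]

theorem mem_octInt_diag (z p : ℝ × ℝ) (r t : ℝ) :
    ((z.1 - z.2) / 2, (z.1 + z.2) / 2) ∈ octInt p r t ↔
      z ∈ octInt (p.1 + p.2, p.2 - p.1) t (2 * r) := by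
  simp only [octInt, mem_ofPred_eq]
  rw [← and_assoc, abs_lt_and_abs_lt_iff, abs_add_abs_lt_iff (c := t), and_comm, and_assoc,
    show (z.1 - z.2) / 2 - p.1 + ((z.1 + z.2) / 2 - p.2) = z.1 - (p.1 + p.2) by ring,
    show (z.1 + z.2) / 2 - p.2 - ((z.1 - z.2) / 2 - p.1) = z.2 - (p.2 - p.1) by ring]

theorem exists_acc_diagonal (h0 : 0 < s) (h1 : s < 1) (hirr : Irrational s) :
    ∃ δ > 0, ∀ t ∈ Ioo 0 δ, ∃ z ∈ acc s, z.1 + z.2 = -1 - 2 * s + t := by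
  obtain ⟨η, hη, hnear⟩ := exists_near_apex h0 h1 hirr
  have hδ : 0 < min η (min s 1) := lt_min hη (lt_min h0 one_pos)
  refine ⟨min η (min s 1), hδ, fun t ht => ?_⟩
  have b1 : min η (min s 1) ≤ η := min_le_left _ _
  have b2 : min η (min s 1) ≤ s := (min_le_right _ _).trans (min_le_left _ _)
  have b3 : min η (min s 1) ≤ 1 := (min_le_right _ _).trans (min_le_right _ _)
  choose! r τ hr hrτ hτ hc hi using fun p (hp : GoodH s p) => hp.cell_eq_oct h0
  have hgen : ∀ x ∈ Ioo (-2 * s - 1) (-1 - 2 * s + min η (min s 1)), x ∉ (modL s : Set ℝ) →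
      ∃ C : Set ℝ, C.Countable ∧ ∀ y ∈ Ioo (-2 * s - x) 1, y ∉ C → HIn s ((x - y) / 2, (x + y) / 2) ∧
        dist ((x - y) / 2, (x + y) / 2) (apex s) < η ∧ Gen (modL s) ((x - y) / 2, (x + y) / 2) := by
    intro x hx hxL
    refine ⟨_, countable_not_gen (s := s) x, fun y hy hyL => ?_⟩
    simp only [mem_ofPred_eq, not_or] at hyL
    obtain ⟨x1, x2⟩ := hx
    obtain ⟨y1, y2⟩ := hy
    refine ⟨⟨?_, ?_, ?_, ?_⟩, ?_, fun h => hyL.2.2 (half_mem_modL h),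
      fun h => hyL.2.1 (half_mem_modL h), ?_, ?_⟩ <;> (try simp only)
    any_goals linarith
    · rw [Prod.dist_eq, max_lt_iff, Real.dist_eq, Real.dist_eq, abs_lt, abs_lt]
      simp only [apex]
      refine ⟨⟨?_, ?_⟩, ?_, ?_⟩ <;> linarith
    · rw [show (x - y) / 2 + (x + y) / 2 = x by ring]; exact hxL
    · rw [show (x - y) / 2 - (x + y) / 2 = -y by ring, neg_mem_iff]; exact hyL.1
  obtain ⟨y, -, hy⟩ := exists_acc_of_wedge h0 h1 hnear
    (g := fun z => ((z.1 - z.2) / 2, (z.1 + z.2) / 2))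
    (P := fun p => (p.1 + p.2, p.2 - p.1)) (R := τ) (T := fun p => 2 * r p) (c := 1) (d := -2 * s)
    (x₁ := -1 - 2 * s + min η (min s 1)) (x := -1 - 2 * s + t) (by fun_prop)
    (fun p hp => (hr p hp).trans_le (hrτ p hp))
    (fun p hp z => by
      simp only [hc p hp]
      exact mem_oct_diag z p (r p) (τ p))
    (fun p hp z => by
      simp only [hi p hp]
      exact mem_octInt_diag z p (r p) (τ p))
    (fun z hz => by
      obtain ⟨z1, z2, z3, z4⟩ := hz
      simp only at z1 z2 z3 z4
      constructor <;> linarith)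
    countable_modL hgen
    ⟨by linarith [ht.1], by linarith [ht.2]⟩
  exact ⟨_, hy, by ring⟩

end

section

variable {s : ℝ}

theorem GoodH.exists_step {p : ℝ × ℝ} (h : GoodH s p) :
    ∃ c p', HStep s c p p' ∧ GoodH s p' := by
  obtain ⟨l, hl, hr⟩ := h
  cases l with
  | nil => simp at hl
  | cons c l =>
    have : ∃ m, HStep s c p m ∧ (Run (HStep s) l m p ∨ Run (HStep s) l m (-p)) := by
      rcases hr with ⟨m, h1, h2⟩ | ⟨m, h1, h2⟩
      · exact ⟨m, h1, Or.inl h2⟩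
      · exact ⟨m, h1, Or.inr h2⟩
    obtain ⟨m, h1, h2 | h2⟩ := this
    · exact ⟨c, m, h1, l ++ [c], by simpa using hl,
        Or.inl (run_append.2 ⟨p, h2, run_singleton.2 h1⟩)⟩
    · exact ⟨c, m, h1, l ++ [-c], by simpa using hl,
        Or.inr (run_append.2 ⟨-p, h2, run_singleton.2 h1.neg⟩)⟩

theorem GoodH.of_run (hs : 0 < s) {l : List (ℤ × ℤ)} {p p' : ℝ × ℝ} (h : GoodH s p)
    (hr : Run (HStep s) l p p') : GoodH s p' := by
  induction l generalizing p with
  | nil => cases hr; exact h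
  | cons c l ih =>
    obtain ⟨m, h1, h2⟩ := hr
    obtain ⟨c', p'', h3, h4⟩ := h.exists_step
    obtain ⟨rfl, rfl⟩ := hstep_det hs _ _ _ _ _ h1 h3
    exact ih h4 h2

theorem GoodH.exists_step_back (hs : 0 < s) {p : ℝ × ℝ} (h : GoodH s p) :
    ∃ c p', HStep s c p' p ∧ GoodH s p' := by
  obtain ⟨l, k, hk, hl, hr⟩ := h.exists_double
  rcases List.eq_nil_or_concat' l with rfl | ⟨l', c, rfl⟩
  · have := hk.pos
    simp at hl
    omega
  · obtain ⟨m, h1, h2⟩ := run_append.1 hr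
    exact ⟨c, m, run_singleton.1 h2, h.of_run hs h1⟩

theorem HStep.code_mem (hs : 0 < s) (hs1 : s < 1) {c : ℤ × ℤ} {p p' : ℝ × ℝ}
    (h : HStep s c p p') : c ∈ Icc (-3 : ℤ) 3 ×ˢ Icc ⌈-2 / s⌉ ⌊2 / s⌋ := by
  obtain ⟨⟨a1, a2, a3, a4⟩, ⟨b1, b2, b3, b4⟩, rfl⟩ := h
  simp only [hact] at b1 b2 b3 b4
  have e1 : -3 < (c.1 : ℝ) := by linarith
  have e2 : (c.1 : ℝ) < 3 := by linarith
  refine ⟨⟨?_, ?_⟩, Int.ceil_le.2 ?_, Int.le_floor.2 ?_⟩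
  · exact_mod_cast e1.le
  · exact_mod_cast e2.le
  · rw [div_le_iff₀ hs]; linarith
  · rw [le_div_iff₀ hs]; linarith

theorem acc_transport {ι : Type*} {C : Set ι} (hC : C.Finite) {f : ι → ℝ × ℝ → ℝ × ℝ}
    (hf : ∀ c, Continuous (f c)) (hinj : ∀ c, Function.Injective (f c))
    (h : ∀ p, GoodH s p → ∃ c ∈ C, GoodH s (f c p)) {z : ℝ × ℝ} (hz : z ∈ acc s) :
    ∃ c, f c z ∈ acc s := by
  have hz' := accPt_iff_frequently.1 (mem_derivedSet.1 hz)
  by_contra hno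
  push Not at hno
  have hev : ∀ c ∈ C, ∀ᶠ y in 𝓝 z, ¬(y ≠ z ∧ GoodH s (f c y)) := by
    intro c _
    by_contra hfr
    refine hno c (mem_derivedSet.2 (accPt_iff_frequently.2 ?_))
    refine (hf c).continuousAt.frequently (Frequently.mono hfr ?_)
    rintro y hy
    exact ⟨fun e => hy.1 (hinj c e), hy.2⟩
  refine hz' ((((eventually_all_finite hC).2 hev)).mono ?_)
  rintro y hy ⟨h1, h2⟩
  obtain ⟨c, hc, h3⟩ := h y h2
  exact hy c hc ⟨h1, h3⟩

/-- The inverse of `hact`. -/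
def hback (s : ℝ) (c : ℤ × ℤ) (z : ℝ × ℝ) : ℝ × ℝ :=
  (-z.2 - 2 * c.1 + 2 * s * c.2, z.1 - 2 * s * c.2)

theorem hback_hact (c : ℤ × ℤ) (z : ℝ × ℝ) : hback s c (hact s c z) = z := by
  ext <;> simp only [hback, hact] <;> ring

theorem hact_hback (c : ℤ × ℤ) (z : ℝ × ℝ) : hact s c (hback s c z) = z := by
  ext <;> simp only [hback, hact] <;> ring

theorem exists_hact_mem_acc (hs : 0 < s) (hs1 : s < 1) {z : ℝ × ℝ} (hz : z ∈ acc s) :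
    ∃ c, hact s c z ∈ acc s := by
  refine acc_transport ((finite_Icc (-3 : ℤ) 3).prod (finite_Icc ⌈-2 / s⌉ ⌊2 / s⌋))
    (fun c => by unfold hact; fun_prop) (fun c => Function.LeftInverse.injective (hback_hact c)) (fun p hp => ?_) hz
  obtain ⟨c, p', h1, h2⟩ := hp.exists_step
  exact ⟨c, h1.code_mem hs hs1, h1.2.2 ▸ h2⟩

theorem exists_hback_mem_acc (hs : 0 < s) (hs1 : s < 1) {z : ℝ × ℝ} (hz : z ∈ acc s) :
    ∃ c, hback s c z ∈ acc s := by
  refine acc_transport ((finite_Icc (-3 : ℤ) 3).prod (finite_Icc ⌈-2 / s⌉ ⌊2 / s⌋))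
    (fun c => by unfold hback; fun_prop) (fun c => Function.LeftInverse.injective (hact_hback c)) (fun p hp => ?_) hz
  obtain ⟨c, p', h1, h2⟩ := hp.exists_step_back hs
  refine ⟨c, h1.code_mem hs hs1, ?_⟩
  obtain ⟨-, -, rfl⟩ := h1
  rwa [hback_hact]

theorem isCompact_acc (hs : 0 < s) (hs1 : s < 1) : IsCompact (acc s) :=
  (isCompact_closedBall (0 : ℝ × ℝ) 2).of_isClosed_subset isClosed_acc fun _ hz =>
    (hCl_of_acc hs hz).mem_closedBall hs1

/-- The dot product with `v` on `limitSet s` covers an interval as soon as it covers, in an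
affine parametrization, an open interval. -/
theorem exists_Icc_of_slices {L : Set (ℝ × ℝ)} {v : ℝ × ℝ} {a b k σ : ℝ} (hab : a < b)
    (hσ : σ = 1 ∨ σ = -1) (h : ∀ t ∈ Ioo a b, ∃ z ∈ L, dot2 z v = k + σ * t) :
    ∃ a b, a < b ∧ Icc a b ⊆ (fun p => dot2 p v) '' L := by
  obtain ⟨a', ha, ha'⟩ := exists_between hab
  obtain ⟨b', hb, hb'⟩ := exists_between ha'
  rcases hσ with rfl | rfl
  · refine ⟨k + a', k + b', by linarith, fun t ht => ?_⟩
    obtain ⟨z, hz, e⟩ := h (t - k) ⟨by linarith [ht.1], by linarith [ht.2]⟩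
    exact ⟨z, hz, by beta_reduce; rw [e]; ring⟩
  · refine ⟨k - b', k - a', by linarith, fun t ht => ?_⟩
    obtain ⟨z, hz, e⟩ := h (k - t) ⟨by linarith [ht.2], by linarith [ht.1]⟩
    exact ⟨z, hz, by beta_reduce; rw [e]; ring⟩

theorem exists_Ioo_of_two_covers {f : ℝ × ℝ → ℝ} (hf : Continuous f) {K : Set (ℝ × ℝ)}
    (hK : IsCompact K) {P₁ P₂ : Set (ℝ × ℝ)} (h1 : IsClosed P₁) {a b : ℝ}
    (hab : a < b) (h : ∀ t ∈ Ioo a b, ∃ z ∈ K, f z = t ∧ (z ∈ P₁ ∨ z ∈ P₂)) :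
    ∃ a' b', a ≤ a' ∧ a' < b' ∧ b' ≤ b ∧ ((∀ t ∈ Ioo a' b', ∃ z ∈ K, f z = t ∧ z ∈ P₁) ∨
      ∀ t ∈ Ioo a' b', ∃ z ∈ K, f z = t ∧ z ∈ P₂) := by
  by_cases hall : ∀ t ∈ Ioo a b, ∃ z ∈ K, f z = t ∧ z ∈ P₁
  · exact ⟨a, b, le_rfl, hab, le_rfl, Or.inl hall⟩
  push Not at hall
  obtain ⟨t, ht, hno⟩ := hall
  have hcl : IsClosed (f '' (K ∩ P₁)) := ((hK.inter_right h1).image hf).isClosed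
  have ht' : t ∈ (f '' (K ∩ P₁))ᶜ ∩ Ioo a b := by
    refine ⟨?_, ht⟩
    rintro ⟨z, ⟨hz, hz'⟩, e⟩
    exact hno z hz e hz'
  obtain ⟨a', b', hlt, hsub'⟩ := (hcl.isOpen_compl.inter isOpen_Ioo).exists_Ioo_subset ⟨t, ht'⟩
  have hcc : Icc a' b' ⊆ Icc a b := by
    rw [← closure_Ioo hlt.ne, ← closure_Ioo hab.ne]
    exact closure_mono fun x hx => (hsub' hx).2
  refine ⟨a', b', (hcc (left_mem_Icc.2 hlt.le)).1, hlt, (hcc (right_mem_Icc.2 hlt.le)).2,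
    Or.inr fun x hx => ?_⟩
  obtain ⟨hx1, hx2⟩ := hsub' hx
  obtain ⟨z, hz, e, hz' | hz'⟩ := h x hx2
  · exact absurd ⟨z, ⟨hz, hz'⟩, e⟩ hx1
  · exact ⟨z, hz, e, hz'⟩

end

section

variable {s : ℝ}

/-- Some one-step image or preimage of `z` lies in the limit set, at prescribed heights. -/
def Lands (s σ k l : ℝ) (z : ℝ × ℝ) : Prop :=
  ∃ z' ∈ limitSet s, z'.2 = k + σ * z.1 ∧ z'.1 - z'.2 = l - σ * (z.1 + z.2)

theorem int_eq_of_lt {n N : ℤ} (h1 : (N : ℝ) - 1 < n) (h2 : (n : ℝ) < N + 1) : n = N := by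
  have h1' : N - 1 < n := by exact_mod_cast h1
  have h2' : n < N + 1 := by exact_mod_cast h2
  omega

theorem exists_lands_small (h0 : 0 < s) (h1 : s < 1 / 2) :
    ∃ δ > 0, ∃ k l, ∀ z ∈ acc s, 0 < z.1 + 1 + s → z.1 + 1 + s < δ → Lands s 1 k l z := by
  set N : ℤ := ⌊-1 / (2 * s)⌋ with hN
  have hN1 : 2 * s * N ≤ -1 := by
    have := Int.floor_le (-1 / (2 * s))
    rw [← hN, le_div_iff₀ (by positivity)] at this
    linarith
  have hN2 : -1 < 2 * s * (N + 1) := by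
    have := Int.lt_floor_add_one (-1 / (2 * s))
    rw [← hN, div_lt_iff₀ (by positivity)] at this
    linarith
  set M : ℤ := ⌈s + 2 * s * N⌉ with hM
  have hM1 : s + 2 * s * N ≤ M := Int.le_ceil _
  have hM2 : (M : ℝ) < s + 2 * s * N + 1 := Int.ceil_lt_add_one _
  refine ⟨min (1 - 2 * s) (min (2 * s * (N + 1) + 1) (s + 2 * s * N + 1 - M)),
    lt_min (by linarith) (lt_min (by linarith) (by linarith)), -2 * s * N, -2 * M + 4 * s * N,
    fun z hz ht0 htδ => ?_⟩
  obtain ⟨e1, e2⟩ := lt_min_iff.1 htδ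
  obtain ⟨e3, e4⟩ := lt_min_iff.1 e2
  obtain ⟨⟨m, n⟩, hc⟩ := exists_hback_mem_acc h0 (by linarith) hz
  obtain ⟨z1, z2, z3, z4⟩ := hCl_of_acc h0 hz
  obtain ⟨a1, a2, a3, a4⟩ := hCl_of_acc h0 hc
  simp only [hback] at a1 a2 a3 a4
  have hn : n = N := by
    apply int_eq_of_lt
    · refine lt_of_mul_lt_mul_left (a := 2 * s) ?_ (by positivity)
      linarith
    · refine lt_of_mul_lt_mul_left (a := 2 * s) ?_ (by positivity)
      linarith
  subst hn
  have hm : m = M := by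
    apply int_eq_of_lt <;> linarith
  subst hm
  refine ⟨_, mem_limitSet_of_acc h0 (by linarith) hc ?_, ?_, ?_⟩
  · rintro ⟨-, b1, b2, b3, b4⟩
    simp only [hback, turn] at b1 b2 b3 b4
    rcases le_or_gt 0 (M : ℤ) with h | h
    · have : (0 : ℝ) ≤ M := by exact_mod_cast h
      linarith
    · have : (M : ℝ) ≤ -1 := by exact_mod_cast (by omega : M ≤ -1)
      linarith
  · simp only [hback]; ring
  · simp only [hback]; ring

theorem exists_lands_big (h0 : 1 / 2 < s) (h1 : s < 1) :
    ∃ δ > 0, ∀ z ∈ acc s, 0 < z.1 + 1 + s → z.1 + 1 + s < δ →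
      (2 * (z.2 + s) ≤ z.1 + 1 + s → Lands s (-1) (-2) 2 z) ∧
      (z.1 + 1 + s ≤ 2 * (z.2 + s) → Lands s 1 (2 * s) (-4 * s) z) := by
  refine ⟨min (2 * s - 1) (1 - s), lt_min (by linarith) (by linarith), fun z hz ht0 htδ => ?_⟩
  obtain ⟨e1, e2⟩ := lt_min_iff.1 htδ
  have hs : 0 < s := by linarith
  obtain ⟨z1, z2, z3, z4⟩ := hCl_of_acc hs hz
  constructor
  · intro hu
    obtain ⟨⟨m, n⟩, hc⟩ := exists_hact_mem_acc hs h1 hz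
    obtain ⟨a1, a2, a3, a4⟩ := hCl_of_acc hs hc
    simp only [hact] at a1 a2 a3 a4
    have hm : m = 1 := by
      apply int_eq_of_lt <;> push_cast <;> linarith
    subst hm
    push_cast at a1 a2 a3 a4
    have hn : n = 0 := by
      apply int_eq_of_lt
      · refine lt_of_mul_lt_mul_left (a := 2 * s) ?_ (by positivity)
        push_cast
        linarith
      · refine lt_of_mul_lt_mul_left (a := 2 * s) ?_ (by positivity)
        push_cast
        linarith
    subst hn
    refine ⟨_, mem_limitSet_of_acc hs h1 hc ?_, ?_, ?_⟩
    · rintro ⟨-, b1, b2, b3, b4⟩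
      simp only [hact, turn] at b1 b2 b3 b4
      push_cast at b1 b2 b3 b4
      linarith
    · simp only [hact]; push_cast; ring
    · simp only [hact]; push_cast; ring
  · intro hu
    obtain ⟨⟨m, n⟩, hc⟩ := exists_hback_mem_acc hs h1 hz
    obtain ⟨a1, a2, a3, a4⟩ := hCl_of_acc hs hc
    simp only [hback] at a1 a2 a3 a4
    have hn : n = -1 := by
      apply int_eq_of_lt
      · refine lt_of_mul_lt_mul_left (a := 2 * s) ?_ (by positivity)
        push_cast
        linarith
      · refine lt_of_mul_lt_mul_left (a := 2 * s) ?_ (by positivity)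
        push_cast
        linarith
    subst hn
    push_cast at a1 a2 a3 a4
    have hm : m = 0 := by
      apply int_eq_of_lt <;> push_cast <;> linarith
    subst hm
    refine ⟨_, mem_limitSet_of_acc hs h1 hc ?_, ?_, ?_⟩
    · rintro ⟨-, b1, b2, b3, b4⟩
      simp only [hback, turn] at b1 b2 b3 b4
      push_cast at b1 b2 b3 b4
      linarith
    · simp only [hback]; push_cast; ring
    · simp only [hback]; push_cast; ring

theorem exists_lands (h0 : 0 < s) (h1 : s < 1) (hirr : Irrational s) :
    ∃ δ > 0, ∃ σ₁ σ₂ k₁ k₂ l₁ l₂ : ℝ, (σ₁ = 1 ∨ σ₁ = -1) ∧ (σ₂ = 1 ∨ σ₂ = -1) ∧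
      ∀ z ∈ acc s, 0 < z.1 + 1 + s → z.1 + 1 + s < δ →
        (2 * (z.2 + s) ≤ z.1 + 1 + s → Lands s σ₁ k₁ l₁ z) ∧
        (z.1 + 1 + s ≤ 2 * (z.2 + s) → Lands s σ₂ k₂ l₂ z) := by
  rcases lt_trichotomy s (1 / 2) with h | h | h
  · obtain ⟨δ, hδ, k, l, H⟩ := exists_lands_small h0 h
    exact ⟨δ, hδ, 1, 1, k, k, l, l, Or.inl rfl, Or.inl rfl, fun z hz h1 h2 =>
      ⟨fun _ => H z hz h1 h2, fun _ => H z hz h1 h2⟩⟩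
  · exact absurd (by rw [h]; push_cast; norm_num) (hirr.ne_rat (1 / 2))
  · obtain ⟨δ, hδ, H⟩ := exists_lands_big h h1
    exact ⟨δ, hδ, -1, 1, -2, 2 * s, 2, -4 * s, Or.inr rfl, Or.inl rfl, H⟩

theorem mem_limitSet_near_apex (h0 : 0 < s) (h1 : s < 1) {z : ℝ × ℝ} (hz : z ∈ acc s)
    (h : z.1 + 1 + s < 1) : z ∈ limitSet s := by
  refine mem_limitSet_of_acc h0 h1 hz ?_
  rintro ⟨-, b1, b2, b3, b4⟩
  simp only [turn] at b1 b2 b3 b4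
  linarith

theorem proj_one_zero (h0 : 0 < s) (h1 : s < 1) (hirr : Irrational s) :
    ∃ a b, a < b ∧ Icc a b ⊆ (fun p => dot2 p (1, 0)) '' limitSet s := by
  obtain ⟨δ, hδ, H⟩ := exists_acc_vertical h0 h1 hirr
  refine exists_Icc_of_slices (lt_min hδ one_pos) (k := -1 - s) (Or.inl rfl) fun t ht => ?_
  obtain ⟨z, hz, e⟩ := H t ⟨ht.1, ht.2.trans_le (min_le_left _ _)⟩
  have := ht.2.trans_le (min_le_right _ _)
  exact ⟨z, mem_limitSet_near_apex h0 h1 hz (by linarith), by simp only [dot2]; linarith⟩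

theorem proj_one_one (h0 : 0 < s) (h1 : s < 1) (hirr : Irrational s) :
    ∃ a b, a < b ∧ Icc a b ⊆ (fun p => dot2 p (1, 1)) '' limitSet s := by
  obtain ⟨δ, hδ, H⟩ := exists_acc_diagonal h0 h1 hirr
  refine exists_Icc_of_slices (lt_min hδ one_pos) (k := -1 - 2 * s) (Or.inl rfl) fun t ht => ?_
  obtain ⟨z, hz, e⟩ := H t ⟨ht.1, ht.2.trans_le (min_le_left _ _)⟩
  have := ht.2.trans_le (min_le_right _ _)
  obtain ⟨z1, -, -, -⟩ := hCl_of_acc h0 hz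
  exact ⟨z, mem_limitSet_near_apex h0 h1 hz (by linarith), by simp only [dot2]; linarith⟩

theorem proj_zero_one (h0 : 0 < s) (h1 : s < 1) (hirr : Irrational s) :
    ∃ a b, a < b ∧ Icc a b ⊆ (fun p => dot2 p (0, 1)) '' limitSet s := by
  obtain ⟨δ, hδ, H⟩ := exists_acc_vertical h0 h1 hirr
  obtain ⟨δ', hδ', σ₁, σ₂, k₁, k₂, l₁, l₂, hσ₁, hσ₂, H'⟩ := exists_lands h0 h1 hirr
  obtain ⟨a, b, ha, hab, hb, h | h⟩ := exists_Ioo_of_two_covers (f := fun z => z.1 + 1 + s)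
    (by fun_prop) (isCompact_acc h0 h1)
    (P₁ := {z | 2 * (z.2 + s) ≤ z.1 + 1 + s}) (P₂ := {z | z.1 + 1 + s ≤ 2 * (z.2 + s)})
    (isClosed_le (by fun_prop) (by fun_prop)) (lt_min hδ hδ') (fun t ht => by
      obtain ⟨z, hz, e⟩ := H t ⟨ht.1, ht.2.trans_le (min_le_left _ _)⟩
      exact ⟨z, hz, by linarith, le_total (2 * (z.2 + s)) (z.1 + 1 + s)⟩)
  · refine exists_Icc_of_slices hab (k := k₁ - σ₁ * (1 + s)) hσ₁ fun t ht => ?_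
    obtain ⟨z, hz, rfl, hp⟩ := h t ht
    obtain ⟨z', hz', e1, -⟩ := (H' z hz (ha.trans_lt ht.1)
      ((ht.2.trans_le hb).trans_le (min_le_right _ _))).1 hp
    exact ⟨z', hz', by simp only [dot2]; rw [e1]; ring⟩
  · refine exists_Icc_of_slices hab (k := k₂ - σ₂ * (1 + s)) hσ₂ fun t ht => ?_
    obtain ⟨z, hz, rfl, hp⟩ := h t ht
    obtain ⟨z', hz', e1, -⟩ := (H' z hz (ha.trans_lt ht.1)
      ((ht.2.trans_le hb).trans_le (min_le_right _ _))).2 hp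
    exact ⟨z', hz', by simp only [dot2]; rw [e1]; ring⟩

theorem neg_sign {σ : ℝ} (h : σ = 1 ∨ σ = -1) : -σ = 1 ∨ -σ = -1 := by
  rcases h with rfl | rfl <;> simp

theorem proj_one_neg_one (h0 : 0 < s) (h1 : s < 1) (hirr : Irrational s) :
    ∃ a b, a < b ∧ Icc a b ⊆ (fun p => dot2 p (1, -1)) '' limitSet s := by
  obtain ⟨δ, hδ, H⟩ := exists_acc_diagonal h0 h1 hirr
  obtain ⟨δ', hδ', σ₁, σ₂, k₁, k₂, l₁, l₂, hσ₁, hσ₂, H'⟩ := exists_lands h0 h1 hirr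
  have hrange : ∀ z ∈ acc s, 0 < z.1 + z.2 + 1 + 2 * s → z.1 + z.2 + 1 + 2 * s < δ' →
      0 < z.1 + 1 + s ∧ z.1 + 1 + s < δ' := by
    intro z hz ha hb
    obtain ⟨z1, z2, z3, z4⟩ := hCl_of_acc h0 hz
    constructor <;> linarith
  obtain ⟨a, b, ha, hab, hb, h | h⟩ := exists_Ioo_of_two_covers
    (f := fun z => z.1 + z.2 + 1 + 2 * s) (by fun_prop) (isCompact_acc h0 h1)
    (P₁ := {z | 2 * (z.2 + s) ≤ z.1 + 1 + s}) (P₂ := {z | z.1 + 1 + s ≤ 2 * (z.2 + s)})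
    (isClosed_le (by fun_prop) (by fun_prop)) (lt_min hδ hδ') (fun t ht => by
      obtain ⟨z, hz, e⟩ := H t ⟨ht.1, ht.2.trans_le (min_le_left _ _)⟩
      exact ⟨z, hz, by linarith, le_total (2 * (z.2 + s)) (z.1 + 1 + s)⟩)
  · refine exists_Icc_of_slices hab (k := l₁ + σ₁ * (1 + 2 * s)) (neg_sign hσ₁) fun t ht => ?_
    obtain ⟨z, hz, rfl, hp⟩ := h t ht
    obtain ⟨r1, r2⟩ := hrange z hz (ha.trans_lt ht.1)
      ((ht.2.trans_le hb).trans_le (min_le_right _ _))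
    obtain ⟨z', hz', -, e1⟩ := (H' z hz r1 r2).1 hp
    exact ⟨z', hz', by simp only [dot2]; linarith⟩
  · refine exists_Icc_of_slices hab (k := l₂ + σ₂ * (1 + 2 * s)) (neg_sign hσ₂) fun t ht => ?_
    obtain ⟨z, hz, rfl, hp⟩ := h t ht
    obtain ⟨r1, r2⟩ := hrange z hz (ha.trans_lt ht.1)
      ((ht.2.trans_le hb).trans_le (min_le_right _ _))
    obtain ⟨z', hz', -, e1⟩ := (H' z hz r1 r2).2 hp
    exact ⟨z', hz', by simp only [dot2]; linarith⟩

theorem one_le_dimH_limitSet (h0 : 0 < s) (h1 : s < 1) (hirr : Irrational s) :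
    1 ≤ dimH (limitSet s) := by
  obtain ⟨a, b, hab, h⟩ := proj_one_zero h0 h1 hirr
  have e : (fun p : ℝ × ℝ => dot2 p (1, 0)) = Prod.fst := by
    funext p
    simp [dot2]
  rw [e] at h
  have hd : dimH (Prod.fst '' limitSet s) = 1 := by
    refine Real.dimH_of_nonempty_interior ?_ |>.trans (by simp)
    refine (nonempty_Ioo.2 hab).mono ?_
    rw [← interior_Icc]
    exact interior_mono h
  rw [← hd]
  exact LipschitzWith.prod_fst.dimH_image_le _

end

theorem mem_derivedSet_of_map {A B : Set (ℝ × ℝ)} {f : ℝ × ℝ → ℝ × ℝ} (hf : Continuous f)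
    (hinj : Function.Injective f) {x : ℝ × ℝ} (h : ∀ᶠ y in 𝓝 x, y ∈ A → f y ∈ B)
    (hx : x ∈ derivedSet A) : f x ∈ derivedSet B := by
  refine mem_derivedSet.2 (accPt_iff_frequently.2 (hf.continuousAt.frequently ?_))
  refine ((accPt_iff_frequently.1 (mem_derivedSet.1 hx)).and_eventually h).mono ?_
  rintro y ⟨⟨h1, h2⟩, h3⟩
  exact ⟨fun e => h1 (hinj e), h3 h2⟩

theorem AffEmb.continuous {φ : ℝ × ℝ → ℝ × ℝ} (h : AffEmb φ) : Continuous φ :=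
  (LipschitzWith.of_dist_le_mul (K := 1) (by simpa using h.dist_le)).continuous

/-- An embedding of a renormalized system into another one, at the acute vertex. -/
structure DeepEmb (a w a' w' : ℝ) (χ : ℝ × ℝ → ℝ × ℝ) : Prop where
  pos : 0 < w'
  lt : w' < 2 * a'
  ind : Ind a' w'
  emb : AffEmb χ
  vertex : χ (0, 2 * a') = (0, 2 * a)
  good : ∀ q, Good (StepC a' w') q → Good (StepC a w) (χ q)
  inT : ∀ q, InT a' w' q → InT a w (χ q)

section

variable {a w a' w' γ ω : ℝ} {n : ℕ}

theorem deepEmb_id (h0 : 0 < w) (h1 : w < 2 * a) (hi : Ind a w) : DeepEmb a w a w id :=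
  ⟨h0, h1, hi, AffEmb.id, rfl, fun _ h => h, fun _ h => h⟩

theorem deepEmb_psi (hl : Lev a γ ω n) (hi : Ind γ ω) (hw : w = γ ∨ w = 2 * a - γ) :
    DeepEmb a w γ ω (psi γ ω n) where
  pos := hl.om_pos
  lt := hl.om_lt
  ind := hi
  emb := affEmb_psi γ ω n
  vertex := by
    have := hl.eq
    ext <;> simp only [psi] <;> linarith
  good q h := by
    rcases hw with rfl | rfl
    · exact good_lift (odd_liftSmall n) (run_liftSmall hl.pos hl.om_pos hl.om_lt hl.eq)
        (good_rev h)
    · exact good_lift (odd_liftBig n) (run_liftBig hl.pos hl.om_pos hl.om_lt hl.eq) h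
  inT q h := by
    have := hl.lt
    exact psi_mem hl.pos hl.om_pos hl.eq (by rcases hw with rfl | rfl <;> linarith) h

theorem DeepEmb.comp {χ ρ : ℝ × ℝ → ℝ × ℝ} {a'' w'' : ℝ} (h : DeepEmb a w a' w' χ)
    (h' : DeepEmb a' w' a'' w'' ρ) : DeepEmb a w a'' w'' (χ ∘ ρ) where
  pos := h'.pos
  lt := h'.lt
  ind := h'.ind
  emb := h.emb.comp h'.emb
  vertex := by rw [Function.comp_apply, h'.vertex, h.vertex]
  good q hq := h.good _ (h'.good q hq)
  inT q hq := h.inT _ (h'.inT q hq)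

theorem exists_deepEmb {ε : ℝ} (hε : 0 < ε) (hw : 0 < w) (hwa : w < 2 * a) (hi : Ind a w) :
    ∃ a' w' χ, DeepEmb a w a' w' χ ∧ a' ≤ ε := by
  obtain ⟨k, hk⟩ : ∃ k : ℕ, a ≤ ε * (4 / 3) ^ k := by
    obtain ⟨k, hk⟩ := pow_unbounded_of_one_lt (a / ε) (show (1 : ℝ) < 4 / 3 by norm_num)
    rw [div_lt_iff₀ hε] at hk
    exact ⟨k, by linarith⟩
  induction k generalizing a w with
  | zero => exact ⟨a, w, id, deepEmb_id hw hwa hi, by simpa using hk⟩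
  | succ k ih =>
    obtain ⟨γ, ω, n, h1, h2, h3⟩ := exists_renorm hw hwa hi
    obtain ⟨γ', ω', n', k1, k2, k3⟩ := exists_renorm h1.om_pos h1.om_lt h2
    have := renorm_two_le h1 k1 k3
    obtain ⟨a', w', χ, hχ, ha'⟩ := ih k1.om_pos k1.om_lt k2 (by rw [pow_succ] at hk; linarith)
    exact ⟨a', w', _, (deepEmb_psi h1 h2 h3).comp ((deepEmb_psi k1 k2 k3).comp hχ), ha'⟩

theorem vertex_mem_derivedSet (hw : 0 < w) (hwa : w < 2 * a) (hi : Ind a w) :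
    (0, 2 * a) ∈ derivedSet {q | Good (StepC a w) q} := by
  refine mem_derivedSet.2 (accPt_iff_frequently.2 (frequently_iff.2 fun {U} hU => ?_))
  obtain ⟨ε, hε, hb⟩ := Metric.mem_nhds_iff.1 hU
  obtain ⟨a', w', χ, hχ, ha'⟩ := exists_deepEmb (show 0 < ε / 9 by positivity) hw hwa hi
  obtain ⟨p, p', h1, h2⟩ := codeGood_plus hχ.pos hχ.lt
  obtain ⟨i1, i2, i3, i4⟩ := h2.1
  have h3 := hχ.lt
  have h0 := hχ.pos
  refine ⟨χ p, hb ?_, fun e => ?_, hχ.good p h1⟩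
  · rw [Metric.mem_ball, ← hχ.vertex]
    refine (hχ.emb.dist_le _ _).trans_lt ?_
    rw [Prod.dist_eq, max_lt_iff, Real.dist_eq, Real.dist_eq, abs_lt, abs_lt]
    refine ⟨⟨?_, ?_⟩, ?_, ?_⟩ <;> simp only <;> linarith
  · rw [← hχ.vertex] at e
    have := hχ.emb.inj e
    rw [this] at i1
    exact lt_irrefl _ i1

/-- The code that moves the acute vertex inside the trapezoid. -/
def pivotCode (a w : ℝ) : Bool × Bool := (decide (a < w), true)

/-- The image of the acute vertex under its admissible code. -/
def pivot (a w : ℝ) : ℝ × ℝ := act a w (pivotCode a w) (0, 2 * a)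

theorem continuous_act (c : Bool × Bool) : Continuous (act a w c) := by
  obtain ⟨_ | _, b⟩ := c
  · change Continuous fun z : ℝ × ℝ => (-z.2 - kap a w b, z.1)
    fun_prop
  · change Continuous fun z : ℝ × ℝ => (z.2 + kap a w b, -z.1)
    fun_prop

theorem act_injective (c : Bool × Bool) : Function.Injective (act a w c) := by
  obtain ⟨_ | _, b⟩ := c <;> intro p q h <;> have h1 := congrArg Prod.fst h <;>
    have h2 := congrArg Prod.snd h <;> simp only [act] at h1 h2 <;> simp at h1 h2 <;>
    ext <;> assumption

theorem isOpen_inT : IsOpen {z | InT a w z} := by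
  simp only [InT]
  refine IsOpen.and (isOpen_lt (by fun_prop) (by fun_prop))
    (IsOpen.and (isOpen_lt (by fun_prop) (by fun_prop))
    (IsOpen.and (isOpen_lt (by fun_prop) (by fun_prop)) (isOpen_lt (by fun_prop) (by fun_prop))))

theorem pivot_eq : pivot a w = (|2 * w - 2 * a|, 0) := by
  by_cases h : a < w
  · rw [abs_of_pos (by linarith)]
    simp [pivot, pivotCode, act, kap, h]
    ring
  · rw [abs_of_nonpos (by linarith)]
    simp [pivot, pivotCode, act, kap, h]
    ring

theorem abs_sub_pos (hi : Ind a w) : 0 < |2 * w - 2 * a| :=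
  abs_pos.2 fun h => ind_ne hi (by linarith)

theorem inT_pivot (hw : 0 < w) (hwa : w < 2 * a) (hi : Ind a w) : InT a w (pivot a w) := by
  rw [pivot_eq]
  have h1 : |2 * w - 2 * a| < 2 * a := by rw [abs_lt]; constructor <;> linarith
  have := abs_sub_pos hi
  refine ⟨?_, ?_, ?_, ?_⟩ <;> simp only <;> linarith

theorem eventually_inT_pivot (hw : 0 < w) (hwa : w < 2 * a) (hi : Ind a w) :
    ∀ᶠ q in 𝓝 (0, 2 * a), InT a w (act a w (pivotCode a w) q) :=
  (continuous_act _).continuousAt.eventually (isOpen_inT.mem_nhds (inT_pivot hw hwa hi))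

theorem good_act {c : Bool × Bool} {q : ℝ × ℝ} (h : Good (StepC a w) q)
    (hc : InT a w (act a w c q)) : Good (StepC a w) (act a w c q) := by
  have hq : InT a w q := by
    obtain ⟨l, hl, h⟩ := h
    cases l with
    | nil => simp at hl
    | cons d l => obtain ⟨m, hm, -⟩ := h; exact hm.1
  exact good_of_good_run (l := [c]) stepC_det (run_singleton.2 ⟨hq, hc, rfl⟩) h

theorem pivot_mem_derivedSet (hw : 0 < w) (hwa : w < 2 * a) (hi : Ind a w) :
    pivot a w ∈ derivedSet {q | Good (StepC a w) q} :=
  mem_derivedSet_of_map (continuous_act _) (act_injective _)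
    ((eventually_inT_pivot hw hwa hi).mono fun _ h1 h2 => good_act h2 h1)
    (vertex_mem_derivedSet hw hwa hi)

theorem pivot_ne_vertex (hi : Ind a w) : pivot a w ≠ (0, 2 * a) := by
  rw [pivot_eq]
  intro h
  exact (abs_sub_pos hi).ne' (congrArg Prod.fst h)

theorem dist_pivot (hw : 0 < w) (hwa : w < 2 * a) : dist (pivot a w) (0, 2 * a) ≤ 2 * a := by
  rw [pivot_eq, Prod.dist_eq]
  refine max_le ?_ ?_ <;> rw [Real.dist_eq]
  · simp only [sub_zero, abs_abs]
    rw [abs_le]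
    constructor <;> linarith
  · rw [abs_le]
    constructor <;> simp only <;> linarith

theorem act_pivotCode_not_collinear (hw : 0 < w) (hwa : w < 2 * a) (hi : Ind a w) {q : ℝ × ℝ}
    (hq : InT a w q) (t : ℝ) :
    act a w (pivotCode a w) q ≠ (0, 2 * a) + t • (pivot a w - (0, 2 * a)) := by
  obtain ⟨i1, i2, i3, i4⟩ := hq
  intro h
  have h1 := congrArg Prod.fst h
  have h2 := congrArg Prod.snd h
  have hb := abs_sub_pos hi
  rw [pivot_eq] at h1 h2
  have hne := ind_ne hi
  by_cases hc : a < w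
  · rw [abs_of_pos (by linarith)] at h1 hb
    simp [pivotCode, act, kap, hc] at h1 h2
    have : 0 < t - 1 := by nlinarith
    nlinarith
  · rw [abs_of_nonpos (by linarith)] at h1 hb
    simp [pivotCode, act, kap, hc] at h1 h2
    have : t - 1 < 0 := by nlinarith
    nlinarith

end

theorem isClosed_of_isLine {L : Set (ℝ × ℝ)} (h : IsLine L) : IsClosed L := by
  obtain ⟨p, v, hv, rfl⟩ := h
  have e : {q : ℝ × ℝ | ∃ t : ℝ, q = p + t • v} =
      {q | (q.1 - p.1) * v.2 = (q.2 - p.2) * v.1} := by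
    ext q
    constructor
    · rintro ⟨t, rfl⟩
      simp only [mem_ofPred_eq, Prod.fst_add, Prod.snd_add, Prod.smul_fst, Prod.smul_snd,
        smul_eq_mul]
      ring
    · intro h
      rw [mem_ofPred_eq] at h
      by_cases h1 : v.1 = 0
      · have h2 : v.2 ≠ 0 := fun h2 => hv (Prod.ext h1 h2)
        refine ⟨(q.2 - p.2) / v.2, Prod.ext ?_ ?_⟩
        · rw [h1, mul_zero] at h
          have := (mul_eq_zero.1 h).resolve_right h2
          simp [h1]
          linarith
        · simp [h2]
      · refine ⟨(q.1 - p.1) / v.1, Prod.ext ?_ ?_⟩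
        · simp [h1]
        · simp
          field_simp
          linarith
  rw [e]
  exact isClosed_eq (by fun_prop) (by fun_prop)

theorem exists_eq_of_isLine {L : Set (ℝ × ℝ)} (h : IsLine L) {x y z : ℝ × ℝ} (hx : x ∈ L)
    (hy : y ∈ L) (hz : z ∈ L) (hne : y ≠ x) : ∃ t : ℝ, z = x + t • (y - x) := by
  obtain ⟨p, v, -, rfl⟩ := h
  obtain ⟨a, rfl⟩ := hx
  obtain ⟨b, rfl⟩ := hy
  obtain ⟨c, rfl⟩ := hz
  have hab : b - a ≠ 0 := fun h => hne (by rw [sub_eq_zero.1 h])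
  refine ⟨(c - a) / (b - a), ?_⟩
  rw [add_sub_add_left_eq_sub, ← sub_smul, smul_smul, div_mul_cancel₀ _ hab, add_assoc,
    ← add_smul]
  congr 2
  ring

theorem not_subset_iUnion_lines {s : ℝ} (h0 : 0 < s) (h1 : s < 1) (hirr : Irrational s) {n : ℕ}
    (L : Fin n → Set (ℝ × ℝ)) (hL : ∀ i, IsLine (L i)) : ¬limitSet s ⊆ ⋃ i, L i := by
  intro hsub
  have hclose : ∀ x : ℝ × ℝ, ∀ᶠ z in 𝓝 x, ∀ i, z ∈ L i → x ∈ L i := fun x =>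
    eventually_all.2 fun i => by
      by_cases hx : x ∈ L i
      · exact Eventually.of_forall fun _ _ => hx
      · filter_upwards [(isClosed_of_isLine (hL i)).isOpen_compl.mem_nhds hx] with z hz hz'
        exact absurd hz' hz
  have hnear : ∀ᶠ z : ℝ × ℝ in 𝓝 (apex s), z.1 + 1 + s < 1 :=
    (isOpen_lt (by fun_prop) (by fun_prop)).mem_nhds (by simp [apex]; linarith)
  have hev := hnear.and (hclose (apex s))
  obtain ⟨δ, hδ, hb⟩ := Metric.mem_nhds_iff.1 hev
  obtain ⟨a, w, φ, hφ⟩ := exists_topEmb h0 h1 hirr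
  obtain ⟨a₁, w₁, χ₁, h₁, hle₁⟩ := exists_deepEmb (show 0 < δ / 3 by positivity)
    hφ.pos hφ.lt hφ.ind
  have hΦ := hφ.emb.comp h₁.emb
  have hv : (φ ∘ χ₁) (0, 2 * a₁) = apex s := by
    rw [Function.comp_apply, h₁.vertex, hφ.apex]
  have hP : (φ ∘ χ₁) (pivot a₁ w₁) ∈ Metric.ball (apex s) δ := by
    rw [Metric.mem_ball, ← hv]
    have := (hΦ.dist_le _ _).trans (dist_pivot h₁.pos h₁.lt)
    linarith
  have hcont : Continuous fun q => (φ ∘ χ₁) (act a₁ w₁ (pivotCode a₁ w₁) q) :=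
    hΦ.continuous.comp (continuous_act _)
  have hev' : ∀ᶠ q in 𝓝 (0, 2 * a₁),
      (∀ i, (φ ∘ χ₁) (act a₁ w₁ (pivotCode a₁ w₁) q) ∈ L i →
        (φ ∘ χ₁) (pivot a₁ w₁) ∈ L i) ∧
      (φ ∘ χ₁) (act a₁ w₁ (pivotCode a₁ w₁) q) ∈ Metric.ball (apex s) δ :=
    hcont.continuousAt.eventually ((hclose _).and (Metric.isOpen_ball.mem_nhds hP))
  obtain ⟨η, hη, hb'⟩ := Metric.mem_nhds_iff.1
    (hev'.and (eventually_inT_pivot h₁.pos h₁.lt h₁.ind))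
  obtain ⟨a₂, w₂, χ₂, h₂, hle₂⟩ := exists_deepEmb (show 0 < η / 3 by positivity)
    h₁.pos h₁.lt h₁.ind
  have hq : χ₂ (pivot a₂ w₂) ∈ Metric.ball (0, 2 * a₁) η := by
    rw [Metric.mem_ball, ← h₂.vertex]
    have := (h₂.emb.dist_le _ _).trans (dist_pivot h₂.pos h₂.lt)
    linarith
  obtain ⟨⟨hq1, hq2⟩, hq3⟩ := hb' hq
  have hd := mem_derivedSet_of_map (B := {q | Good (StepC a₁ w₁) q}) h₂.emb.continuous h₂.emb.inj
    (Eventually.of_forall h₂.good) (pivot_mem_derivedSet h₂.pos h₂.lt h₂.ind)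
  have hacc : (φ ∘ χ₁) (act a₁ w₁ (pivotCode a₁ w₁) (χ₂ (pivot a₂ w₂))) ∈ acc s :=
    mem_derivedSet_of_map (B := {p | GoodH s p}) hcont (hΦ.inj.comp (act_injective _))
      (((continuous_act _).continuousAt.eventually (isOpen_inT.mem_nhds hq3)).mono
        fun q hq hgood => hφ.good _ (h₁.good _ (good_act hgood hq))) hd
  obtain ⟨hz1, hz2⟩ := hb hq2
  obtain ⟨i, hi⟩ := mem_iUnion.1 (hsub (mem_limitSet_near_apex h0 h1 hacc hz1))
  obtain ⟨t, ht⟩ := exists_eq_of_isLine (hL i) (hv ▸ hz2 i hi) (hq1 i hi) hi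
    fun e => pivot_ne_vertex h₁.ind (hΦ.inj e)
  rw [← hΦ.aff] at ht
  exact act_pivotCode_not_collinear h₁.pos h₁.lt h₁.ind
    (h₂.inT _ (inT_pivot h₂.pos h₂.lt h₂.ind)) t (hΦ.inj ht)

end OctPET

/-- For irrational `s ∈ (0,1)`: the orthogonal projection of `Λ̂_s` onto
each of the directions `(1,0)`, `(0,1)`, `(1,1)`, `(1,−1)` contains a nondegenerate
segment; consequently `dimH Λ̂_s ≥ 1`; and `Λ̂_s` is not contained in a finite union of
lines. -/
theorem limitSet_projections_and_dimension (s : ℝ) (hs : s ∈ Ioo (0:ℝ) 1)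
    (hirr : Irrational s) :
    (∀ v ∈ ({(1, 0), (0, 1), (1, 1), (1, -1)} : Set (ℝ × ℝ)),
      ∃ a b : ℝ, a < b ∧ Icc a b ⊆ (fun p => dot2 p v) '' limitSet s) ∧
    1 ≤ dimH (limitSet s) ∧
    ¬∃ (n : ℕ) (L : Fin n → Set (ℝ × ℝ)),
        (∀ i, IsLine (L i)) ∧ limitSet s ⊆ ⋃ i, L i := by
  obtain ⟨h0, h1⟩ := hs
  refine ⟨?_, OctPET.one_le_dimH_limitSet h0 h1 hirr, ?_⟩
  · rintro v (rfl | rfl | rfl | rfl)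
    · exact OctPET.proj_one_zero h0 h1 hirr
    · exact OctPET.proj_zero_one h0 h1 hirr
    · exact OctPET.proj_one_one h0 h1 hirr
    · exact OctPET.proj_one_neg_one h0 h1 hirr
  · rintro ⟨n, L, hL, hsub⟩
    exact OctPET.not_subset_iUnion_lines h0 h1 hirr L hL hsub

end
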